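/- arXiv:1307.2183 — 2 statements merged into one kernel-verified Lean document; each statement's English description precedes it below -/
import Mathlib

section
/- (Shalom) Let n ≥ 4 and let H be the subgroup of SL(n,ℝ) consisting of block matrices diag(A, I_{n−2}) with A ∈ SL(2,ℝ), i.e., SL(2,ℝ) embedded in the upper-left corner. Then there is no discrete subgroup Γ of SL(n,ℝ) whose action by left multiplication on the coset space SL(n,ℝ)/H is free, properly discontinuous and cocompact; i.e., SL(2,ℝ)\SL(n,ℝ) admits no compact Clifford–Klein form for n ≥ 4. -/
open Matrix

/-- The matrix topology on `SL(n, ℝ)`, induced from the space of matrices. -/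
noncomputable instance (n : ℕ) : TopologicalSpace (Matrix.SpecialLinearGroup (Fin n) ℝ) :=
  TopologicalSpace.induced (fun g => (g : Matrix (Fin n) (Fin n) ℝ)) inferInstance


namespace Shalom

instance isTopologicalGroup_frozen (n : ℕ) :
    IsTopologicalGroup (Matrix.SpecialLinearGroup (Fin n) ℝ) :=
  Matrix.SpecialLinearGroup.topologicalGroup

/-- The averaging operator has norm < 1 as soon as there is a spectral gap. -/
theorem hilbert_rigidity {V : Type*} [NormedAddCommGroup V] [InnerProductSpace ℝ V]
    [CompleteSpace V] (A B Z : V →L[ℝ] V)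
    (hA : ∀ v, ‖A v‖ = ‖v‖) (hB : ∀ v, ‖B v‖ = ‖v‖)
    (hAZ : ∀ v, A (Z v) = Z (A v)) (hBZ : ∀ v, B (Z v) = Z (B v))
    (ε : ℝ) (hε : 0 < ε)
    (gap : ∀ v, ε * ‖v‖ ^ 2 ≤ ‖A v - v‖ ^ 2 + ‖B v - v‖ ^ 2)
    (hZ0 : ∀ v, Z v = v → v = 0)
    (bA bB bZ : V) (h1 : A bZ - bZ = Z bA - bA) (h2 : B bZ - bZ = Z bB - bB) :
    ∃ K : ℝ, ∀ (L : V →L[ℝ] V) (bL : V), (∀ v, ‖L v‖ = ‖v‖) → (∀ v, L (Z v) = Z (L v)) →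
      L bZ - bZ = Z bL - bL → ‖bL‖ ≤ K := by
  set T : V →L[ℝ] V := (1/3 : ℝ) • (1 + A + B) with hT
  have key : ∀ v, ‖T v‖ ^ 2 ≤ (1 - ε / 9) * ‖v‖ ^ 2 := by
    intro v
    have e1 : T v = (1/3 : ℝ) • (v + A v + B v) := by simp [hT]
    have e2 : ‖T v‖ ^ 2 = (1/9) * ‖v + A v + B v‖ ^ 2 := by
      rw [e1, norm_smul, mul_pow]; norm_num
    have hAv := hA v
    have hBv := hB v
    have g := gap v
    have q0 : ‖v + A v + B v‖ ^ 2 = ‖v‖^2 + ‖A v‖^2 + ‖B v‖^2 + 2 * inner ℝ v (A v)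
        + 2 * inner ℝ v (B v) + 2 * inner ℝ (A v) (B v) := by
      rw [norm_add_sq_real, norm_add_sq_real, inner_add_left]; ring
    have q1 := norm_sub_sq_real (A v) v
    have q2 := norm_sub_sq_real (B v) v
    have q3 := norm_sub_sq_real (A v) (B v)
    have q4 := sq_nonneg ‖A v - B v‖
    rw [real_inner_comm] at q1 q2
    rw [e2, q0]
    rw [hAv, hBv] at *
    nlinarith
  have hε9 : ε / 9 ≤ 1 ∨ ∀ v : V, v = 0 := by
    by_cases h : ε / 9 ≤ 1
    · exact Or.inl h
    · right
      intro v
      have := key v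
      have h3 : 0 ≤ ‖T v‖ ^ 2 := sq_nonneg _
      push Not at h
      have h4 : ‖v‖ ^ 2 = 0 := by nlinarith [sq_nonneg ‖v‖]
      simpa using h4
  rcases hε9 with hε9 | hz
  swap
  · refine ⟨0, fun L bL _ _ _ => ?_⟩
    rw [hz bL]; simp
  have hTn : ‖T‖ < 1 := by
    have : ‖T‖ ≤ Real.sqrt (1 - ε / 9) := by
      refine ContinuousLinearMap.opNorm_le_bound _ (Real.sqrt_nonneg _) fun v => ?_
      have := Real.sqrt_le_sqrt (key v)
      rwa [Real.sqrt_mul (by linarith), Real.sqrt_sq (norm_nonneg _),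
        Real.sqrt_sq (norm_nonneg _)] at this
    refine this.trans_lt ?_
    rw [Real.sqrt_lt' one_pos]; linarith
  have hu := isUnit_one_sub_of_norm_lt_one hTn
  obtain ⟨S, hS1, hS2⟩ := isUnit_iff_exists.1 hu
  have hS1' : ∀ v, S v - T (S v) = v := fun v => by
    simpa using congrArg (fun f : V →L[ℝ] V => f v) hS1
  have inj : ∀ v w, v - T v = w - T w → v = w := by
    intro v w h
    have hv : S (v - T v) = v := by simpa using congrArg (fun f : V →L[ℝ] V => f v) hS2
    have hw : S (w - T w) = w := by simpa using congrArg (fun f : V →L[ℝ] V => f w) hS2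
    rw [← hv, ← hw, h]
  set Ψ := S (-((1/3 : ℝ) • (bA + bB))) with hΨ
  have hΨ1 : Ψ - T Ψ = -((1/3 : ℝ) • (bA + bB)) := hS1' _
  have TZ : ∀ v, T (Z v) = Z (T v) := fun v => by simp [hT, hAZ, hBZ]
  have hb : bZ = Z Ψ - Ψ := by
    apply inj
    have l1 : bZ - T bZ = -((1/3 : ℝ) • ((A bZ - bZ) + (B bZ - bZ))) := by
      simp only [hT, ContinuousLinearMap.smul_apply, ContinuousLinearMap.add_apply,
        ContinuousLinearMap.one_apply]
      module
    have l2 : Z Ψ - Ψ - T (Z Ψ - Ψ) = Z (Ψ - T Ψ) - (Ψ - T Ψ) := by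
      rw [map_sub, map_sub, TZ]; abel
    rw [l1, l2, hΨ1, h1, h2]
    simp only [map_neg, map_smul, map_add]
    module
  refine ⟨2 * ‖Ψ‖, fun L bL hL hLZ hLb => ?_⟩
  have : bL = L Ψ - Ψ := by
    rw [← sub_eq_zero]
    apply hZ0
    rw [hb, map_sub, hLZ] at hLb
    simp only [map_sub]
    have e : Z bL = bL + (Z (L Ψ) - L Ψ - (Z Ψ - Ψ)) := by rw [hLb]; abel
    rw [e]; abel
  rw [this]
  calc _ ≤ ‖L Ψ‖ + ‖Ψ‖ := norm_sub_le _ _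
    _ = _ := by rw [hL]; ring

end Shalom


namespace Shalom

open MeasureTheory

section koop

variable {G X : Type*} [Group G] [MulAction G X] [MeasurableSpace X] [MeasurableConstSMul G X]
  (μ : Measure X) [SMulInvariantMeasure G X μ]

/-- Koopman operator `v ↦ v(g ·)`. -/
noncomputable def koop (g : G) : Lp ℝ 2 μ →L[ℝ] Lp ℝ 2 μ :=
  (Lp.compMeasurePreservingₗᵢ ℝ (fun x : X => g • x)
    (measurePreserving_smul g μ)).toContinuousLinearMap

theorem koop_norm (g : G) (v : Lp ℝ 2 μ) : ‖koop μ g v‖ = ‖v‖ :=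
  LinearIsometry.norm_map (Lp.compMeasurePreservingₗᵢ ℝ (fun x : X => g • x)
    (measurePreserving_smul g μ)) v

theorem koop_coe (g : G) (v : Lp ℝ 2 μ) : koop μ g v =ᵐ[μ] fun x => v (g • x) :=
  Lp.coeFn_compMeasurePreserving v (measurePreserving_smul g μ)

theorem koop_koop (g h : G) (v : Lp ℝ 2 μ) : koop μ g (koop μ h v) = koop μ (h * g) v := by
  apply Lp.ext
  have h1 := koop_coe μ g (koop μ h v)
  have h2 := (measurePreserving_smul g μ).quasiMeasurePreserving.ae (koop_coe μ h v)
  have h3 := koop_coe μ (h * g) v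
  filter_upwards [h1, h2, h3] with x h1 h2 h3
  rw [h1, h2, h3, mul_smul]

theorem sq_diff_bound (e : X → ℝ) (he : Measurable e) (h0 : ∀ x, 0 ≤ e x) (h1 : ∀ x, e x ≤ 1)
    (v w : Lp ℝ 2 μ) : ∫ x, e x * v x ^ 2 ∂μ - (‖v‖ + ‖w‖) * ‖w - v‖ ≤ ∫ x, e x * w x ^ 2 ∂μ := by
  have iv : ∀ v : Lp ℝ 2 μ, Integrable (fun x => e x * v x ^ 2) μ := by
    intro v
    have := (memLp_two_iff_integrable_sq (Lp.aestronglyMeasurable v)).1 (Lp.memLp v)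
    refine this.bdd_mul (c := 1) he.aestronglyMeasurable (Filter.Eventually.of_forall fun x => ?_)
    rw [Real.norm_eq_abs, abs_of_nonneg (h0 x)]; exact h1 x
  have key : ∫ x, (e x * v x ^ 2 - e x * w x ^ 2) ∂μ ≤ inner ℝ |w - v| |w + v| := by
    rw [L2.inner_def]
    refine integral_mono_ae ((iv v).sub (iv w)) (L2.integrable_inner _ _) ?_
    filter_upwards [Lp.coeFn_abs (w - v), Lp.coeFn_abs (w + v), Lp.coeFn_sub w v, Lp.coeFn_add w v]
      with x a1 a2 a3 a4
    rw [a1, a2, a3, a4]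
    simp only [Pi.sub_apply, Pi.add_apply, RCLike.inner_apply, conj_trivial]
    rw [← abs_mul]
    have : e x * v x ^ 2 - e x * w x ^ 2 = e x * ((v x - w x) * (w x + v x)) := by ring
    rw [this]
    calc e x * ((v x - w x) * (w x + v x)) ≤ e x * |(w x + v x) * (w x - v x)| := by
          apply mul_le_mul_of_nonneg_left _ (h0 x)
          have := neg_abs_le ((w x + v x) * (w x - v x))
          linarith
      _ ≤ 1 * |(w x + v x) * (w x - v x)| := by
          apply mul_le_mul_of_nonneg_right (h1 x) (abs_nonneg _)
      _ = _ := one_mul _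
  rw [integral_sub (iv v) (iv w)] at key
  have k2 := real_inner_le_norm |w - v| |w + v|
  rw [norm_abs_eq_norm, norm_abs_eq_norm] at k2
  have k3 := norm_add_le w v
  nlinarith [norm_nonneg (w - v)]

theorem integral_koop (e : X → ℝ) (g : G) (v : Lp ℝ 2 μ) :
    ∫ x, e x * (koop μ g v) x ^ 2 ∂μ = ∫ x, e (g⁻¹ • x) * v x ^ 2 ∂μ := by
  have h := (measurePreserving_smul g μ).integral_comp
    (measurableEmbedding_const_smul g) (fun x => e (g⁻¹ • x) * v x ^ 2)
  rw [← h]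
  apply integral_congr_ae
  filter_upwards [koop_coe μ g v] with x hx
  simp [hx]

theorem norm_sq_eq (v : Lp ℝ 2 μ) : ‖v‖ ^ 2 = ∫ x, v x ^ 2 ∂μ := by
  rw [← real_inner_self_eq_norm_sq, L2.inner_def]
  congr 1; ext x; simp [sq]

theorem gap_half (e : X → ℝ) (he : Measurable e) (h0 : ∀ x, 0 ≤ e x) (h1 : ∀ x, e x ≤ 1) (a : G)
    (ha : ∀ x, e x + e (a⁻¹ • x) + e (a⁻¹ • a⁻¹ • x) ≤ 1) (v : Lp ℝ 2 μ) :
    3 * ∫ x, e x * v x ^ 2 ∂μ ≤ ‖v‖ ^ 2 + 6 * ‖v‖ * ‖koop μ a v - v‖ := by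
  have iv : ∀ (e : X → ℝ) (he : Measurable e) (h0 : ∀ x, 0 ≤ e x) (h1 : ∀ x, e x ≤ 1),
      Integrable (fun x => e x * v x ^ 2) μ := by
    intro e he h0 h1
    have := (memLp_two_iff_integrable_sq (Lp.aestronglyMeasurable v)).1 (Lp.memLp v)
    refine this.bdd_mul (c := 1) he.aestronglyMeasurable (Filter.Eventually.of_forall fun x => ?_)
    rw [Real.norm_eq_abs, abs_of_nonneg (h0 x)]; exact h1 x
  have b1 := sq_diff_bound μ e he h0 h1 v (koop μ a v)
  have b2 := sq_diff_bound μ e he h0 h1 (koop μ a v) (koop μ a (koop μ a v))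
  rw [← map_sub, koop_norm μ a (koop μ a v - v), koop_norm μ a (koop μ a v), koop_norm] at b2
  rw [koop_norm] at b1
  rw [integral_koop] at b1 b2
  rw [integral_koop, integral_koop] at b2
  have m1 : Measurable fun x => e (a⁻¹ • x) := he.comp (measurable_const_smul a⁻¹)
  have m2 : Measurable fun x => e (a⁻¹ • a⁻¹ • x) := m1.comp (measurable_const_smul a⁻¹)
  have i0 := iv e he h0 h1
  have i1 := iv (fun x => e (a⁻¹ • x)) m1 (fun x => h0 _) (fun x => h1 _)
  have i2 := iv (fun x => e (a⁻¹ • a⁻¹ • x)) m2 (fun x => h0 _) (fun x => h1 _)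
  have i3 := (memLp_two_iff_integrable_sq (Lp.aestronglyMeasurable v)).1 (Lp.memLp v)
  have tot : ∫ x, e x * v x ^ 2 ∂μ + ∫ x, e (a⁻¹ • x) * v x ^ 2 ∂μ
      + ∫ x, e (a⁻¹ • a⁻¹ • x) * v x ^ 2 ∂μ ≤ ‖v‖ ^ 2 := by
    have i01 : Integrable (fun x => e x * v x ^ 2 + e (a⁻¹ • x) * v x ^ 2) μ := i0.add i1
    rw [norm_sq_eq, ← integral_add i0 i1, ← integral_add i01 i2]
    refine integral_mono (i01.add i2) i3 fun x => ?_
    have := ha x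
    simp only [Pi.add_apply]
    nlinarith [sq_nonneg (v x)]
  nlinarith

theorem gap_full (e : X → ℝ) (he : Measurable e) (h0 : ∀ x, 0 ≤ e x) (h1 : ∀ x, e x ≤ 1) (a b : G)
    (ha : ∀ x, e x + e (a⁻¹ • x) + e (a⁻¹ • a⁻¹ • x) ≤ 1)
    (hb : ∀ x, 2 ≤ e x + e (b⁻¹ • x) + e (b⁻¹ • b⁻¹ • x)) (v : Lp ℝ 2 μ) :
    (1 / 72 : ℝ) * ‖v‖ ^ 2 ≤ ‖koop μ a v - v‖ ^ 2 + ‖koop μ b v - v‖ ^ 2 := by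
  have g1 := gap_half μ e he h0 h1 a ha v
  have g2 := gap_half μ (fun x => 1 - e x) (by fun_prop) (fun x => by linarith [h1 x])
    (fun x => by linarith [h0 x]) b (fun x => by linarith [hb x]) v
  have i0 : Integrable (fun x => e x * v x ^ 2) μ := by
    have := (memLp_two_iff_integrable_sq (Lp.aestronglyMeasurable v)).1 (Lp.memLp v)
    refine this.bdd_mul (c := 1) he.aestronglyMeasurable (Filter.Eventually.of_forall fun x => ?_)
    rw [Real.norm_eq_abs, abs_of_nonneg (h0 x)]; exact h1 x
  have i3 := (memLp_two_iff_integrable_sq (Lp.aestronglyMeasurable v)).1 (Lp.memLp v)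
  have : ∫ x, (1 - e x) * v x ^ 2 ∂μ = ‖v‖ ^ 2 - ∫ x, e x * v x ^ 2 ∂μ := by
    rw [norm_sq_eq, ← integral_sub i3 i0]
    congr 1; ext x; ring
  rw [this] at g2
  set d1 := ‖koop μ a v - v‖
  set d2 := ‖koop μ b v - v‖
  have h : ‖v‖ * ‖v‖ ≤ ‖v‖ * (6 * (d1 + d2)) := by nlinarith
  have h3 : ‖v‖ ≤ 6 * (d1 + d2) := by
    by_contra hc
    push Not at hc
    have d1p : 0 ≤ d1 := norm_nonneg _
    have d2p : 0 ≤ d2 := norm_nonneg _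
    have : 0 < ‖v‖ := by linarith
    nlinarith
  have h4 : ‖v‖ ^ 2 ≤ (6 * (d1 + d2)) ^ 2 := pow_le_pow_left₀ (norm_nonneg _) h3 2
  nlinarith [sq_nonneg (d1 - d2)]

end koop

end Shalom


namespace Shalom

set_option linter.unusedSectionVars false
set_option linter.deprecated false

open MeasureTheory
open scoped ENNReal

section partition

variable {Λ G X : Type*} [Group Λ] [Countable Λ] [Group G] [MulAction G X] [MeasurableSpace X]
  [MeasurableConstSMul G X]

/-- Sum of translates of `ρ` over the part `s` of the group. -/
noncomputable def psum (f : Λ →* G) (ρ : X → ℝ≥0∞) (s : Set Λ) (x : X) : ℝ≥0∞ :=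
  ∑' γ : Λ, s.indicator (fun γ => ρ ((f γ)⁻¹ • x)) γ

theorem psum_measurable (f : Λ →* G) (ρ : X → ℝ≥0∞) (hρ : Measurable ρ) (s : Set Λ) :
    Measurable (psum f ρ s) := by
  classical
  unfold psum
  refine Measurable.ennreal_tsum fun γ => ?_
  by_cases h : γ ∈ s
  · simp only [Set.indicator_of_mem h]
    exact hρ.comp (measurable_const_smul _)
  · simp only [Set.indicator_of_notMem h]
    exact measurable_const

theorem psum_smul (f : Λ →* G) (ρ : X → ℝ≥0∞) (s : Set Λ) (a : Λ) (x : X) :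
    psum f ρ s ((f a)⁻¹ • x) = psum f ρ {γ | a⁻¹ * γ ∈ s} x := by
  classical
  unfold psum
  rw [← (Equiv.mulLeft a⁻¹).tsum_eq]
  congr 1
  ext γ
  simp [Set.indicator_apply, mul_smul]

theorem psum_disj (f : Λ →* G) (ρ : X → ℝ≥0∞) (s t : Set Λ) (h : Disjoint s t) (x : X) :
    psum f ρ s x + psum f ρ t x = psum f ρ (s ∪ t) x := by
  unfold psum
  rw [← ENNReal.tsum_add]
  congr 1
  ext γ
  rw [Set.indicator_union_of_disjoint h]

theorem psum_le (f : Λ →* G) (ρ : X → ℝ≥0∞) (s : Set Λ) (x : X) :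
    psum f ρ s x ≤ psum f ρ Set.univ x := by
  unfold psum
  refine ENNReal.tsum_le_tsum fun γ => ?_
  apply Set.indicator_le_indicator_of_subset (Set.subset_univ _) (fun _ => zero_le)

/-- normalized version -/
noncomputable def pfun (f : Λ →* G) (ρ : X → ℝ≥0∞) (s : Set Λ) (x : X) : ℝ :=
  (psum f ρ s x / psum f ρ Set.univ x).toReal

theorem pfun_eq (f : Λ →* G) (ρ : X → ℝ≥0∞) (s : Set Λ) (x : X) :
    pfun f ρ s x = (psum f ρ s x).toReal / (psum f ρ Set.univ x).toReal := ENNReal.toReal_div _ _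

variable (f : Λ →* G) (ρ : X → ℝ≥0∞)

theorem psum_ne_top (ht : ∀ x, psum f ρ Set.univ x ≠ ⊤)
    (s : Set Λ) (x : X) : psum f ρ s x ≠ ⊤ :=
  ne_top_of_le_ne_top (ht x) (psum_le f ρ s x)

theorem pfun_le_one (h0 : ∀ x, psum f ρ Set.univ x ≠ 0) (ht : ∀ x, psum f ρ Set.univ x ≠ ⊤)
    (s : Set Λ) (x : X) : pfun f ρ s x ≤ 1 := by
  rw [pfun_eq]
  have : 0 < (psum f ρ Set.univ x).toReal := ENNReal.toReal_pos (h0 x) (ht x)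
  rw [div_le_one this]
  exact ENNReal.toReal_mono (ht x) (psum_le f ρ s x)

theorem pfun_disj (ht : ∀ x, psum f ρ Set.univ x ≠ ⊤)
    (s t : Set Λ) (h : Disjoint s t) (x : X) :
    pfun f ρ s x + pfun f ρ t x = pfun f ρ (s ∪ t) x := by
  rw [pfun_eq, pfun_eq, pfun_eq, ← psum_disj f ρ s t h,
    ENNReal.toReal_add (psum_ne_top f ρ ht s x) (psum_ne_top f ρ ht t x), add_div]

theorem pfun_smul (s : Set Λ) (a : Λ) (x : X) :
    pfun f ρ s ((f a)⁻¹ • x) = pfun f ρ {γ | a⁻¹ * γ ∈ s} x := by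
  rw [pfun_eq, pfun_eq, psum_smul, psum_smul]; simp

theorem pfun_three (h0 : ∀ x, psum f ρ Set.univ x ≠ 0) (ht : ∀ x, psum f ρ Set.univ x ≠ ⊤)
    (s : Set Λ) (a : Λ) (h1 : ∀ γ ∈ s, a⁻¹ * γ ∉ s)
    (h2 : ∀ γ ∈ s, a⁻¹ * (a⁻¹ * γ) ∉ s) (x : X) :
    pfun f ρ s x + pfun f ρ s ((f a)⁻¹ • x) + pfun f ρ s ((f a)⁻¹ • (f a)⁻¹ • x) ≤ 1 := by
  rw [pfun_smul, pfun_smul, pfun_smul, pfun_disj f ρ ht, pfun_disj f ρ ht]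
  · exact pfun_le_one f ρ h0 ht _ x
  · rw [Set.disjoint_left]
    rintro γ (h | h) h'
    · exact h2 γ h h'
    · exact h1 _ h h'
  · rw [Set.disjoint_left]
    exact h1

theorem pfun_univ (h0 : ∀ x, psum f ρ Set.univ x ≠ 0) (ht : ∀ x, psum f ρ Set.univ x ≠ ⊤)
    (x : X) : pfun f ρ Set.univ x = 1 := by
  have : 0 < (psum f ρ Set.univ x).toReal := ENNReal.toReal_pos (h0 x) (ht x)
  rw [pfun_eq, div_self this.ne']

theorem partition_exists (h0 : ∀ x, psum f ρ Set.univ x ≠ 0) (ht : ∀ x, psum f ρ Set.univ x ≠ ⊤)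
    (hρ : Measurable ρ) (s : Set Λ) (a b : Λ) (h1 : ∀ γ ∈ s, a⁻¹ * γ ∉ s)
    (h2 : ∀ γ ∈ s, a⁻¹ * (a⁻¹ * γ) ∉ s) (h3 : ∀ γ ∉ s, b⁻¹ * γ ∈ s)
    (h4 : ∀ γ ∉ s, b⁻¹ * (b⁻¹ * γ) ∈ s) :
    ∃ e : X → ℝ, Measurable e ∧ (∀ x, 0 ≤ e x) ∧ (∀ x, e x ≤ 1) ∧
      (∀ x, e x + e ((f a)⁻¹ • x) + e ((f a)⁻¹ • (f a)⁻¹ • x) ≤ 1) ∧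
      (∀ x, 2 ≤ e x + e ((f b)⁻¹ • x) + e ((f b)⁻¹ • (f b)⁻¹ • x)) := by
  refine ⟨pfun f ρ s, ?_, fun x => ENNReal.toReal_nonneg, pfun_le_one f ρ h0 ht s,
    pfun_three f ρ h0 ht s a h1 h2, fun x => ?_⟩
  · exact ((psum_measurable f ρ hρ s).div (psum_measurable f ρ hρ _)).ennreal_toReal
  · have key := pfun_three f ρ h0 ht sᶜ b (fun γ h => by simpa using h3 γ h)
      (fun γ h => by simpa using h4 γ h) x
    have c : ∀ y, pfun f ρ sᶜ y = 1 - pfun f ρ s y := fun y => by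
      rw [eq_sub_iff_add_eq, pfun_disj f ρ ht _ _ disjoint_compl_left, Set.compl_union_self,
        pfun_univ f ρ h0 ht]
    rw [c, c, c] at key
    linarith

end partition

section rho

variable {Λ G X : Type*} [Group Λ] [Countable Λ] [Group G] [MulAction G X] [MeasurableSpace X]
  [TopologicalSpace X] [T2Space X] [SigmaCompactSpace X] [BorelSpace X]
  [MeasurableConstSMul G X]

theorem rho_exists (f : Λ →* G)
    (prop : ∀ C : Set X, IsCompact C → {γ : Λ | ∃ x ∈ C, f γ • x ∈ C}.Finite) :
    ∃ ρ : X → ℝ≥0∞, Measurable ρ ∧ (∀ x, psum f ρ Set.univ x ≠ 0) ∧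
      (∀ x, psum f ρ Set.univ x ≠ ⊤) := by
  classical
  set K := compactCovering X
  have hK := isCompact_compactCovering X
  set F : ℕ → Set Λ := fun n => {γ : Λ | ∃ x ∈ K n, f γ • x ∈ K n}
  set N : ℕ → ℝ≥0∞ := fun n => ∑' δ : Λ, (F n).indicator 1 δ
  have hN : ∀ n, N n ≠ ⊤ := by
    intro n
    have hf : (F n).Finite := prop _ (hK n)
    have : N n = ∑ δ ∈ hf.toFinset, (F n).indicator 1 δ := by
      apply tsum_eq_sum
      intro b hb
      rw [Set.indicator_of_notMem]
      simpa using hb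
    rw [this]
    refine (ENNReal.sum_lt_top.2 fun i _ => ?_).ne
    refine lt_of_le_of_lt (Set.indicator_le_self' (fun _ _ => zero_le) i) ?_
    simp
  obtain ⟨c, hc0, hc⟩ := ENNReal.exists_pos_tsum_mul_lt_of_countable (ε := 1) one_ne_zero N hN
  set ρ : X → ℝ≥0∞ := fun x => ∑' n, (c n : ℝ≥0∞) * (K n).indicator 1 x
  refine ⟨ρ, ?_, fun x => ?_, fun x => ?_⟩
  · refine Measurable.ennreal_tsum fun n => ?_
    exact (measurable_one.indicator (hK n).measurableSet).const_mul _
  · obtain ⟨n, hn⟩ : ∃ n, x ∈ K n := by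
      have : x ∈ ⋃ n, K n := by rw [iUnion_compactCovering]; trivial
      simpa using this
    have h1 : (c n : ℝ≥0∞) ≤ ρ x := by
      refine le_trans ?_ (ENNReal.le_tsum n)
      simp [hn]
    have h2 : ρ x ≤ psum f ρ Set.univ x := by
      refine le_trans ?_ (ENNReal.le_tsum (1 : Λ))
      simp
    have : 0 < psum f ρ Set.univ x := lt_of_lt_of_le (by simpa using hc0 n) (h1.trans h2)
    exact this.ne'
  · refine (lt_of_le_of_lt ?_ (hc.trans ENNReal.one_lt_top)).ne
    unfold psum
    simp only [Set.indicator_univ, ρ]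
    rw [ENNReal.tsum_comm]
    refine ENNReal.tsum_le_tsum fun n => ?_
    rw [ENNReal.tsum_mul_left, mul_comm]
    gcongr
    by_cases h : ∃ γ0 : Λ, (f γ0)⁻¹ • x ∈ K n
    · obtain ⟨γ0, h⟩ := h
      rw [← ((Equiv.inv Λ).trans (Equiv.mulLeft γ0)).tsum_eq]
      refine ENNReal.tsum_le_tsum fun δ => ?_
      by_cases h' : δ ∈ F n
      · rw [Set.indicator_of_mem h']
        exact Set.indicator_le_self' (fun _ _ => zero_le) _
      · rw [Set.indicator_of_notMem h', Set.indicator_of_notMem]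
        intro h''
        apply h'
        refine ⟨_, h, ?_⟩
        simpa [mul_smul] using h''
    · push Not at h
      simp [h]

end rho

theorem pp1 (x y : ℤ) (nz : ¬ (x = 0 ∧ y = 0)) (h : |x| ≤ |y|) : ¬ (|x - 3 * y| ≤ |y|) := by
  grind

theorem pp2 (x y : ℤ) (nz : ¬ (x = 0 ∧ y = 0)) (h : |x| ≤ |y|) :
    ¬ (|x - 3 * y - 3 * y| ≤ |y|) := by
  grind

theorem pp3 (x y : ℤ) (h : ¬ |x| ≤ |y|) : |x| ≤ |y - 3 * x| := by
  grind

theorem pp4 (x y : ℤ) (h : ¬ |x| ≤ |y|) : |x| ≤ |y - 3 * x - 3 * x| := by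
  grind

open Matrix in
theorem sl2z_a (a γ : SpecialLinearGroup (Fin 2) ℤ)
    (ha : (a : Matrix (Fin 2) (Fin 2) ℤ) = !![1, 3; 0, 1]) :
      (a⁻¹ * γ) 0 0 = γ 0 0 - 3 * γ 1 0 ∧ (a⁻¹ * γ) 1 0 = γ 1 0 := by
  constructor <;>
  simp [Matrix.SpecialLinearGroup.coe_mul, Matrix.SpecialLinearGroup.coe_inv, ha,
        Matrix.adjugate_fin_two_of, Matrix.mul_apply, Fin.sum_univ_two] <;> ring

open Matrix in
theorem sl2z_b (b γ : SpecialLinearGroup (Fin 2) ℤ)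
    (hb : (b : Matrix (Fin 2) (Fin 2) ℤ) = !![1, 0; 3, 1]) :
      (b⁻¹ * γ) 0 0 = γ 0 0 ∧ (b⁻¹ * γ) 1 0 = γ 1 0 - 3 * γ 0 0 := by
  constructor <;>
  simp [Matrix.SpecialLinearGroup.coe_mul, Matrix.SpecialLinearGroup.coe_inv, hb,
        Matrix.adjugate_fin_two_of, Matrix.mul_apply, Fin.sum_univ_two] <;> ring

open Matrix in
theorem sl2z_nz (γ : SpecialLinearGroup (Fin 2) ℤ) : ¬ (γ 0 0 = 0 ∧ γ 1 0 = 0) := by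
  rintro ⟨h1, h2⟩
  have := γ.det_coe
  rw [Matrix.det_fin_two] at this
  simp [h1, h2] at this

open Matrix in
/-- Ping-pong set. -/
def ppSet : Set (SpecialLinearGroup (Fin 2) ℤ) := {γ | |γ 0 0| ≤ |γ 1 0|}

open Matrix in
theorem mem_ppSet (γ : SpecialLinearGroup (Fin 2) ℤ) : γ ∈ ppSet ↔ |γ 0 0| ≤ |γ 1 0| := Iff.rfl

instance : Countable (Matrix.SpecialLinearGroup (Fin 2) ℤ) :=
  have : Countable (Matrix (Fin 2) (Fin 2) ℤ) := inferInstanceAs (Countable (Fin 2 → Fin 2 → ℤ))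
  Function.Injective.countable (f := fun g : Matrix.SpecialLinearGroup (Fin 2) ℤ =>
      (g : Matrix (Fin 2) (Fin 2) ℤ)) Subtype.coe_injective

open Matrix in
theorem ppA1 (a : SpecialLinearGroup (Fin 2) ℤ)
    (ha : (a : Matrix (Fin 2) (Fin 2) ℤ) = !![1, 3; 0, 1]) (γ : SpecialLinearGroup (Fin 2) ℤ)
    (h : γ ∈ ppSet) : a⁻¹ * γ ∉ ppSet := by
  intro hc
  have h1 := (mem_ppSet _).1 h
  have h2 := (mem_ppSet _).1 hc
  obtain ⟨e1, e2⟩ := sl2z_a a γ ha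
  rw [e1, e2] at h2
  exact pp1 _ _ (sl2z_nz γ) h1 h2

open Matrix in
theorem ppA2 (a : SpecialLinearGroup (Fin 2) ℤ)
    (ha : (a : Matrix (Fin 2) (Fin 2) ℤ) = !![1, 3; 0, 1]) (γ : SpecialLinearGroup (Fin 2) ℤ)
    (h : γ ∈ ppSet) : a⁻¹ * (a⁻¹ * γ) ∉ ppSet := by
  intro hc
  have h1 := (mem_ppSet _).1 h
  have h2 := (mem_ppSet _).1 hc
  obtain ⟨e1, e2⟩ := sl2z_a a γ ha
  obtain ⟨e3, e4⟩ := sl2z_a a (a⁻¹ * γ) ha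
  rw [e3, e4, e1, e2] at h2
  exact pp2 _ _ (sl2z_nz γ) h1 h2

open Matrix in
theorem ppB1 (b : SpecialLinearGroup (Fin 2) ℤ)
    (hb : (b : Matrix (Fin 2) (Fin 2) ℤ) = !![1, 0; 3, 1]) (γ : SpecialLinearGroup (Fin 2) ℤ)
    (h : γ ∉ ppSet) : b⁻¹ * γ ∈ ppSet := by
  apply (mem_ppSet _).2
  have h1 := fun hc => h ((mem_ppSet _).2 hc)
  obtain ⟨e1, e2⟩ := sl2z_b b γ hb
  rw [e1, e2]
  exact pp3 _ _ h1

open Matrix in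
theorem ppB2 (b : SpecialLinearGroup (Fin 2) ℤ)
    (hb : (b : Matrix (Fin 2) (Fin 2) ℤ) = !![1, 0; 3, 1]) (γ : SpecialLinearGroup (Fin 2) ℤ)
    (h : γ ∉ ppSet) : b⁻¹ * (b⁻¹ * γ) ∈ ppSet := by
  apply (mem_ppSet _).2
  have h1 := fun hc => h ((mem_ppSet _).2 hc)
  obtain ⟨e1, e2⟩ := sl2z_b b γ hb
  obtain ⟨e3, e4⟩ := sl2z_b b (b⁻¹ * γ) hb
  rw [e3, e4, e1, e2]
  exact pp4 _ _ h1

theorem sl2z_gap {G X : Type*} [Group G] [MulAction G X] [MeasurableSpace X]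
    [TopologicalSpace X] [T2Space X] [SigmaCompactSpace X] [BorelSpace X]
    [MeasurableConstSMul G X] (μ : Measure X) [SMulInvariantMeasure G X μ]
    (f : Matrix.SpecialLinearGroup (Fin 2) ℤ →* G)
    (prop : ∀ C : Set X, IsCompact C → {γ | ∃ x ∈ C, f γ • x ∈ C}.Finite)
    (a b : Matrix.SpecialLinearGroup (Fin 2) ℤ)
    (ha : (a : Matrix (Fin 2) (Fin 2) ℤ) = !![1, 3; 0, 1])
    (hb : (b : Matrix (Fin 2) (Fin 2) ℤ) = !![1, 0; 3, 1]) (v : Lp ℝ 2 μ) :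
    (1 / 72 : ℝ) * ‖v‖ ^ 2 ≤ ‖koop μ (f a) v - v‖ ^ 2 + ‖koop μ (f b) v - v‖ ^ 2 := by
  obtain ⟨ρ, hρ, h0, ht⟩ := rho_exists f prop
  have p1 : ∀ γ ∈ ppSet, a⁻¹ * γ ∉ ppSet := ppA1 a ha
  have p2 : ∀ γ ∈ ppSet, a⁻¹ * (a⁻¹ * γ) ∉ ppSet := ppA2 a ha
  have p3 : ∀ γ ∉ ppSet, b⁻¹ * γ ∈ ppSet := ppB1 b hb
  have p4 : ∀ γ ∉ ppSet, b⁻¹ * (b⁻¹ * γ) ∈ ppSet := ppB2 b hb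
  obtain ⟨e, he, e0, e1, e2, e3⟩ := partition_exists f ρ h0 ht hρ ppSet a b p1 p2 p3 p4
  exact gap_full μ e he e0 e1 (f a) (f b) e2 e3 v

end Shalom


namespace Shalom

open MeasureTheory Filter Topology
open scoped ENNReal

theorem fixed_zero {G X : Type*} [Group G] [MulAction G X] [MeasurableSpace X]
    [TopologicalSpace X] [T2Space X] [SigmaCompactSpace X] [BorelSpace X]
    [TopologicalSpace G] [ContinuousSMul G X]
    (μ : Measure X) [SMulInvariantMeasure G X μ] [IsLocallyFiniteMeasure μ]
    [μ.InnerRegularCompactLTTop] (z u : G)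
    (hzu : Tendsto (fun k : ℕ => z ^ k * u * (z ^ k)⁻¹) atTop (𝓝 1))
    (hu : ∀ C : Set X, IsCompact C → ∃ m0 : ℕ, 0 < m0 ∧ ∀ m ≥ m0, ∀ x ∈ C, u ^ m • x ∉ C)
    (v : Lp ℝ 2 μ) (hv : koop μ z v = v) : v = 0 := by
  have hzk : ∀ k : ℕ, koop μ (z ^ k) v = v := by
    intro k
    induction k with
    | zero =>
      apply Lp.ext
      filter_upwards [koop_coe μ (z ^ 0) v] with x hx
      simpa using hx
    | succ k ih => rw [pow_succ', ← koop_koop, hv, ih]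
  have hone : koop μ (1 : G) v = v := by simpa using hzk 0
  have hzk' : ∀ k : ℕ, koop μ (z ^ k)⁻¹ v = v := by
    intro k
    conv_lhs => rw [← hzk k, koop_koop, mul_inv_cancel]
    exact hone
  have hn : ∀ k : ℕ, ‖koop μ (z ^ k * u * (z ^ k)⁻¹) v - v‖ = ‖koop μ u v - v‖ := by
    intro k
    rw [← koop_koop, ← koop_koop, hzk]
    conv_lhs => rw [← hzk' k, ← map_sub]
    rw [koop_norm, hzk']
  have hcont : Tendsto (fun k : ℕ => koop μ (z ^ k * u * (z ^ k)⁻¹) v) atTop (𝓝 (koop μ (1 : G) v)) := by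
    let g : C(G, C(X, X)) := (ContinuousMap.mk (fun a : G × X ↦ a.1 • a.2) continuous_smul).curry
    have h1 : Tendsto (fun k : ℕ => g (z ^ k * u * (z ^ k)⁻¹)) atTop (𝓝 (g 1)) :=
      (g.continuous.tendsto 1).comp hzu
    exact Tendsto.compMeasurePreservingLp (tendsto_const_nhds (x := v)) h1
      (fun k => measurePreserving_smul _ μ) (measurePreserving_smul _ μ) (by simp)
  have huv : koop μ u v = v := by
    rw [hone] at hcont
    have h2 := (tendsto_sub_nhds_zero_iff.2 hcont).norm
    simp only [hn, norm_zero] at h2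
    have := tendsto_nhds_unique h2 tendsto_const_nhds
    rw [← sub_eq_zero, ← norm_eq_zero]; exact this.symm
  have huk : ∀ k : ℕ, koop μ (u ^ k) v = v := by
    intro k
    induction k with
    | zero => simpa using hone
    | succ k ih => rw [pow_succ', ← koop_koop, huv, ih]
  set w : X → ℝ≥0∞ := fun x => ‖v x‖ₑ ^ 2 with hw
  have hwint : ∫⁻ x, w x ∂μ < ⊤ := by
    have := (Lp.memLp v).eLpNorm_lt_top
    have h := lintegral_rpow_enorm_lt_top_of_eLpNorm_lt_top two_ne_zero (by simp) this
    simpa [hw] using h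
  have hC : ∀ C : Set X, IsCompact C → ∫⁻ x in C, w x ∂μ = 0 := by
    intro C hC
    obtain ⟨m0, hm0, hm⟩ := hu C hC
    by_contra hne
    have hmeas : ∀ k : ℕ, MeasurableSet ((fun x => u ^ (m0 * k) • x) ⁻¹' C) := fun k =>
      (measurable_const_smul (u ^ (m0 * k))) hC.measurableSet
    have hkey : ∀ k l : ℕ, k < l → Disjoint ((fun x => u ^ (m0 * k) • x) ⁻¹' C)
        ((fun x => u ^ (m0 * l) • x) ⁻¹' C) := by
      intro k l hkl
      rw [Set.disjoint_left]
      intro x h1 h2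
      refine hm (m0 * (l - k)) ?_ _ h1 ?_
      · exact Nat.le_mul_of_pos_right _ (by omega)
      · simp only [smul_smul, ← pow_add, ← mul_add]
        rwa [Nat.sub_add_cancel hkl.le]
    have hdis : Pairwise (Function.onFun Disjoint fun k : ℕ => (fun x => u ^ (m0 * k) • x) ⁻¹' C) := by
      intro k l hkl
      rcases lt_or_gt_of_ne hkl with h | h
      · exact hkey k l h
      · exact (hkey l k h).symm
    have hun := lintegral_iUnion (μ := μ) hmeas hdis w
    have heach : ∀ k : ℕ, ∫⁻ x in (fun x => u ^ (m0 * k) • x) ⁻¹' C, w x ∂μ = ∫⁻ x in C, w x ∂μ := by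
      intro k
      have mp := measurePreserving_smul (u ^ (m0 * k)) μ
      rw [← mp.setLIntegral_comp_preimage_emb (measurableEmbedding_const_smul _) w C]
      apply setLIntegral_congr_fun_ae (hmeas k)
      have h1 := koop_coe μ (u ^ (m0 * k)) v
      rw [huk] at h1
      filter_upwards [h1] with x hx _
      simp only [hw]
      rw [hx]
    simp only [heach] at hun
    rw [ENNReal.tsum_const_eq_top_of_ne_zero hne] at hun
    have := setLIntegral_le_lintegral (μ := μ) (⋃ k, (fun x => u ^ (m0 * k) • x) ⁻¹' C) w
    rw [hun] at this
    exact absurd hwint (by simpa using this)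
  have htot : ∫⁻ x, w x ∂μ = 0 := by
    rw [← setLIntegral_univ, ← iUnion_compactCovering X]
    refine le_antisymm ((lintegral_iUnion_le _ _).trans ?_) zero_le
    simp [hC _ (isCompact_compactCovering X _)]
  apply Lp.ext
  have hwm : AEMeasurable w μ := (Lp.aestronglyMeasurable v).enorm.pow_const 2
  rw [lintegral_eq_zero_iff' hwm] at htot
  filter_upwards [htot, Lp.coeFn_zero ℝ 2 μ] with x h1 h2
  rw [h2]
  simpa [hw] using h1

end Shalom


namespace Shalom

set_option linter.unusedSimpArgs false

open Matrix

/-- squared Frobenius norm -/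
def nb (h : SpecialLinearGroup (Fin 2) ℝ) : ℝ :=
  h 0 0 ^ 2 + h 0 1 ^ 2 + h 1 0 ^ 2 + h 1 1 ^ 2

/-- The matrices `[[2^j, m 2^j],[0, 2^{-j}]]`. -/
noncomputable def qm (t : ℤ × ℤ) : SpecialLinearGroup (Fin 2) ℝ :=
  ⟨!![2 ^ t.1, t.2 * 2 ^ t.1; 0, 2 ^ (-t.1)], by
    rw [Matrix.det_fin_two_of, mul_zero, sub_zero, ← zpow_add₀ two_ne_zero]; simp⟩

/-- weight -/
noncomputable def wt (t : ℤ × ℤ) : ℝ := 4 ^ t.1 * (|(t.2 : ℝ)| + 1)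

/-- the profile function -/
noncomputable def phi (t : ℤ × ℤ) : ℝ := max 0 (1 - wt t)

/-- first row as a complex number -/
def row1 (h : SpecialLinearGroup (Fin 2) ℝ) : ℂ := ⟨h 0 0, h 0 1⟩
/-- second row as a complex number -/
def row2 (h : SpecialLinearGroup (Fin 2) ℝ) : ℂ := ⟨h 1 0, h 1 1⟩

theorem nb_eq (h : SpecialLinearGroup (Fin 2) ℝ) : nb h = ‖row1 h‖ ^ 2 + ‖row2 h‖ ^ 2 := by
  rw [← Complex.normSq_eq_norm_sq, ← Complex.normSq_eq_norm_sq, Complex.normSq_apply,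
    Complex.normSq_apply]
  simp only [nb, row1, row2]; ring

theorem sl2_det (h : SpecialLinearGroup (Fin 2) ℝ) : h 0 0 * h 1 1 - h 0 1 * h 1 0 = 1 := by
  have := h.det_coe
  rwa [Matrix.det_fin_two] at this

theorem rows_sq (h : SpecialLinearGroup (Fin 2) ℝ) :
    ‖row1 h‖ ^ 2 * ‖row2 h‖ ^ 2 = (h 0 0 * h 1 0 + h 0 1 * h 1 1) ^ 2 + 1 := by
  rw [← Complex.normSq_eq_norm_sq, ← Complex.normSq_eq_norm_sq, Complex.normSq_apply,
    Complex.normSq_apply]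
  simp only [row1, row2]
  have h1 : (h 0 0 * h 1 1 - h 0 1 * h 1 0) ^ 2 = 1 := by rw [sl2_det]; norm_num
  linear_combination h1

theorem one_le_rows (h : SpecialLinearGroup (Fin 2) ℝ) : 1 ≤ ‖row1 h‖ * ‖row2 h‖ := by
  have := rows_sq h
  have h2 : 1 ^ 2 ≤ (‖row1 h‖ * ‖row2 h‖) ^ 2 := by
    rw [mul_pow, this]; nlinarith [sq_nonneg (h 0 0 * h 1 0 + h 0 1 * h 1 1)]
  exact le_of_sq_le_sq h2 (by positivity)

theorem row2_pos (h : SpecialLinearGroup (Fin 2) ℝ) : 0 < ‖row2 h‖ := by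
  have := one_le_rows h
  by_contra hc
  have h0 : ‖row2 h‖ = 0 := le_antisymm (not_lt.1 hc) (norm_nonneg _)
  rw [h0] at this
  linarith

theorem sl2_mul (g h : SpecialLinearGroup (Fin 2) ℝ) (i j : Fin 2) :
    (g * h) i j = g i 0 * h 0 j + g i 1 * h 1 j := by
  rw [Matrix.SpecialLinearGroup.coe_mul, Matrix.mul_apply, Fin.sum_univ_two]

theorem qm00 (t : ℤ × ℤ) : (qm t) 0 0 = 2 ^ t.1 := rfl
theorem qm01 (t : ℤ × ℤ) : (qm t) 0 1 = t.2 * 2 ^ t.1 := rfl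
theorem qm10 (t : ℤ × ℤ) : (qm t) 1 0 = 0 := rfl
theorem qm11 (t : ℤ × ℤ) : (qm t) 1 1 = 2 ^ (-t.1) := rfl

theorem sl2_inv (g : SpecialLinearGroup (Fin 2) ℝ) :
    g⁻¹ 0 0 = g 1 1 ∧ g⁻¹ 0 1 = - g 0 1 ∧ g⁻¹ 1 0 = - g 1 0 ∧ g⁻¹ 1 1 = g 0 0 := by
  rw [Matrix.SpecialLinearGroup.coe_inv, Matrix.adjugate_fin_two]
  exact ⟨rfl, rfl, rfl, rfl⟩

theorem row1_q (t : ℤ × ℤ) (h : SpecialLinearGroup (Fin 2) ℝ) :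
    row1 (qm t * h) = ((2 ^ t.1 : ℝ) : ℂ) * (row1 h + ((t.2 : ℝ) : ℂ) * row2 h) := by
  apply Complex.ext
  · rw [Complex.re_ofReal_mul, Complex.add_re, Complex.re_ofReal_mul]
    simp only [row1, row2, sl2_mul, qm00, qm01]; ring
  · rw [Complex.im_ofReal_mul, Complex.add_im, Complex.im_ofReal_mul]
    simp only [row1, row2, sl2_mul, qm00, qm01]; ring

theorem row2_q (t : ℤ × ℤ) (h : SpecialLinearGroup (Fin 2) ℝ) :
    row2 (qm t * h) = ((2 ^ (-t.1) : ℝ) : ℂ) * row2 h := by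
  apply Complex.ext
  · rw [Complex.re_ofReal_mul]
    simp only [row1, row2, sl2_mul, qm10, qm11]; ring
  · rw [Complex.im_ofReal_mul]
    simp only [row1, row2, sl2_mul, qm10, qm11]; ring

theorem norm_row1_q (t : ℤ × ℤ) (h : SpecialLinearGroup (Fin 2) ℝ) :
    ‖row1 (qm t * h)‖ = 2 ^ t.1 * ‖row1 h + ((t.2 : ℝ) : ℂ) * row2 h‖ := by
  rw [row1_q, norm_mul, Complex.norm_real, Real.norm_of_nonneg (by positivity)]

theorem norm_row2_q (t : ℤ × ℤ) (h : SpecialLinearGroup (Fin 2) ℝ) :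
    ‖row2 (qm t * h)‖ = 2 ^ (-t.1) * ‖row2 h‖ := by
  rw [row2_q, norm_mul, Complex.norm_real, Real.norm_of_nonneg (by positivity)]

theorem four_zpow (j : ℤ) : (4 : ℝ) ^ j = 2 ^ j * 2 ^ j := by
  rw [← mul_zpow]; norm_num

/-- Every element of `SL(2,ℝ)` is within bounded distance of some `qm t`. -/
theorem tiling (h : SpecialLinearGroup (Fin 2) ℝ) : ∃ t, nb ((qm t)⁻¹ * h) ≤ 6 := by
  have hp := row2_pos h
  obtain ⟨j, hj1, hj2⟩ := exists_mem_Ico_zpow (x := 4 * ‖row2 h‖ ^ 2) (y := (4 : ℝ))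
    (by positivity) (by norm_num)
  -- use exponent `-j`
  set n2 : ℝ := 4 ^ (-j) * ‖row2 h‖ ^ 2 with hn2
  have h4 : (0 : ℝ) < 4 ^ j := by positivity
  have e1 : n2 * 4 ^ j = ‖row2 h‖ ^ 2 := by
    rw [hn2, mul_right_comm, ← zpow_add₀ (by norm_num)]; simp
  rw [zpow_add_one₀ (by norm_num)] at hj2
  have b1 : 1 / 4 ≤ n2 := by
    by_contra hc; push Not at hc; nlinarith
  have b2 : n2 < 1 := by
    by_contra hc; push Not at hc; nlinarith
  set D : ℝ := h 0 0 * h 1 0 + h 0 1 * h 1 1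
  set m : ℤ := round (D / n2)
  have hm : |D - m * n2| ≤ n2 / 2 := by
    have := abs_sub_round (D / n2)
    have e : D - m * n2 = n2 * (D / n2 - round (D / n2)) := by
      field_simp
      simp only [m]
      ring
    rw [e, abs_mul, abs_of_pos (by linarith)]
    nlinarith
  refine ⟨(-j, m), ?_⟩
  set c := (qm (-j, m))⁻¹ * h with hc
  have hqc : qm (-j, m) * c = h := by rw [hc, mul_inv_cancel_left]
  have r2 : ‖row2 c‖ ^ 2 = n2 := by
    have := norm_row2_q (-j, m) c
    rw [hqc] at this
    rw [hn2, this, four_zpow, mul_pow]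
    simp only [neg_neg]
    have : (2 : ℝ) ^ (-j) * 2 ^ j = 1 := by rw [← zpow_add₀ two_ne_zero]; simp
    linear_combination (-‖row2 c‖ ^ 2 * (2 ^ (-j) * 2 ^ j + 1)) * this
  have hD : D = (c 0 0 * c 1 0 + c 0 1 * c 1 1) + m * n2 := by
    rw [← r2, ← Complex.normSq_eq_norm_sq, Complex.normSq_apply]
    have k00 : h 0 0 = 2 ^ (-j) * (c 0 0 + m * c 1 0) := by
      rw [← hqc, sl2_mul, qm00, qm01]; ring
    have k01 : h 0 1 = 2 ^ (-j) * (c 0 1 + m * c 1 1) := by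
      rw [← hqc, sl2_mul, qm00, qm01]; ring
    have k10 : h 1 0 = 2 ^ j * (c 1 0) := by
      rw [← hqc, sl2_mul, qm10, qm11]; simp
    have k11 : h 1 1 = 2 ^ j * (c 1 1) := by
      rw [← hqc, sl2_mul, qm10, qm11]; simp
    have : (2 : ℝ) ^ (-j) * 2 ^ j = 1 := by rw [← zpow_add₀ two_ne_zero]; simp
    simp only [D, k00, k01, k10, k11, row2]
    linear_combination ((c 0 0 + m * c 1 0) * c 1 0 + (c 0 1 + m * c 1 1) * c 1 1) * this
  have hs := rows_sq c
  have hin : (c 0 0 * c 1 0 + c 0 1 * c 1 1) ^ 2 ≤ 1 / 4 := by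
    have e : c 0 0 * c 1 0 + c 0 1 * c 1 1 = D - m * n2 := by linarith
    rw [e, ← sq_abs]
    have := abs_nonneg (D - m * n2)
    nlinarith
  rw [nb_eq, r2]
  rw [r2] at hs
  have : ‖row1 c‖ ^ 2 ≤ 5 := by
    nlinarith [sq_nonneg ‖row1 c‖]
  linarith

theorem qinv_q (t t' : ℤ × ℤ) : nb ((qm t)⁻¹ * qm t') =
    4 ^ (t'.1 - t.1) + 4 ^ (t.1 - t'.1) +
      (t'.2 * 2 ^ (t'.1 - t.1) - t.2 * 2 ^ (t.1 - t'.1)) ^ 2 := by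
  have e : ∀ a b : ℤ, (2 : ℝ) ^ (a - b) = 2 ^ a * 2 ^ (-b) := fun a b => by
    rw [← zpow_add₀ two_ne_zero]; rfl
  have c1 : (2 : ℝ) ^ (-t.1) * 2 ^ t.1 = 1 := by rw [← zpow_add₀ two_ne_zero]; simp
  rw [four_zpow, four_zpow, e, e]
  obtain ⟨i1, i2, i3, i4⟩ := sl2_inv (qm t)
  simp only [nb, sl2_mul, i1, i2, i3, i4, qm00, qm01, qm10, qm11]
  ring

end Shalom


namespace Shalom

open Matrix
open scoped ENNReal

theorem two_zpow_sub (a b : ℤ) : (2 : ℝ) ^ (a - b) * 2 ^ (b - a) = 1 := by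
  rw [← zpow_add₀ two_ne_zero]; simp

theorem four_zpow_sub (a b : ℤ) : (4 : ℝ) ^ a = 4 ^ (a - b) * 4 ^ b := by
  rw [← zpow_add₀ (by norm_num)]; simp

theorem wt_diff {R : ℝ} (hR : 1 ≤ R) {t t' : ℤ × ℤ} (h : nb ((qm t)⁻¹ * qm t') ≤ R) :
    |wt t' - wt t| ≤ 2 * R * 4 ^ t.1 ∧ (4 : ℝ) ^ t.1 ≤ R * 4 ^ t'.1 := by
  rw [qinv_q] at h
  set p : ℝ := 2 ^ (t'.1 - t.1) with hp
  set r : ℝ := 2 ^ (t.1 - t'.1) with hr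
  have hpr : p * r = 1 := two_zpow_sub _ _
  have e1 : (4 : ℝ) ^ (t'.1 - t.1) = p * p := four_zpow _
  have e2 : (4 : ℝ) ^ (t.1 - t'.1) = r * r := four_zpow _
  have f1 : (4 : ℝ) ^ t'.1 = p * p * 4 ^ t.1 := by rw [four_zpow_sub t'.1 t.1, e1]
  have f2 : (4 : ℝ) ^ t.1 = r * r * 4 ^ t'.1 := by rw [four_zpow_sub t.1 t'.1, e2]
  rw [e1, e2] at h
  have hpos : (0 : ℝ) < 4 ^ t.1 := by positivity
  have hpos' : (0 : ℝ) < 4 ^ t'.1 := by positivity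
  have hpp : 0 < p := by positivity
  have hrr : 0 < r := by positivity
  set d : ℝ := t'.2 * p - t.2 * r with hd
  have pR : p * p ≤ R := by nlinarith [sq_nonneg d, sq_nonneg r]
  have rR : r * r ≤ R := by nlinarith [sq_nonneg d, sq_nonneg p]
  have dR : d ^ 2 ≤ R := by nlinarith
  constructor
  · have pd : |p * d| ≤ R := by
      apply abs_le_of_sq_le_sq _ (by linarith)
      rw [mul_pow]; nlinarith [sq_nonneg d]
    have k : wt t' - wt t = (|(t'.2 : ℝ) * 4 ^ t'.1| - |(t.2 : ℝ) * 4 ^ t.1|)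
        + (4 ^ t'.1 - 4 ^ t.1) := by
      rw [abs_mul, abs_mul, abs_of_pos hpos, abs_of_pos hpos']
      simp only [wt]; ring
    have k1 : |(t'.2 : ℝ) * 4 ^ t'.1 - (t.2 : ℝ) * 4 ^ t.1| ≤ R * 4 ^ t.1 := by
      have : (t'.2 : ℝ) * 4 ^ t'.1 - (t.2 : ℝ) * 4 ^ t.1 = (p * d) * 4 ^ t.1 := by
        rw [f1, hd]; linear_combination (-(4 : ℝ) ^ t.1 * t.2) * (-hpr)
      rw [this, abs_mul, abs_of_pos hpos]
      exact mul_le_mul_of_nonneg_right pd hpos.le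
    have k2 : |(4 : ℝ) ^ t'.1 - 4 ^ t.1| ≤ R * 4 ^ t.1 := by
      rw [abs_le]; constructor
      · nlinarith
      · rw [f1]; nlinarith
    rw [k]
    calc _ ≤ |(|(t'.2 : ℝ) * 4 ^ t'.1| - |(t.2 : ℝ) * 4 ^ t.1|)| + |(4 : ℝ) ^ t'.1 - 4 ^ t.1| :=
          abs_add_le _ _
      _ ≤ |(t'.2 : ℝ) * 4 ^ t'.1 - (t.2 : ℝ) * 4 ^ t.1| + |(4 : ℝ) ^ t'.1 - 4 ^ t.1| := by
          gcongr ?_ + _; exact abs_abs_sub_abs_le _ _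
      _ ≤ _ := by linarith
  · rw [f2]; nlinarith

theorem phi_diff_abs (t t' : ℤ × ℤ) : |phi t' - phi t| ≤ |wt t' - wt t| := by
  unfold phi
  have := abs_max_sub_max_le_abs (1 - wt t') (1 - wt t) 0
  rw [max_comm 0, max_comm 0]
  refine this.trans ?_
  rw [sub_sub_sub_cancel_left, abs_sub_comm]

theorem four_le_wt (t : ℤ × ℤ) : (4 : ℝ) ^ t.1 ≤ wt t := by
  unfold wt
  have : (0 : ℝ) < 4 ^ t.1 := by positivity
  nlinarith [abs_nonneg (t.2 : ℝ)]

/-- dominating coefficients -/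
noncomputable def cf (R : ℝ) (t : ℤ × ℤ) : ℝ :=
  if wt t ≤ 1 + 2 * R ^ 2 then 4 * R ^ 2 * (4 ^ t.1 * 4 ^ t.1) else 0

theorem phi_diff {R : ℝ} (hR : 1 ≤ R) {t t' : ℤ × ℤ} (h : nb ((qm t)⁻¹ * qm t') ≤ R) :
    (phi t' - phi t) ^ 2 ≤ cf R t := by
  obtain ⟨h1, h2⟩ := wt_diff hR h
  unfold cf
  split_ifs with hw
  · have h3 := (phi_diff_abs t t').trans h1
    rw [← sq_abs]
    have := abs_nonneg (phi t' - phi t)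
    calc _ ≤ (2 * R * 4 ^ t.1) ^ 2 := pow_le_pow_left₀ this h3 2
      _ = _ := by ring
  · push Not at hw
    have w1 : 1 ≤ wt t := by nlinarith
    have w2 : 1 ≤ wt t' := by
      by_contra hc
      push Not at hc
      have f := four_le_wt t'
      have := (abs_le.1 h1).1
      nlinarith
    have e1 : phi t = 0 := max_eq_left (by linarith)
    have e2 : phi t' = 0 := max_eq_left (by linarith)
    rw [e1, e2]; norm_num

theorem summable_cf (R : ℝ) (hR : 1 ≤ R) : Summable (cf R) := by
  set C : ℝ := 1 + 2 * R ^ 2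
  have hC : 1 ≤ C := by simp only [C]; nlinarith
  have s1 : Summable (fun j : ℤ => ((1/2 : ℝ)) ^ j.natAbs) := by
    rw [summable_int_iff_summable_nat_and_neg]
    constructor <;> simpa using summable_geometric_two
  have s2 : Summable (fun m : ℤ => ((|(m : ℝ)| + 1) ^ (3/2 : ℝ))⁻¹) := by
    have := (summable_nat_add_iff 1).2 (Real.summable_nat_rpow_inv.2 (by norm_num : (1 : ℝ) < 3/2))
    rw [summable_int_iff_summable_nat_and_neg]
    constructor <;> simpa using this
  have s3 := (Summable.mul_of_nonneg s1 s2 (fun _ => by positivity) (fun _ => by positivity)).mul_left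
    (4 * R ^ 2 * (C * C ^ (3/2 : ℝ)))
  refine Summable.of_nonneg_of_le (fun t => ?_) (fun t => ?_) s3
  · unfold cf; split_ifs <;> positivity
  · unfold cf
    split_ifs with hw
    swap
    · positivity
    rw [mul_assoc (4 * R ^ 2)]
    rw [show ((4 * R ^ 2) * (4 ^ t.1 * 4 ^ t.1) : ℝ) = (4 * R ^ 2) * (2 ^ t.1 * (2 ^ t.1 * 4 ^ t.1)) by
      rw [four_zpow]; ring]
    refine mul_le_mul_of_nonneg_left ?_ (by positivity)
    have a1 : (2 : ℝ) ^ t.1 ≤ C * (1/2) ^ t.1.natAbs := by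
      rcases le_total 0 t.1 with h | h
      · obtain ⟨n, hn⟩ := Int.eq_ofNat_of_zero_le h
        have h4 := (four_le_wt t).trans hw
        rw [four_zpow] at h4
        rw [hn] at h4 ⊢
        simp only [zpow_natCast, Int.natAbs_natCast] at h4 ⊢
        rw [one_div, inv_pow, ← div_eq_mul_inv, le_div_iff₀ (by positivity)]
        exact h4
      · obtain ⟨n, hn⟩ := Int.eq_ofNat_of_zero_le (neg_nonneg.2 h)
        have : t.1 = -n := by omega
        rw [this, _root_.zpow_neg]
        simp only [zpow_natCast, Int.natAbs_neg, Int.natAbs_natCast, one_div, inv_pow]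
        have : (0 : ℝ) < (2 ^ n)⁻¹ := by positivity
        nlinarith
    have a2 : (2 : ℝ) ^ t.1 * 4 ^ t.1 ≤ C ^ (3/2 : ℝ) * ((|(t.2 : ℝ)| + 1) ^ (3/2 : ℝ))⁻¹ := by
      rw [← div_eq_mul_inv, le_div_iff₀ (by positivity)]
      have e : (2 : ℝ) ^ t.1 * 4 ^ t.1 = (4 ^ t.1) ^ (3/2 : ℝ) := by
        rw [four_zpow, ← sq, ← Real.rpow_natCast, ← Real.rpow_mul (by positivity)]
        norm_num
        ring
      rw [e, ← Real.mul_rpow (by positivity) (by positivity)]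
      exact Real.rpow_le_rpow (by positivity) hw (by norm_num)
    calc (2 : ℝ) ^ t.1 * (2 ^ t.1 * 4 ^ t.1) ≤ (C * (1/2) ^ t.1.natAbs) *
          (C ^ (3/2 : ℝ) * ((|(t.2 : ℝ)| + 1) ^ (3/2 : ℝ))⁻¹) := by gcongr
      _ = _ := by ring

/-- the ratio of the lengths of the rows -/
noncomputable def ratio (M : SpecialLinearGroup (Fin 2) ℝ) : ℝ := ‖row1 M‖ / ‖row2 M‖

theorem phi_vanish {R : ℝ} (hR : 1 ≤ R) {t t' : ℤ × ℤ} (M : SpecialLinearGroup (Fin 2) ℝ)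
    (h : nb ((qm t')⁻¹ * (qm t * M)) ≤ R) (hm : (4 : ℝ) ^ t.1 * |(t.2 : ℝ)| ≤ 1)
    (hP : R + 1 ≤ 4 ^ t.1 * ratio M) : phi t' = 0 := by
  set c := (qm t')⁻¹ * (qm t * M) with hc
  have hqc : qm t' * c = qm t * M := by rw [hc, mul_inv_cancel_left]
  have n1 := norm_row1_q t' c
  have n2 := norm_row2_q t' c
  rw [hqc, norm_row1_q] at n1
  rw [hqc, norm_row2_q] at n2
  have hM := row2_pos M
  have hcp := row2_pos c
  have hone := one_le_rows c
  rw [nb_eq] at h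
  set r1 := ‖row1 M‖
  set r2 := ‖row2 M‖
  set c1 := ‖row1 c‖
  set c2 := ‖row2 c‖
  have hc1 : 0 ≤ c1 := norm_nonneg _
  have c12 : c1 ≤ R * c2 := by nlinarith
  have tr1 : r1 - |(t.2 : ℝ)| * r2 ≤ ‖row1 M + ((t.2 : ℝ) : ℂ) * row2 M‖ := by
    have := norm_sub_norm_le (row1 M) (-(((t.2 : ℝ) : ℂ) * row2 M))
    rw [sub_neg_eq_add, norm_neg, norm_mul, Complex.norm_real, Real.norm_eq_abs] at this
    exact this
  have tr2 : ‖row1 c + ((t'.2 : ℝ) : ℂ) * row2 c‖ ≤ c1 + |(t'.2 : ℝ)| * c2 := by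
    have := norm_add_le (row1 c) (((t'.2 : ℝ) : ℂ) * row2 c)
    rw [norm_mul, Complex.norm_real, Real.norm_eq_abs] at this
    exact this
  have i1 : (2 : ℝ) ^ (-t.1) * 2 ^ t.1 = 1 := by rw [← zpow_add₀ two_ne_zero]; simp
  have i2 : (2 : ℝ) ^ (-t'.1) * 2 ^ t'.1 = 1 := by rw [← zpow_add₀ two_ne_zero]; simp
  have p1 : (0 : ℝ) < 2 ^ t.1 := by positivity
  have p2 : (0 : ℝ) < 2 ^ t'.1 := by positivity
  set a : ℝ := 2 ^ t.1
  set b : ℝ := 2 ^ t'.1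
  have ec2 : c2 * a = b * r2 := by
    linear_combination (-a * b) * n2 + (b * r2) * i1 - (c2 * a) * i2
  have w : 1 ≤ wt t' := by
    have s1 : a * (r1 - |(t.2 : ℝ)| * r2) ≤ b * (R * (|(t'.2 : ℝ)| + 1) * c2) := by
      calc _ ≤ a * ‖row1 M + ((t.2 : ℝ) : ℂ) * row2 M‖ := by gcongr
        _ = b * ‖row1 c + ((t'.2 : ℝ) : ℂ) * row2 c‖ := n1
        _ ≤ b * (c1 + |(t'.2 : ℝ)| * c2) := by gcongr
        _ ≤ _ := by
          gcongr
          nlinarith [mul_nonneg (abs_nonneg (t'.2 : ℝ)) hcp.le]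
    have s2 : a * a * (r1 - |(t.2 : ℝ)| * r2) ≤ R * wt t' * r2 := by
      have : R * wt t' * r2 = a * (b * (R * (|(t'.2 : ℝ)| + 1) * c2)) := by
        simp only [wt, four_zpow]
        linear_combination (-b * R * (|(t'.2 : ℝ)| + 1)) * ec2
      rw [this, mul_assoc]
      gcongr
    rw [four_zpow] at hm hP
    have e : ratio M * r2 = r1 := div_mul_cancel₀ _ hM.ne'
    have s3 : a * a * ratio M - a * a * |(t.2 : ℝ)| ≤ R * wt t' := by
      have : (a * a * ratio M - a * a * |(t.2 : ℝ)|) * r2 ≤ (R * wt t') * r2 := by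
        calc _ = a * a * (r1 - |(t.2 : ℝ)| * r2) := by rw [← e]; ring
          _ ≤ _ := s2
      exact le_of_mul_le_mul_right this hM
    have : R * 1 ≤ R * wt t' := by linarith
    exact le_of_mul_le_mul_left this (by linarith)
  exact max_eq_left (by linarith)

theorem phi_large {R : ℝ} (hR : 1 ≤ R) {t t' : ℤ × ℤ} (h : nb ((qm t)⁻¹ * qm t') ≤ R)
    (hm : (4 : ℝ) ^ t.1 * |(t.2 : ℝ)| ≤ 1 / 8) (h4 : (4 : ℝ) ^ t.1 ≤ 1 / (8 * R)) :
    1 / 2 ≤ phi t' := by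
  have h1 := (wt_diff hR h).1
  have h2 : R * (4 : ℝ) ^ t.1 ≤ 1 / 8 := by
    have := mul_le_mul_of_nonneg_left h4 (by linarith : (0 : ℝ) ≤ R)
    refine this.trans_eq ?_
    field_simp
  have h3 : (4 : ℝ) ^ t.1 ≤ 1 / 8 := by
    have : (0 : ℝ) < 4 ^ t.1 := by positivity
    nlinarith
  have h5 : wt t ≤ 1 / 4 := by unfold wt; linarith
  have := (abs_le.1 h1).2
  unfold phi
  refine le_max_of_le_right ?_
  linarith

end Shalom


namespace Shalom
open MeasureTheory Filter Topology
open scoped ENNReal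

theorem count_lower {R : ℝ} (hR : 1 ≤ R) (P : ℝ) (a : ℤ × ℤ → ℝ≥0∞)
    (ha : ∀ t : ℤ × ℤ, (4 : ℝ) ^ t.1 * |(t.2 : ℝ)| ≤ 1/8 → (4 : ℝ) ^ t.1 ≤ 1/(8*R) →
      R + 1 ≤ 4 ^ t.1 * P → ENNReal.ofReal (1/4) ≤ a t) :
    ENNReal.ofReal (P / (128 * (R+1))) ≤ (∑' t, a t) + ENNReal.ofReal (R/4) := by
  by_cases hP : P < 32 * R * (R+1)
  · refine le_trans ?_ le_add_self
    apply ENNReal.ofReal_le_ofReal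
    rw [div_le_iff₀ (by positivity)]
    nlinarith
  push Not at hP
  have hP0 : 0 < P := lt_of_lt_of_le (by positivity) hP
  refine le_trans ?_ le_self_add
  obtain ⟨j, hj1, hj2⟩ := exists_mem_Ioc_zpow (x := P / (R+1)) (y := (4:ℝ)) (by positivity)
    (by norm_num)
  have hj0 : (0:ℝ) < 4 ^ j := by positivity
  have e2 : (4:ℝ) ^ (j+1) = 4^j * 4 := by
    rw [zpow_add₀ (by norm_num)]; simp
  rw [e2] at hj2
  have e1 : (4:ℝ) ^ (-j) = (4^j)⁻¹ := _root_.zpow_neg _ _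
  have hge : 8 * R ≤ 4 ^ j := by
    rw [div_le_iff₀ (by positivity)] at hj2
    have : (0:ℝ) < R + 1 := by positivity
    nlinarith
  let S : Finset (ℤ × ℤ) := (Finset.range (⌊(4:ℝ)^j/8⌋₊ + 1)).image
    (fun m : ℕ => ((-j : ℤ), (m : ℤ)))
  have hS : S.card = ⌊(4:ℝ)^j/8⌋₊ + 1 := by
    rw [Finset.card_image_of_injective, Finset.card_range]
    intro m m' h
    simpa using h
  calc ENNReal.ofReal (P / (128 * (R+1))) ≤ ENNReal.ofReal ((S.card : ℝ) * (1/4)) := by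
        apply ENNReal.ofReal_le_ofReal
        have := Nat.lt_floor_add_one ((4:ℝ)^j/8)
        rw [hS]; push_cast
        have h2 : P / (128 * (R+1)) = P / (R+1) / 128 := by field_simp
        rw [h2]; linarith
    _ = ∑ t ∈ S, ENNReal.ofReal (1/4) := by
        rw [Finset.sum_const, nsmul_eq_mul, ENNReal.ofReal_mul (by positivity),
          ENNReal.ofReal_natCast]
    _ ≤ ∑ t ∈ S, a t := by
        apply Finset.sum_le_sum
        intro t ht
        simp only [S, Finset.mem_image, Finset.mem_range] at ht
        obtain ⟨m, hm, rfl⟩ := ht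
        have hm' : (m:ℝ) ≤ 4^j/8 := (Nat.le_floor_iff (by positivity)).1 (by omega)
        apply ha
        · simp only [Int.cast_natCast, Nat.abs_cast, e1]
          rw [inv_mul_le_iff₀ hj0]; linarith
        · simp only [e1]
          rw [one_div]
          gcongr
        · simp only [e1]
          rw [lt_div_iff₀ (by positivity)] at hj1
          rw [← div_eq_inv_mul, le_div_iff₀ hj0]
          linarith
    _ ≤ ∑' t, a t := ENNReal.sum_le_tsum S

theorem multiplicity {R : ℝ} (hR : 1 ≤ R) : ∃ N : ℕ, ∀ t : ℤ × ℤ, ∃ S : Finset (ℤ × ℤ),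
    S.card ≤ N ∧ ∀ t', nb ((qm t)⁻¹ * qm t') ≤ R → t' ∈ S := by
  let J : ℤ := ⌈R⌉
  let E : ℤ := ⌈R^2⌉ + 1
  refine ⟨((Finset.Icc (-J) J) ×ˢ (Finset.Icc (-E) E)).card, fun t =>
    ⟨((Finset.Icc (-J) J) ×ˢ (Finset.Icc (-E) E)).image
      (fun p => (t.1 + p.1, ⌊(t.2 : ℝ) * 4 ^ (-p.1)⌋ + p.2)), Finset.card_image_le, ?_⟩⟩
  intro t' h
  rw [qinv_q] at h
  set d := t'.1 - t.1 with hd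
  have hnd : t.1 - t'.1 = -d := by ring
  rw [hnd] at h
  have hpos : (0:ℝ) < 4 ^ d := by positivity
  have hpos' : (0:ℝ) < 4 ^ (-d) := by positivity
  have p2 : (0:ℝ) < 2 ^ d := by positivity
  have p2' : (0:ℝ) < 2 ^ (-d) := by positivity
  have hb : ∀ k : ℤ, (4:ℝ)^k ≤ R → k ≤ J := by
    intro k hk
    rcases le_total 0 k with h0 | h0
    · obtain ⟨n, rfl⟩ := Int.eq_ofNat_of_zero_le h0
      have : (n:ℝ) < 4 ^ n := by exact_mod_cast Nat.lt_pow_self (by norm_num)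
      have h3 : ((n:ℤ):ℝ) ≤ J := by
        refine le_trans ?_ (Int.le_ceil R)
        simp only [zpow_natCast] at hk
        push_cast; linarith
      exact_mod_cast h3
    · exact h0.trans (Int.ceil_nonneg (by linarith))
  have d1 : d ≤ J := hb d (by nlinarith [sq_nonneg ((t'.2:ℝ) * 2^d - t.2 * 2^(-d))])
  have d2 : -d ≤ J := hb (-d) (by nlinarith [sq_nonneg ((t'.2:ℝ) * 2^d - t.2 * 2^(-d))])
  have h4 : ((t'.2:ℝ) * 2^d - t.2 * 2^(-d))^2 ≤ R^2 := by nlinarith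
  have h5 := abs_le_of_sq_le_sq h4 (by linarith)
  have h6 : (2:ℝ)^(-d) ≤ R := by
    have : (2:ℝ)^(-d) * 2^(-d) ≤ R^2 := by
      rw [← mul_zpow, show (2:ℝ)*2 = 4 by norm_num]
      nlinarith [sq_nonneg ((t'.2:ℝ) * 2^d - t.2 * 2^(-d))]
    nlinarith
  have hm1 : (2:ℝ)^d * 2^(-d) = 1 := by rw [← zpow_add₀ (by norm_num)]; simp
  have hm2 : (2:ℝ)^(-d) * 2^(-d) = 4^(-d) := by rw [← mul_zpow]; norm_num
  have h7 : |(t'.2:ℝ) - t.2 * 4^(-d)| ≤ R^2 := by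
    have : (t'.2:ℝ) - t.2 * 4^(-d) = ((t'.2:ℝ) * 2^d - t.2 * 2^(-d)) * 2^(-d) := by
      rw [← hm2]; linear_combination -(t'.2:ℝ) * hm1
    rw [this, abs_mul, abs_of_pos p2', sq]
    gcongr
  simp only [Finset.mem_image, Finset.mem_product, Finset.mem_Icc]
  refine ⟨(d, t'.2 - ⌊(t.2 : ℝ) * 4 ^ (-d)⌋), ⟨⟨by linarith, d1⟩, ?_⟩, ?_⟩
  · rw [abs_le] at h7
    have f1 := Int.floor_le ((t.2 : ℝ) * 4 ^ (-d))
    have f2 := Int.lt_floor_add_one ((t.2 : ℝ) * 4 ^ (-d))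
    have f3 := Int.le_ceil (R^2)
    constructor
    · have : ((-E : ℤ):ℝ) ≤ ((t'.2 - ⌊(t.2 : ℝ) * 4 ^ (-d)⌋ : ℤ) : ℝ) := by
        simp only [E]; push_cast; linarith
      exact_mod_cast this
    · have : ((t'.2 - ⌊(t.2 : ℝ) * 4 ^ (-d)⌋ : ℤ) : ℝ) ≤ ((E : ℤ):ℝ) := by
        simp only [E]; push_cast; linarith
      exact_mod_cast this
  · ext <;> simp [hd]

end Shalom


namespace Shalom
open MeasureTheory Filter Topology
open Matrix hiding zpow_neg
open scoped ENNReal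

/-- rotation -/
noncomputable def rot (θ : ℝ) : SpecialLinearGroup (Fin 2) ℝ :=
  ⟨!![Real.cos θ, -Real.sin θ; Real.sin θ, Real.cos θ], by
    rw [Matrix.det_fin_two_of]; nlinarith [Real.sin_sq_add_cos_sq θ]⟩

theorem rot00 (θ : ℝ) : rot θ 0 0 = Real.cos θ := rfl
theorem rot01 (θ : ℝ) : rot θ 0 1 = -Real.sin θ := rfl
theorem rot10 (θ : ℝ) : rot θ 1 0 = Real.sin θ := rfl
theorem rot11 (θ : ℝ) : rot θ 1 1 = Real.cos θ := rfl

theorem nb_rot_mul (θ : ℝ) (h : SpecialLinearGroup (Fin 2) ℝ) : nb (rot θ * h) = nb h := by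
  simp only [nb, sl2_mul, rot00, rot01, rot10, rot11]
  linear_combination (h 0 0 ^ 2 + h 0 1 ^ 2 + h 1 0 ^ 2 + h 1 1 ^ 2) * Real.sin_sq_add_cos_sq θ

theorem norm_row2_sq (h : SpecialLinearGroup (Fin 2) ℝ) : ‖row2 h‖ ^ 2 = h 1 0 ^ 2 + h 1 1 ^ 2 := by
  rw [← Complex.normSq_eq_norm_sq, Complex.normSq_apply]
  simp only [row2]; ring

theorem norm_row1_sq (h : SpecialLinearGroup (Fin 2) ℝ) : ‖row1 h‖ ^ 2 = h 0 0 ^ 2 + h 0 1 ^ 2 := by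
  rw [← Complex.normSq_eq_norm_sq, Complex.normSq_apply]
  simp only [row1]; ring

theorem continuous_ratio_rot (h : SpecialLinearGroup (Fin 2) ℝ) :
    Continuous (fun θ => ratio (rot θ * h)) := by
  unfold ratio
  have e1 : ∀ θ, ‖row1 (rot θ * h)‖ = Real.sqrt ((rot θ * h) 0 0 ^ 2 + (rot θ * h) 0 1 ^ 2) := by
    intro θ; rw [← norm_row1_sq, Real.sqrt_sq (norm_nonneg _)]
  have e2 : ∀ θ, ‖row2 (rot θ * h)‖ = Real.sqrt ((rot θ * h) 1 0 ^ 2 + (rot θ * h) 1 1 ^ 2) := by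
    intro θ; rw [← norm_row2_sq, Real.sqrt_sq (norm_nonneg _)]
  refine Continuous.div ?_ ?_ (fun θ => (row2_pos _).ne')
  · simp_rw [e1, sl2_mul, rot00, rot01]; fun_prop
  · simp_rw [e2, sl2_mul, rot10, rot11]; fun_prop

theorem log_diff_le (h : SpecialLinearGroup (Fin 2) ℝ) {θ₁ θ₂ : ℝ} (h₁ : θ₁ ∈ Set.Icc 0 Real.pi)
    (h₂ : θ₂ ∈ Set.Icc 0 Real.pi) :
    ENNReal.ofReal ((Real.log (‖row2 (rot θ₂ * h)‖ ^ 2) - Real.log (‖row2 (rot θ₁ * h)‖ ^ 2)) / 2) ≤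
      ∫⁻ θ in Set.Icc 0 Real.pi, ENNReal.ofReal (ratio (rot θ * h)) := by
  have hcont := continuous_ratio_rot h
  have hpos : ∀ θ, 0 < ‖row2 (rot θ * h)‖ ^ 2 := fun θ => pow_pos (row2_pos _) 2
  have hr0 : ∀ θ, 0 ≤ ratio (rot θ * h) := fun θ => div_nonneg (norm_nonneg _) (norm_nonneg _)
  rw [← ofReal_integral_eq_lintegral_ofReal
    (hcont.continuousOn.integrableOn_compact isCompact_Icc) (Eventually.of_forall hr0)]
  apply ENNReal.ofReal_le_ofReal
  set d : ℝ → ℝ := fun θ => 2 * ((rot θ * h) 0 0 * (rot θ * h) 1 0 +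
    (rot θ * h) 0 1 * (rot θ * h) 1 1) with hd
  have hder : ∀ θ, HasDerivAt (fun θ => ‖row2 (rot θ * h)‖ ^ 2) (d θ) θ := by
    intro θ
    simp_rw [norm_row2_sq, hd, sl2_mul, rot00, rot01, rot10, rot11]
    have hs := Real.hasDerivAt_sin θ
    have hc := Real.hasDerivAt_cos θ
    convert! (((hs.mul_const (h 0 0)).add (hc.mul_const (h 1 0))).pow 2).add
      (((hs.mul_const (h 0 1)).add (hc.mul_const (h 1 1))).pow 2) using 1
    simp; ring
  have hdc : Continuous d := by
    simp_rw [hd, sl2_mul, rot00, rot01, rot10, rot11]; fun_prop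
  have hcc : Continuous (fun θ => ‖row2 (rot θ * h)‖ ^ 2) :=
    continuous_iff_continuousAt.2 fun θ => (hder θ).continuousAt
  have hlog : ∀ θ, HasDerivAt (fun θ => Real.log (‖row2 (rot θ * h)‖ ^ 2))
      (d θ / ‖row2 (rot θ * h)‖ ^ 2) θ := fun θ => (hder θ).log (hpos θ).ne'
  have hquot : Continuous (fun θ => d θ / ‖row2 (rot θ * h)‖ ^ 2) :=
    hdc.div hcc (fun θ => (hpos θ).ne')
  have hbd : ∀ θ, ‖d θ / ‖row2 (rot θ * h)‖ ^ 2‖ ≤ 2 * ratio (rot θ * h) := by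
    intro θ
    rw [norm_div, Real.norm_eq_abs, norm_pow, norm_norm, div_le_iff₀ (hpos θ)]
    have hp := row2_pos (rot θ * h)
    have : 2 * ratio (rot θ * h) * ‖row2 (rot θ * h)‖ ^ 2 =
        2 * (‖row1 (rot θ * h)‖ * ‖row2 (rot θ * h)‖) := by
      unfold ratio; field_simp
    rw [this, hd]
    simp only [abs_mul]
    rw [abs_of_pos (by norm_num : (0:ℝ) < 2)]
    gcongr
    apply abs_le_of_sq_le_sq _ (by positivity)
    rw [mul_pow, rows_sq]; linarith
  rw [← intervalIntegral.integral_eq_sub_of_hasDerivAt (fun θ _ => hlog θ)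
    (hquot.intervalIntegrable _ _)]
  rw [div_le_iff₀ (by norm_num)]
  calc _ ≤ ‖∫ θ in θ₁..θ₂, d θ / ‖row2 (rot θ * h)‖ ^ 2‖ := le_abs_self _
    _ ≤ ∫ θ in Set.uIoc θ₁ θ₂, ‖d θ / ‖row2 (rot θ * h)‖ ^ 2‖ :=
        intervalIntegral.norm_integral_le_integral_norm_uIoc
    _ ≤ ∫ θ in Set.Icc 0 Real.pi, ‖d θ / ‖row2 (rot θ * h)‖ ^ 2‖ := by
        apply setIntegral_mono_set
        · exact (hquot.norm.continuousOn.integrableOn_compact isCompact_Icc)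
        · exact Eventually.of_forall fun θ => norm_nonneg _
        · apply HasSubset.Subset.eventuallyLE
          intro θ hθ
          rw [Set.uIoc, Set.mem_Ioc] at hθ
          exact ⟨(le_min h₁.1 h₂.1).trans hθ.1.le, hθ.2.trans (max_le h₁.2 h₂.2)⟩
    _ ≤ ∫ θ in Set.Icc 0 Real.pi, 2 * ratio (rot θ * h) := by
        apply setIntegral_mono
        · exact (hquot.norm.continuousOn.integrableOn_compact isCompact_Icc)
        · exact ((continuous_const.mul hcont).continuousOn.integrableOn_compact isCompact_Icc)
        · exact hbd
    _ = _ := by rw [integral_const_mul]; ring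

theorem rot_integral {R₁ : ℝ} (hR : 1 ≤ R₁) (t : ℤ × ℤ) (hn : 3 * R₁ ^ 2 < nb (qm t)) :
    ENNReal.ofReal (2 * Real.log R₁) ≤
      ∫⁻ θ in Set.Icc 0 Real.pi, ENNReal.ofReal (ratio (rot θ * qm t)) := by
  have hpi := Real.pi_pos
  have hR0 : 0 < R₁ := by linarith
  have key : ∀ θ₁ ∈ Set.Icc 0 Real.pi, ∀ θ₂ ∈ Set.Icc 0 Real.pi,
      ‖row2 (rot θ₁ * qm t)‖ ^ 2 ≤ (R₁ ^ 2)⁻¹ → R₁ ^ 2 ≤ ‖row2 (rot θ₂ * qm t)‖ ^ 2 →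
      ENNReal.ofReal (2 * Real.log R₁) ≤
      ∫⁻ θ in Set.Icc 0 Real.pi, ENNReal.ofReal (ratio (rot θ * qm t)) := by
    intro θ₁ h₁ θ₂ h₂ a b
    refine le_trans (ENNReal.ofReal_le_ofReal ?_) (log_diff_le (qm t) h₁ h₂)
    have a' := Real.log_le_log (pow_pos (row2_pos (rot θ₁ * qm t)) 2) a
    have b' := Real.log_le_log (by positivity) b
    rw [Real.log_inv] at a'
    rw [Real.log_pow R₁] at a' b'
    push_cast at a' b'
    linarith
  have hc : ∀ θ, ‖row2 (rot θ * qm t)‖ ^ 2 = (Real.sin θ * 2 ^ t.1) ^ 2 +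
      (Real.sin θ * (t.2 * 2 ^ t.1) + Real.cos θ * 2 ^ (-t.1)) ^ 2 := by
    intro θ; rw [norm_row2_sq]; simp [sl2_mul, rot10, rot11, qm00, qm01, qm10, qm11]
  set p : ℝ := 2 ^ t.1 with hp
  have hp0 : 0 < p := by positivity
  have hq : (2:ℝ) ^ (-t.1) = p⁻¹ := _root_.zpow_neg _ _
  set s : ℝ := t.2 * p with hs
  rw [hq] at hc
  have hnb : nb (qm t) = p ^ 2 + s ^ 2 + (p⁻¹) ^ 2 := by
    simp only [nb, qm00, qm01, qm10, qm11, hq]; ring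
  have hc0 : ‖row2 (rot 0 * qm t)‖ ^ 2 = (p⁻¹) ^ 2 := by rw [hc]; simp
  have hc2 : ‖row2 (rot (Real.pi/2) * qm t)‖ ^ 2 = p ^ 2 + s ^ 2 := by rw [hc]; simp
  obtain ⟨θ₀, hθ₀, hz⟩ : ∃ θ ∈ Set.Icc 0 Real.pi, Real.sin θ * s * p + Real.cos θ = 0 := by
    have := intermediate_value_Icc' (f := fun θ => Real.sin θ * s * p + Real.cos θ) hpi.le
      (by fun_prop)
    have := this (show (0:ℝ) ∈ _ by simp)
    simpa using this
  have hcz : ‖row2 (rot θ₀ * qm t)‖ ^ 2 = (Real.sin θ₀) ^ 2 * p ^ 2 := by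
    rw [hc]
    have : Real.sin θ₀ * s + Real.cos θ₀ * p⁻¹ = 0 := by
      have : Real.sin θ₀ * s + Real.cos θ₀ * p⁻¹ = (Real.sin θ₀ * s * p + Real.cos θ₀) * p⁻¹ := by
        field_simp
      rw [this, hz, zero_mul]
    rw [this]; ring
  have hsc := Real.sin_sq_add_cos_sq θ₀
  by_cases c1 : R₁ ^ 2 < p ^ 2
  · apply key 0 ⟨le_rfl, hpi.le⟩ (Real.pi/2) ⟨by linarith, by linarith⟩
    · rw [hc0, inv_pow]; gcongr
    · rw [hc2]; nlinarith
  by_cases c2 : R₁ ^ 2 < (p⁻¹) ^ 2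
  · apply key θ₀ hθ₀ 0 ⟨le_rfl, hpi.le⟩
    · rw [hcz]
      have : p ^ 2 ≤ (R₁ ^ 2)⁻¹ := by
        rw [inv_pow] at c2
        rw [← inv_inv (p^2)]; gcongr
      nlinarith [sq_nonneg (Real.cos θ₀), sq_nonneg p]
    · rw [hc0]; exact c2.le
  have c3 : R₁ ^ 2 < s ^ 2 := by linarith
  · apply key θ₀ hθ₀ (Real.pi/2) ⟨by linarith, by linarith⟩
    · rw [hcz]
      have e : (Real.sin θ₀) ^ 2 * p ^ 2 * s ^ 2 = (Real.cos θ₀) ^ 2 := by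
        have : Real.sin θ₀ * s * p = - Real.cos θ₀ := by linarith
        calc _ = (Real.sin θ₀ * s * p) ^ 2 := by ring
          _ = _ := by rw [this]; ring
      have : (Real.sin θ₀) ^ 2 * p ^ 2 * R₁ ^ 2 ≤ 1 := by
        have : (Real.sin θ₀) ^ 2 * p ^ 2 * R₁ ^ 2 ≤ (Real.sin θ₀) ^ 2 * p ^ 2 * s ^ 2 := by gcongr
        nlinarith [sq_nonneg (Real.sin θ₀)]
      rw [← one_div, le_div_iff₀ (by positivity)]
      exact this
    · rw [hc2]; nlinarith

end Shalom


namespace Shalom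
open MeasureTheory Filter Topology
open scoped ENNReal Pointwise

set_option linter.unusedSectionVars false

/-- A tiling of `X` by translates of a compact set. -/
structure Tile {G X : Type*} [Group G] [MulAction G X] [MeasurableSpace X] [TopologicalSpace X]
    (ι : Matrix.SpecialLinearGroup (Fin 2) ℝ →* G) (F : Set X) (idx : X → ℤ × ℤ) : Prop where
  compact : IsCompact F
  rotmem : ∀ θ x, x ∈ F → ι (rot θ) • x ∈ F
  meas : Measurable idx
  mem : ∀ x, (ι (qm (idx x)))⁻¹ • x ∈ F
  proper : ∀ C : Set X, IsCompact C → ∃ R : ℝ, 1 ≤ R ∧ ∀ h, (∃ x ∈ C, ι h • x ∈ C) → nb h ≤ R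

section
variable {G X : Type*} [Group G] [MulAction G X] [MeasurableSpace X] [TopologicalSpace X]
  [TopologicalSpace G] [ContinuousSMul G X] [T2Space X] [BorelSpace X]

theorem tile_exists (ι : Matrix.SpecialLinearGroup (Fin 2) ℝ →* G)
    (prop : ∀ C : Set X, IsCompact C → ∃ R : ℝ, ∀ h, (∃ x ∈ C, ι h • x ∈ C) → nb h ≤ R)
    (hcpt : ∀ R : ℝ, IsCompact (ι '' {h | nb h ≤ R}))
    (F₀ : Set X) (hF₀ : IsCompact F₀) (hcov : ∀ x, ∃ h, ι h • x ∈ F₀) :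
    ∃ F idx, Tile (X := X) ι F idx := by
  classical
  set F : Set X := (ι '' {h | nb h ≤ 6}) • F₀ with hF
  have hFc : IsCompact F := (hcpt 6).smul_set hF₀
  have hex : ∀ x : X, ∃ n : ℕ, (ι (qm (Denumerable.ofNat (ℤ × ℤ) n)))⁻¹ • x ∈ F := by
    intro x
    obtain ⟨h, hh⟩ := hcov x
    obtain ⟨t, ht⟩ := tiling h⁻¹
    refine ⟨Encodable.encode t, ?_⟩
    rw [Denumerable.ofNat_encode]
    refine Set.mem_smul.2 ⟨_, ⟨_, ht, rfl⟩, _, hh, ?_⟩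
    simp [smul_smul]
  have hmeas : Measurable (fun x : X => Nat.find (hex x)) := by
    apply measurable_find
    intro k
    exact (hFc.isClosed.measurableSet.preimage (measurable_const_smul _))
  refine ⟨F, fun x => Denumerable.ofNat (ℤ × ℤ) (Nat.find (hex x)), hFc, ?_, ?_, ?_, ?_⟩
  · intro θ x hx
    obtain ⟨_, ⟨h, hh, rfl⟩, y, hy, rfl⟩ := Set.mem_smul.1 hx
    refine Set.mem_smul.2 ⟨_, ⟨rot θ * h, ?_, rfl⟩, y, hy, ?_⟩
    · simpa [nb_rot_mul] using hh
    · simp [smul_smul]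
  · exact (measurable_from_nat (f := Denumerable.ofNat (ℤ × ℤ))).comp hmeas
  · intro x
    exact Nat.find_spec (hex x)
  · intro C hC
    obtain ⟨R, hR⟩ := prop C hC
    exact ⟨max R 1, le_max_right _ _, fun h hh => (hR h hh).trans (le_max_left _ _)⟩

variable {ι : Matrix.SpecialLinearGroup (Fin 2) ℝ →* G} {F : Set X} {idx : X → ℤ × ℤ}

/-- relation of indices -/
theorem Tile.rel (T : Tile ι F idx) {R : ℝ} {C : Set X} (hFC : F ⊆ C)
    (hR : ∀ h, (∃ x ∈ C, ι h • x ∈ C) → nb h ≤ R) (h : Matrix.SpecialLinearGroup (Fin 2) ℝ)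
    (x : X) (hx : (ι h)⁻¹ • x ∈ C) : nb (h⁻¹ * qm (idx x)) ≤ R := by
  refine hR _ ⟨_, hFC (T.mem x), ?_⟩
  simpa [smul_smul] using hx

theorem Tile.rel' (T : Tile ι F idx) {R : ℝ} {C : Set X} (hFC : F ⊆ C)
    (hR : ∀ h, (∃ x ∈ C, ι h • x ∈ C) → nb h ≤ R) (h : Matrix.SpecialLinearGroup (Fin 2) ℝ)
    (x : X) (hx : (ι h)⁻¹ • x ∈ C) : nb ((qm (idx x))⁻¹ * h) ≤ R := by
  refine hR _ ⟨_, hx, ?_⟩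
  have := hFC (T.mem x)
  simpa [smul_smul] using this

theorem measurable_phi : Measurable phi := measurable_of_countable _

theorem Tile.memLp (T : Tile ι F idx) (μ : Measure X) [SMulInvariantMeasure G X μ]
    [IsFiniteMeasureOnCompacts μ] (g : G) (hg : ∀ h, g * ι h = ι h * g) :
    MemLp (fun x => phi (idx (g • x)) - phi (idx x)) 2 μ := by
  have hm : Measurable (fun x => phi (idx (g • x)) - phi (idx x)) :=
    (measurable_phi.comp (T.meas.comp (measurable_const_smul g))).sub (measurable_phi.comp T.meas)
  rw [memLp_two_iff_integrable_sq hm.aestronglyMeasurable]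
  obtain ⟨R, hR1, hR⟩ := T.proper (F ∪ g • F) (T.compact.union (T.compact.smul g))
  have hb : ∀ x, (phi (idx (g • x)) - phi (idx x)) ^ 2 ≤ cf R (idx x) := by
    intro x
    apply phi_diff hR1
    apply T.rel Set.subset_union_left hR
    right
    refine ⟨_, T.mem x, ?_⟩
    show g • _ = _
    rw [smul_smul, smul_smul, ← map_inv, hg]
  have h0 : ∀ t, 0 ≤ cf R t := by
    intro t
    have : nb ((qm t)⁻¹ * qm t) ≤ 2 := by simp [nb]; norm_num
    unfold cf; split_ifs <;> positivity
  refine ⟨(hm.pow_const 2).aestronglyMeasurable, ?_⟩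
  rw [hasFiniteIntegral_iff_ofReal (Eventually.of_forall fun x => sq_nonneg _)]
  have hFm : MeasurableSet F := T.compact.isClosed.measurableSet
  have hpt : ∀ x, ENNReal.ofReal ((phi (idx (g • x)) - phi (idx x)) ^ 2) ≤
      ∑' t, ENNReal.ofReal (cf R t) * F.indicator (1 : X → ℝ≥0∞) ((ι (qm t))⁻¹ • x) := by
    intro x
    refine le_trans ?_ (ENNReal.le_tsum (idx x))
    rw [Set.indicator_of_mem (T.mem x)]
    simpa using ENNReal.ofReal_le_ofReal (hb x)
  calc _ ≤ ∫⁻ x, ∑' t, ENNReal.ofReal (cf R t) *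
        F.indicator (1 : X → ℝ≥0∞) ((ι (qm t))⁻¹ • x) ∂μ := lintegral_mono hpt
    _ = ∑' t, ∫⁻ x, ENNReal.ofReal (cf R t) *
        F.indicator (1 : X → ℝ≥0∞) ((ι (qm t))⁻¹ • x) ∂μ := by
        apply lintegral_tsum
        intro t
        exact (measurable_const.mul ((measurable_one.indicator hFm).comp
          (measurable_const_smul _))).aemeasurable
    _ = ∑' t, ENNReal.ofReal (cf R t) * μ F := by
        congr 1; ext t
        have hmm : Measurable (fun x => F.indicator (1 : X → ℝ≥0∞) ((ι (qm t))⁻¹ • x)) :=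
          (measurable_one.indicator hFm).comp (measurable_const_smul _)
        rw [lintegral_const_mul _ hmm]
        congr 1
        rw [(measurePreserving_smul ((ι (qm t))⁻¹) μ).lintegral_comp
          (measurable_one.indicator hFm), lintegral_indicator_one hFm]
    _ = ENNReal.ofReal (∑' t, cf R t) * μ F := by
        rw [ENNReal.tsum_mul_right, ENNReal.ofReal_tsum_of_nonneg h0 (summable_cf R hR1)]
    _ < ⊤ := ENNReal.mul_lt_top ENNReal.ofReal_lt_top T.compact.measure_lt_top

/-- The cocycle. -/
noncomputable def Tile.coc (T : Tile ι F idx) (μ : Measure X) [SMulInvariantMeasure G X μ]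
    [IsFiniteMeasureOnCompacts μ] (g : G) (hg : ∀ h, g * ι h = ι h * g) : Lp ℝ 2 μ :=
  (T.memLp μ g hg).toLp _

theorem Tile.coc_identity (T : Tile ι F idx) (μ : Measure X) [SMulInvariantMeasure G X μ]
    [IsFiniteMeasureOnCompacts μ] (g g' : G) (hg : ∀ h, g * ι h = ι h * g)
    (hg' : ∀ h, g' * ι h = ι h * g') (hgg' : g * g' = g' * g) :
    koop μ g (T.coc μ g' hg') - T.coc μ g' hg' = koop μ g' (T.coc μ g hg) - T.coc μ g hg := by
  have key : ∀ (g g' : G) (hg : ∀ h, g * ι h = ι h * g) (hg' : ∀ h, g' * ι h = ι h * g'),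
      (koop μ g (T.coc μ g' hg') - T.coc μ g' hg' : Lp ℝ 2 μ) =ᵐ[μ] fun x =>
      phi (idx (g' • g • x)) - phi (idx (g • x)) - (phi (idx (g' • x)) - phi (idx x)) := by
    intro g g' hg hg'
    have h1 := koop_coe μ g (T.coc μ g' hg')
    have h2 := (T.memLp μ g' hg').coeFn_toLp
    have h3 := (measurePreserving_smul g μ).quasiMeasurePreserving.ae h2
    filter_upwards [h1, h2, h3, Lp.coeFn_sub (koop μ g (T.coc μ g' hg')) (T.coc μ g' hg')]
      with x a b c d
    rw [d, Pi.sub_apply, a]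
    unfold Tile.coc
    rw [b, c]
  apply Lp.ext
  filter_upwards [key g g' hg hg', key g' g hg' hg] with x a b
  rw [a, b, smul_smul, smul_smul, hgg']; ring

theorem Tile.coc_norm (T : Tile ι F idx) (μ : Measure X) [SMulInvariantMeasure G X μ]
    [IsFiniteMeasureOnCompacts μ] (g : G) (hg : ∀ h, g * ι h = ι h * g) :
    ∫⁻ x, ENNReal.ofReal ((phi (idx (g • x)) - phi (idx x)) ^ 2) ∂μ =
      ENNReal.ofReal (‖T.coc μ g hg‖ ^ 2) := by
  rw [norm_sq_eq, ← ofReal_integral_eq_lintegral_ofReal]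
  · congr 1
    apply integral_congr_ae
    filter_upwards [(T.memLp μ g hg).coeFn_toLp] with x hx
    unfold Tile.coc; rw [hx]
  · exact (T.memLp μ g hg).integrable_sq
  · exact Eventually.of_forall fun x => sq_nonneg _

end

end Shalom


namespace Shalom
open MeasureTheory Filter Topology
open scoped ENNReal Pointwise

set_option linter.unusedSectionVars false

section
variable {G X : Type*} [Group G] [MulAction G X] [MeasurableSpace X] [TopologicalSpace X]
  [TopologicalSpace G] [ContinuousSMul G X] [T2Space X] [BorelSpace X]
variable {ι : Matrix.SpecialLinearGroup (Fin 2) ℝ →* G} {F : Set X} {idx : X → ℤ × ℤ}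

/-- multiplicity of the tiling -/
theorem Tile.mult (T : Tile ι F idx) {R : ℝ} (hR : ∀ h, (∃ x ∈ F, ι h • x ∈ F) → nb h ≤ R)
    {N : ℕ} (hN : ∀ t : ℤ × ℤ, ∃ S : Finset (ℤ × ℤ),
      S.card ≤ N ∧ ∀ t', nb ((qm t)⁻¹ * qm t') ≤ R → t' ∈ S) (x : X) :
    ∑' t, F.indicator (1 : X → ℝ≥0∞) ((ι (qm t))⁻¹ • x) ≤ N := by
  obtain ⟨S, hS, hS'⟩ := hN (idx x)
  rw [tsum_eq_sum (s := S)]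
  · calc _ ≤ ∑ t ∈ S, (1 : ℝ≥0∞) := by
          apply Finset.sum_le_sum
          intro t _
          exact Set.indicator_le_self' (by simp) _ |>.trans (by simp)
      _ ≤ N := by simpa using hS
  · intro t ht
    apply Set.indicator_of_notMem
    intro hx
    exact ht (hS' t (T.rel' subset_rfl hR _ _ hx))

theorem Tile.pointwise (T : Tile ι F idx) {R : ℝ} (hR1 : 1 ≤ R)
    (hR : ∀ h, (∃ x ∈ F, ι h • x ∈ F) → nb h ≤ R) (l : G) (hl : ∀ h, l * ι h = ι h * l)
    (x : X) (hx : x ∈ F) (θ : ℝ) :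
    ENNReal.ofReal (ratio (rot θ * qm (idx (l • x))) / (128 * (R+1))) ≤
    (∑' t, ENNReal.ofReal ((phi (idx (l • ι (qm t) • ι (rot θ) • x)) -
      phi (idx (ι (qm t) • ι (rot θ) • x))) ^ 2)) + ENNReal.ofReal (R/4) := by
  apply count_lower hR1
  intro t h1 h2 h3
  have a1 : 1/2 ≤ phi (idx (ι (qm t) • ι (rot θ) • x)) := by
    apply phi_large hR1 _ h1 h2
    apply T.rel subset_rfl hR
    rw [inv_smul_smul]
    exact T.rotmem θ x hx
  have a2 : phi (idx (l • ι (qm t) • ι (rot θ) • x)) = 0 := by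
    apply phi_vanish hR1 (t := t) (rot θ * qm (idx (l • x))) _ (by linarith) h3
    apply T.rel' subset_rfl hR
    have := T.mem (l • x)
    have e : l • ι (qm t) • ι (rot θ) • x = ι (qm t * rot θ) • (l • x) := by
      rw [smul_smul (ι (qm t)), ← map_mul, smul_smul, smul_smul, hl]
    rw [e]
    convert this using 1
    simp only [map_mul, smul_smul]
    congr 1
    group
  rw [a2]
  apply ENNReal.ofReal_le_ofReal
  nlinarith

theorem Tile.lower [SecondCountableTopology X] (T : Tile ι F idx)
    (μ : Measure X) [SMulInvariantMeasure G X μ] [SFinite μ]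
    (hrot : Continuous (fun θ => ι (rot θ)))
    {R : ℝ} (hR1 : 1 ≤ R)
    (hR : ∀ h, (∃ x ∈ F, ι h • x ∈ F) → nb h ≤ R)
    {N : ℕ} (hN : ∀ t : ℤ × ℤ, ∃ S : Finset (ℤ × ℤ),
      S.card ≤ N ∧ ∀ t', nb ((qm t)⁻¹ * qm t') ≤ R → t' ∈ S)
    (l : G) (hl : ∀ h, l * ι h = ι h * l) {R₁ : ℝ} (hR₁ : 1 ≤ R₁)
    (hlarge : ∀ x ∈ F, 3 * R₁ ^ 2 < nb (qm (idx (l • x)))) :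
    ENNReal.ofReal (2 * Real.log R₁ / (128 * (R+1))) * μ F ≤
      N * ENNReal.ofReal Real.pi * ∫⁻ x, ENNReal.ofReal ((phi (idx (l • x)) - phi (idx x)) ^ 2) ∂μ +
      ENNReal.ofReal (R/4) * ENNReal.ofReal Real.pi * μ F := by
  set D : X → ℝ≥0∞ := fun x => ENNReal.ofReal ((phi (idx (l • x)) - phi (idx x)) ^ 2) with hD
  have hDm : Measurable D :=
    (((measurable_phi.comp (T.meas.comp (measurable_const_smul l))).sub
      (measurable_phi.comp T.meas)).pow_const 2).ennreal_ofReal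
  have hFm : MeasurableSet F := T.compact.isClosed.measurableSet
  have hpi : volume.restrict (Set.Icc 0 Real.pi) Set.univ = ENNReal.ofReal Real.pi := by
    simp
  have hvar : Measurable (Function.uncurry fun (x : X) (θ : ℝ) =>
      ∑' t, D (ι (qm t) • ι (rot θ) • x)) := by
    apply Measurable.tsum
    intro t
    apply hDm.comp
    apply Continuous.measurable
    exact ((hrot.comp continuous_snd).smul continuous_fst).const_smul _
  -- the upper bound
  have up : ∀ θ, ∫⁻ x in F, ∑' t, D (ι (qm t) • ι (rot θ) • x) ∂μ ≤ N * ∫⁻ x, D x ∂μ := by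
    intro θ
    have hmt : ∀ t, Measurable (fun x => D (ι (qm t) • ι (rot θ) • x)) := fun t =>
      hDm.comp ((measurable_const_smul _).comp (measurable_const_smul _))
    rw [lintegral_tsum (fun t => (hmt t).aemeasurable)]
    have hind : ∀ t, Measurable (fun x => F.indicator (1 : X → ℝ≥0∞) ((ι (qm t))⁻¹ • x)) :=
      fun t => (measurable_one.indicator hFm).comp (measurable_const_smul _)
    have st : ∀ t, ∫⁻ x in F, D (ι (qm t) • ι (rot θ) • x) ∂μ ≤
        ∫⁻ x, F.indicator (1 : X → ℝ≥0∞) ((ι (qm t))⁻¹ • x) * D x ∂μ := by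
      intro t
      have hind' : Measurable (fun x => F.indicator (1 : X → ℝ≥0∞) ((ι (qm t))⁻¹ • x) * D x) :=
        (hind t).mul hDm
      rw [← (measurePreserving_smul (ι (qm t) * ι (rot θ)) μ).lintegral_comp hind', ← lintegral_indicator hFm]
      apply lintegral_mono
      intro x
      by_cases hx : x ∈ F
      · rw [Set.indicator_of_mem hx]
        simp only [mul_smul, inv_smul_smul]
        rw [Set.indicator_of_mem (T.rotmem θ x hx)]
        simp
      · rw [Set.indicator_of_notMem hx]; exact zero_le
    calc _ ≤ ∑' t, ∫⁻ x, F.indicator (1 : X → ℝ≥0∞) ((ι (qm t))⁻¹ • x) * D x ∂μ :=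
          ENNReal.tsum_le_tsum st
      _ = ∫⁻ x, ∑' t, F.indicator (1 : X → ℝ≥0∞) ((ι (qm t))⁻¹ • x) * D x ∂μ :=
          (lintegral_tsum fun t => ((hind t).mul hDm).aemeasurable).symm
      _ ≤ ∫⁻ x, N * D x ∂μ := by
          apply lintegral_mono
          intro x
          simp only [ENNReal.tsum_mul_right]
          gcongr
          exact T.mult hR hN x
      _ = _ := lintegral_const_mul _ hDm
  -- the lower bound
  have low : ∀ x ∈ F, ENNReal.ofReal (2 * Real.log R₁ / (128 * (R+1))) ≤
      (∫⁻ θ in Set.Icc 0 Real.pi, ∑' t, D (ι (qm t) • ι (rot θ) • x)) +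
        ENNReal.ofReal (R/4) * ENNReal.ofReal Real.pi := by
    intro x hx
    have h1 := rot_integral hR₁ (idx (l • x)) (hlarge x hx)
    have h2 : ENNReal.ofReal (2 * Real.log R₁ / (128 * (R+1))) ≤
        ∫⁻ θ in Set.Icc 0 Real.pi,
          ENNReal.ofReal (ratio (rot θ * qm (idx (l • x))) / (128 * (R+1))) := by
      simp_rw [div_eq_mul_inv, ENNReal.ofReal_mul' (inv_nonneg.2 (by linarith :
        (0:ℝ) ≤ 128 * (R+1)))]
      rw [lintegral_mul_const' _ _ ENNReal.ofReal_ne_top]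
      gcongr
    refine h2.trans ?_
    have h3 := lintegral_mono (μ := volume.restrict (Set.Icc 0 Real.pi))
      (fun θ => T.pointwise hR1 hR l hl x hx θ)
    refine h3.trans ?_
    rw [lintegral_add_right _ measurable_const, lintegral_const, hpi]
  calc _ = ∫⁻ x in F, ENNReal.ofReal (2 * Real.log R₁ / (128 * (R+1))) ∂μ := by
        rw [lintegral_const, Measure.restrict_apply_univ]
    _ ≤ ∫⁻ x in F, ((∫⁻ θ in Set.Icc 0 Real.pi, ∑' t, D (ι (qm t) • ι (rot θ) • x)) +
        ENNReal.ofReal (R/4) * ENNReal.ofReal Real.pi) ∂μ := setLIntegral_mono' hFm low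
    _ = (∫⁻ x in F, (∫⁻ θ in Set.Icc 0 Real.pi, ∑' t, D (ι (qm t) • ι (rot θ) • x)) ∂μ) +
        ENNReal.ofReal (R/4) * ENNReal.ofReal Real.pi * μ F := by
        rw [lintegral_add_right _ measurable_const, lintegral_const, Measure.restrict_apply_univ]
    _ ≤ _ := by
        gcongr
        rw [lintegral_lintegral_swap hvar.aemeasurable]
        calc _ ≤ ∫⁻ θ in Set.Icc 0 Real.pi, (N * ∫⁻ x, D x ∂μ) := lintegral_mono up
          _ = _ := by rw [lintegral_const, hpi]; ring

end

end Shalom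


namespace Shalom
open MeasureTheory Filter Topology
open scoped ENNReal Pointwise

/-- upper unipotent -/
def uni (s : ℝ) : Matrix.SpecialLinearGroup (Fin 2) ℝ :=
  ⟨!![1, s; 0, 1], by rw [Matrix.det_fin_two_of]; ring⟩

theorem nb_uni (s : ℝ) : nb (uni s) = 2 + s ^ 2 := by
  have h1 : uni s 0 0 = 1 := rfl
  have h2 : uni s 0 1 = s := rfl
  have h3 : uni s 1 0 = 0 := rfl
  have h4 : uni s 1 1 = 1 := rfl
  rw [nb, h1, h2, h3, h4]; ring

theorem sl2z_finite (R : ℝ) : {γ : Matrix.SpecialLinearGroup (Fin 2) ℤ |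
    nb (Matrix.SpecialLinearGroup.map (Int.castRingHom ℝ) γ) ≤ R}.Finite := by
  let E : ℤ := ⌈R⌉
  let f : Matrix.SpecialLinearGroup (Fin 2) ℤ → (Fin 2 → Fin 2 → ℤ) := fun γ i j => γ i j
  have hf : Function.Injective f := by
    intro γ γ' h
    ext i j
    exact congrFun (congrFun h i) j
  apply Set.Finite.of_finite_image (f := f) _ hf.injOn
  apply (Set.Finite.pi' (t := fun _ : Fin 2 => {v : Fin 2 → ℤ | ∀ j, v j ∈ Set.Icc (-E) E})
    (fun _ => Set.Finite.pi' (fun _ => Set.finite_Icc (-E) E))).subset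
  rintro _ ⟨γ, hγ, rfl⟩ i j
  have hR : ((γ i j : ℤ) : ℝ) ^ 2 ≤ R := by
    have e : ∀ i j, (Matrix.SpecialLinearGroup.map (Int.castRingHom ℝ) γ) i j = ((γ i j : ℤ) : ℝ) :=
      fun i j => rfl
    simp only [Set.mem_setOf_eq, nb, e] at hγ
    have h00 := sq_nonneg ((γ 0 0 : ℤ) : ℝ)
    have h01 := sq_nonneg ((γ 0 1 : ℤ) : ℝ)
    have h10 := sq_nonneg ((γ 1 0 : ℤ) : ℝ)
    have h11 := sq_nonneg ((γ 1 1 : ℤ) : ℝ)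
    fin_cases i <;> fin_cases j <;> simp only [Fin.zero_eta, Fin.mk_one, Fin.isValue] <;> linarith
  have h2 : (γ i j) ^ 2 ≤ E := by
    have : (((γ i j) ^ 2 : ℤ) : ℝ) ≤ E := by push_cast; exact hR.trans (Int.le_ceil R)
    exact_mod_cast this
  show γ i j ∈ Set.Icc (-E) E
  have h3 : |γ i j| ≤ (γ i j) ^ 2 := by
    rw [← sq_abs]
    exact Int.le_self_sq |γ i j|
  exact abs_le.1 (h3.trans h2)

theorem abstract_main {G X : Type*} [Group G] [MulAction G X] [MeasurableSpace X]
    [TopologicalSpace X] [TopologicalSpace G] [ContinuousSMul G X] [T2Space X] [BorelSpace X]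
    [SigmaCompactSpace X] [SecondCountableTopology X]
    (μ : Measure X) [SMulInvariantMeasure G X μ] [IsLocallyFiniteMeasure μ] [SFinite μ]
    [μ.InnerRegularCompactLTTop] (hμ : μ ≠ 0)
    (ι j : Matrix.SpecialLinearGroup (Fin 2) ℝ →* G)
    (hij : ∀ h h', j h * ι h' = ι h' * j h)
    (propι : ∀ C : Set X, IsCompact C → ∃ R : ℝ, ∀ h, (∃ x ∈ C, ι h • x ∈ C) → nb h ≤ R)
    (propj : ∀ C : Set X, IsCompact C → ∃ R : ℝ, ∀ h, (∃ x ∈ C, j h • x ∈ C) → nb h ≤ R)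
    (hcpt : ∀ R : ℝ, IsCompact (ι '' {h | nb h ≤ R}))
    (hrot : Continuous (fun θ => ι (rot θ)))
    (F₀ : Set X) (hF₀ : IsCompact F₀) (hcov : ∀ x, ∃ h, ι h • x ∈ F₀)
    (z u : G) (hzι : ∀ h, z * ι h = ι h * z) (hzj : ∀ h, z * j h = j h * z)
    (hzu : Tendsto (fun k : ℕ => z ^ k * u * (z ^ k)⁻¹) atTop (𝓝 1))
    (hu : ∀ C : Set X, IsCompact C → ∃ m0 : ℕ, 0 < m0 ∧ ∀ m ≥ m0, ∀ x ∈ C, u ^ m • x ∉ C) :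
    False := by
  obtain ⟨F, idx, T⟩ := tile_exists ι propι hcpt F₀ hF₀ hcov
  obtain ⟨R, hR1, hR⟩ := T.proper F T.compact
  obtain ⟨N, hN⟩ := multiplicity hR1
  -- positivity of the measure of `F`
  have hF : μ F ≠ 0 := by
    intro h0
    apply hμ
    rw [← Measure.measure_univ_eq_zero]
    have : (Set.univ : Set X) ⊆ ⋃ t : ℤ × ℤ, (fun x => (ι (qm t))⁻¹ • x) ⁻¹' F := by
      intro x _
      exact Set.mem_iUnion.2 ⟨idx x, T.mem x⟩
    refine measure_mono_null this (measure_iUnion_null fun t => ?_)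
    rw [measure_preimage_smul, h0]
  have hFtop : μ F ≠ ⊤ := T.compact.measure_lt_top.ne
  -- rigidity
  let f : Matrix.SpecialLinearGroup (Fin 2) ℤ →* G :=
    j.comp (Matrix.SpecialLinearGroup.map (Int.castRingHom ℝ))
  let a : Matrix.SpecialLinearGroup (Fin 2) ℤ := ⟨!![1, 3; 0, 1], by simp [Matrix.det_fin_two_of]⟩
  let b : Matrix.SpecialLinearGroup (Fin 2) ℤ := ⟨!![1, 0; 3, 1], by simp [Matrix.det_fin_two_of]⟩
  have hprop : ∀ C : Set X, IsCompact C → {γ | ∃ x ∈ C, f γ • x ∈ C}.Finite := by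
    intro C hC
    obtain ⟨R', hR'⟩ := propj C hC
    exact (sl2z_finite R').subset fun γ hγ => hR' _ hγ
  have comm : ∀ (g g' : G), g * g' = g' * g → ∀ v, koop μ g (koop μ g' v) = koop μ g' (koop μ g v) := by
    intro g g' h v
    rw [koop_koop, koop_koop, h]
  have hfι : ∀ γ h, f γ * ι h = ι h * f γ := fun γ h => hij _ _
  have hfz : ∀ γ, f γ * z = z * f γ := fun γ => (hzj _).symm
  obtain ⟨K, hK⟩ := hilbert_rigidity (koop μ (f a)) (koop μ (f b)) (koop μ z)
    (koop_norm μ _) (koop_norm μ _) (comm _ _ (hfz a)) (comm _ _ (hfz b)) (1/72) (by norm_num)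
    (sl2z_gap μ f hprop a b rfl rfl) (fun v hv => fixed_zero μ z u hzu hu v hv)
    (T.coc μ (f a) (hfι a)) (T.coc μ (f b) (hfι b)) (T.coc μ z hzι)
    (T.coc_identity μ _ _ _ _ (hfz a)) (T.coc_identity μ _ _ _ _ (hfz b))
  have bound : ∀ R₁ : ℝ, 1 ≤ R₁ → ENNReal.ofReal (2 * Real.log R₁ / (128 * (R+1))) * μ F ≤
      N * ENNReal.ofReal Real.pi * ENNReal.ofReal (K ^ 2) +
      ENNReal.ofReal (R/4) * ENNReal.ofReal Real.pi * μ F := by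
    intro R₁ hR₁
    obtain ⟨R', hR'⟩ := propj (F ∪ (ι '' {h | nb h ≤ 3 * R₁ ^ 2}) • F)
      (T.compact.union ((hcpt _).smul_set T.compact))
    obtain ⟨s, hs⟩ : ∃ s : ℝ, R' < nb (uni s) := by
      refine ⟨|R'| + 1, ?_⟩
      rw [nb_uni]
      nlinarith [le_abs_self R', abs_nonneg R']
    have hl : ∀ h, j (uni s) * ι h = ι h * j (uni s) := fun h => hij _ _
    have hlarge : ∀ x ∈ F, 3 * R₁ ^ 2 < nb (qm (idx (j (uni s) • x))) := by
      intro x hx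
      by_contra hcon
      push Not at hcon
      have := hR' (uni s) ⟨x, Or.inl hx, Or.inr (Set.mem_smul.2
        ⟨_, ⟨_, hcon, rfl⟩, _, T.mem (j (uni s) • x), by rw [smul_inv_smul]⟩)⟩
      linarith
    have h1 := T.lower μ hrot hR1 hR hN (j (uni s)) hl hR₁ hlarge
    rw [T.coc_norm μ _ hl] at h1
    refine h1.trans ?_
    gcongr
    exact hK (koop μ (j (uni s))) (T.coc μ (j (uni s)) hl) (koop_norm μ _)
      (comm _ _ (hzj _).symm) (T.coc_identity μ _ _ _ _ (hzj _).symm)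
  set B : ℝ≥0∞ := N * ENNReal.ofReal Real.pi * ENNReal.ofReal (K ^ 2) +
      ENNReal.ofReal (R/4) * ENNReal.ofReal Real.pi * μ F with hB
  have hBtop : B ≠ ⊤ := by
    rw [hB]
    refine ENNReal.add_ne_top.2 ⟨?_, ?_⟩
    · exact ENNReal.mul_ne_top (ENNReal.mul_ne_top (ENNReal.natCast_ne_top N)
        ENNReal.ofReal_ne_top) ENNReal.ofReal_ne_top
    · exact ENNReal.mul_ne_top (ENNReal.mul_ne_top ENNReal.ofReal_ne_top
        ENNReal.ofReal_ne_top) hFtop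
  have hQ : B / μ F ≠ ⊤ := ENNReal.div_ne_top hBtop hF
  set q := (B / μ F).toReal with hq
  have hq0 : 0 ≤ q := ENNReal.toReal_nonneg
  have h2 := bound (Real.exp (64 * (R+1) * (q + 1))) (Real.one_le_exp (by positivity))
  rw [Real.log_exp, ← ENNReal.le_div_iff_mul_le (Or.inl hF) (Or.inl hFtop),
    ← ENNReal.ofReal_toReal hQ, ← hq, ENNReal.ofReal_le_ofReal_iff hq0] at h2
  have : 2 * (64 * (R + 1) * (q + 1)) / (128 * (R + 1)) = q + 1 := by
    have : R + 1 ≠ 0 := by positivity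
    field_simp; ring
  linarith

end Shalom


namespace Shalom
open MeasureTheory Filter Topology
open scoped ENNReal Pointwise

section
variable {G : Type*} [Group G] [TopologicalSpace G] [IsTopologicalGroup G] [PolishSpace G]
  [MeasurableSpace G] [BorelSpace G]

theorem fundDom_exists (ν : Measure G) (Γ : Subgroup G) [DiscreteTopology Γ] :
    ∃ 𝓕 : Set G, IsFundamentalDomain Γ.op 𝓕 ν := by
  -- a small neighbourhood
  obtain ⟨U, hU, hUΓ⟩ : ∃ U ∈ 𝓝 (1 : G), ∀ γ ∈ Γ, γ ∈ U → γ = 1 := by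
    have h1 : ({1} : Set Γ) ∈ 𝓝 (1 : Γ) := by simp
    rw [nhds_subtype_eq_comap, mem_comap] at h1
    obtain ⟨U, hU, hU'⟩ := h1
    refine ⟨U, hU, fun γ hγ hγU => ?_⟩
    have : (⟨γ, hγ⟩ : Γ) ∈ ({1} : Set Γ) := hU' hγU
    simpa using congrArg Subtype.val this
  obtain ⟨W, hWo, hW1, hW⟩ : ∃ W : Set G, IsOpen W ∧ (1 : G) ∈ W ∧ ∀ a ∈ W, ∀ b ∈ W, a⁻¹ * b ∈ U := by
    have hc : ContinuousAt (fun p : G × G => p.1⁻¹ * p.2) (1, 1) := by fun_prop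
    have : U ∈ 𝓝 ((fun p : G × G => p.1⁻¹ * p.2) (1, 1)) := by simpa using hU
    obtain ⟨u, hu, v, hv, huv⟩ := mem_nhds_prod_iff.1 (hc this)
    obtain ⟨W, hWs, hWo, hW1⟩ := mem_nhds_iff.1 (inter_mem hu hv)
    exact ⟨W, hWo, hW1, fun a ha b hb => huv (Set.mk_mem_prod (hWs ha).1 (hWs hb).2)⟩
  -- countable cover
  obtain ⟨d, hd⟩ := TopologicalSpace.exists_dense_seq G
  let V : ℕ → Set G := fun i => {x | (d i)⁻¹ * x ∈ W}
  have hVo : ∀ i, IsOpen (V i) := fun i => hWo.preimage (by fun_prop : Continuous fun x => (d i)⁻¹ * x)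
  have hVc : ∀ x, ∃ i, x ∈ V i := by
    intro x
    have ho : IsOpen {y : G | y⁻¹ * x ∈ W} := hWo.preimage (by fun_prop)
    obtain ⟨i, hi⟩ := hd.exists_mem_open ho ⟨x, by simpa using hW1⟩
    exact ⟨i, hi⟩
  let Q : ℕ → Set G := fun i => {x | ∃ γ ∈ Γ, x * γ ∈ V i}
  have hQo : ∀ i, IsOpen (Q i) := by
    intro i
    have : Q i = ⋃ γ ∈ Γ, {x | x * γ ∈ V i} := by ext x; simp [Q]
    rw [this]
    exact isOpen_biUnion fun γ _ => (hVo i).preimage (by fun_prop : Continuous fun x => x * γ)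
  have hQinv : ∀ i x, ∀ γ ∈ Γ, (x * γ ∈ Q i ↔ x ∈ Q i) := by
    intro i x γ hγ
    constructor
    · rintro ⟨δ, hδ, h⟩; exact ⟨γ * δ, Γ.mul_mem hγ hδ, by rwa [← mul_assoc]⟩
    · rintro ⟨δ, hδ, h⟩
      exact ⟨γ⁻¹ * δ, Γ.mul_mem (Γ.inv_mem hγ) hδ, by simpa [mul_assoc] using h⟩
  let 𝓕 : Set G := ⋃ i, (V i \ ⋃ k ∈ Finset.range i, Q k)
  have hF : ∀ x, x ∈ 𝓕 ↔ ∃ i, x ∈ V i ∧ ∀ k < i, x ∉ Q k := by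
    intro x; simp [𝓕]
  refine ⟨𝓕, ?_, ?_, ?_⟩
  · apply MeasurableSet.nullMeasurableSet
    apply MeasurableSet.iUnion
    intro i
    refine (hVo i).measurableSet.diff (Finset.measurableSet_biUnion _ fun k _ => (hQo k).measurableSet)
  · refine Eventually.of_forall fun x => ?_
    classical
    have hex : ∃ i, x ∈ Q i := by
      obtain ⟨i, hi⟩ := hVc x
      exact ⟨i, 1, Γ.one_mem, by simpa using hi⟩
    obtain ⟨γ, hγ, h⟩ := Nat.find_spec hex
    refine ⟨⟨MulOpposite.op γ, hγ⟩, (hF _).2 ⟨Nat.find hex, h, fun k hk => ?_⟩⟩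
    have := Nat.find_min hex hk
    exact fun hc => this ((hQinv k x γ hγ).1 hc)
  · intro g g' hgg'
    apply Disjoint.aedisjoint
    rw [Set.disjoint_left]
    intro x hx hx'
    apply hgg'
    obtain ⟨y, hy, rfl⟩ := hx
    obtain ⟨y', hy', he⟩ := hx'
    have he : y' * MulOpposite.unop (g' : Gᵐᵒᵖ) = y * MulOpposite.unop (g : Gᵐᵒᵖ) := he
    have hg : MulOpposite.unop (g : Gᵐᵒᵖ) ∈ Γ := g.2
    have hg' : MulOpposite.unop (g' : Gᵐᵒᵖ) ∈ Γ := g'.2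
    set a := MulOpposite.unop (g : Gᵐᵒᵖ) with ha
    set b := MulOpposite.unop (g' : Gᵐᵒᵖ) with hb
    have hyy : y' = y * (a * b⁻¹) := by rw [← mul_assoc, ← he]; simp
    have hab : a * b⁻¹ ∈ Γ := Γ.mul_mem hg (Γ.inv_mem hg')
    obtain ⟨i, hi, hi'⟩ := (hF y).1 hy
    obtain ⟨k, hk, hk'⟩ := (hF y').1 hy'
    have hyQ : y ∈ Q i := ⟨1, Γ.one_mem, by simpa using hi⟩
    have hyQ' : y' ∈ Q k := ⟨1, Γ.one_mem, by simpa using hk⟩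
    have hik : i = k := by
      rcases lt_trichotomy i k with h | h | h
      · exact absurd (by rw [hyy]; exact (hQinv i y _ hab).2 hyQ) (hk' i h)
      · exact h
      · rw [hyy] at hyQ'
        exact absurd ((hQinv k y _ hab).1 hyQ') (hi' k h)
    subst hik
    have h1 := hW _ hi _ hk
    have h2 : ((d i)⁻¹ * y)⁻¹ * ((d i)⁻¹ * y') = a * b⁻¹ := by rw [hyy]; group
    rw [h2] at h1
    have h3 := hUΓ _ hab h1
    have h4 : a = b := mul_inv_eq_one.1 h3
    exact Subtype.ext (MulOpposite.unop_injective h4)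

theorem quotient_measure [LocallyCompactSpace G] (ν : Measure G) [ν.IsHaarMeasure]
    [ν.IsMulRightInvariant] (Γ : Subgroup G) [DiscreteTopology Γ] [T2Space (G ⧸ Γ)] :
    BorelSpace (G ⧸ Γ) ∧ 
    ∃ μ : Measure (G ⧸ Γ), SMulInvariantMeasure G (G ⧸ Γ) μ ∧ IsLocallyFiniteMeasure μ ∧ μ ≠ 0 := by
  have : SecondCountableTopology (G ⧸ Γ) := inferInstance
  have hB : BorelSpace (G ⧸ Γ) := Quotient.borelSpace
  refine ⟨hB, ?_⟩
  have : Countable Γ := by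
    have : SecondCountableTopology Γ := inferInstance
    exact countable_of_Lindelof_of_discrete
  have : Countable Γ.op := Countable.of_equiv _ Γ.equivOp
  obtain ⟨𝓕, h𝓕⟩ := fundDom_exists ν Γ
  have : HasFundamentalDomain Γ.op G ν := ⟨⟨𝓕, h𝓕⟩⟩
  set μ : Measure (G ⧸ Γ) := (ν.restrict 𝓕).map (QuotientGroup.mk : G → G ⧸ Γ) with hμ
  have i : QuotientMeasureEqMeasurePreimage ν μ :=
    h𝓕.quotientMeasureEqMeasurePreimage_quotientMeasure
  have hmk : Measurable (QuotientGroup.mk : G → G ⧸ Γ) := continuous_quotient_mk'.measurable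
  refine ⟨μ, QuotientMeasureEqMeasurePreimage.smulInvariantMeasure_quotient ν, ⟨?_⟩, ?_⟩
  · intro x
    obtain ⟨g, rfl⟩ := QuotientGroup.mk_surjective x
    obtain ⟨K, hK, hKn⟩ := exists_compact_mem_nhds g
    refine ⟨QuotientGroup.mk '' K, QuotientGroup.isOpenMap_coe.image_mem_nhds hKn, ?_⟩
    have hKc : IsCompact ((QuotientGroup.mk : G → G ⧸ Γ) '' K) := hK.image QuotientGroup.continuous_mk
    rw [hμ, Measure.map_apply hmk hKc.isClosed.measurableSet,
      Measure.restrict_apply (hmk hKc.isClosed.measurableSet)]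
    have hsub : ((QuotientGroup.mk : G → G ⧸ Γ) ⁻¹' (QuotientGroup.mk '' K)) ∩ 𝓕 ⊆
        ⋃ γ : Γ.op, (γ • K) ∩ 𝓕 := by
      rintro x ⟨⟨k, hk, hkx⟩, hx⟩
      have := QuotientGroup.eq.1 hkx
      exact Set.mem_iUnion.2 ⟨⟨MulOpposite.op (k⁻¹ * x), this⟩, ⟨⟨k, hk, by
        show k * (k⁻¹ * x) = x
        simp⟩, hx⟩⟩
    refine lt_of_le_of_lt ((measure_mono hsub).trans (measure_iUnion_le _)) ?_
    rw [← h𝓕.measure_eq_tsum]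
    exact hK.measure_lt_top
  · intro h0
    have h1 : μ Set.univ = 0 := by rw [h0]; simp
    rw [hμ, Measure.map_apply hmk MeasurableSet.univ] at h1
    simp only [Set.preimage_univ, Measure.restrict_apply_univ] at h1
    have : ν Set.univ = 0 := h𝓕.measure_zero_of_invariant Set.univ (by simp) (by simpa using h1)
    exact NeZero.ne ν (Measure.measure_univ_eq_zero.1 this)

end
end Shalom


namespace Shalom
open Matrix hiding zpow_neg
open MeasureTheory Filter Topology
open scoped Pointwise

section emb
variable {n : ℕ}

def PM (p : Fin 2 → Fin n) : Matrix (Fin n) (Fin 2) ℝ := (1 : Matrix (Fin n) (Fin n) ℝ).submatrix id p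

lemma PM_apply (p : Fin 2 → Fin n) (a : Fin n) (k : Fin 2) : PM p a k = if a = p k then 1 else 0 := by
  simp [PM, Matrix.one_apply]

lemma PMT_mul (p q : Fin 2 → Fin n) :
    (PM p)ᵀ * PM q = (1 : Matrix (Fin n) (Fin n) ℝ).submatrix p q := by
  ext a b
  simp [Matrix.mul_apply, PM_apply, Matrix.one_apply, eq_comm]

lemma PMT_mul_self (p : Fin 2 → Fin n) (hp : Function.Injective p) : (PM p)ᵀ * PM p = 1 := by
  rw [PMT_mul, Matrix.submatrix_one p hp]

def embM (p : Fin 2 → Fin n) (h : Matrix (Fin 2) (Fin 2) ℝ) : Matrix (Fin n) (Fin n) ℝ :=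
  1 + PM p * (h - 1) * (PM p)ᵀ

lemma embM_mul (p : Fin 2 → Fin n) (hp : Function.Injective p) (h h' : Matrix (Fin 2) (Fin 2) ℝ) :
    embM p (h * h') = embM p h * embM p h' := by
  have e : PM p * (h - 1) * (PM p)ᵀ * (PM p * (h' - 1) * (PM p)ᵀ) =
      PM p * ((h - 1) * (h' - 1)) * (PM p)ᵀ := by
    calc _ = PM p * (h - 1) * ((PM p)ᵀ * PM p) * (h' - 1) * (PM p)ᵀ := by
          simp only [Matrix.mul_assoc]
      _ = _ := by rw [PMT_mul_self p hp, Matrix.mul_one]; simp only [Matrix.mul_assoc]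
  have e2 : h * h' - 1 = (h - 1) + (h' - 1) + (h - 1) * (h' - 1) := by noncomm_ring
  unfold embM
  rw [Matrix.add_mul, Matrix.mul_add, Matrix.one_mul, Matrix.one_mul, Matrix.mul_add, e, e2]
  simp only [Matrix.mul_one, Matrix.mul_add, Matrix.add_mul]
  abel

lemma embM_det (p : Fin 2 → Fin n) (hp : Function.Injective p) (h : Matrix (Fin 2) (Fin 2) ℝ) :
    (embM p h).det = h.det := by
  unfold embM
  rw [Matrix.mul_assoc, Matrix.det_one_add_mul_comm, Matrix.mul_assoc, PMT_mul_self p hp]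
  simp

noncomputable def emb (p : Fin 2 → Fin n) (hp : Function.Injective p) :
    Matrix.SpecialLinearGroup (Fin 2) ℝ →* Matrix.SpecialLinearGroup (Fin n) ℝ where
  toFun h := ⟨embM p h, by rw [embM_det p hp]; exact h.2⟩
  map_one' := by apply Subtype.ext; simp [embM]
  map_mul' h h' := Subtype.ext (embM_mul p hp h h')

lemma emb_coe (p : Fin 2 → Fin n) (hp : Function.Injective p) (h : Matrix.SpecialLinearGroup (Fin 2) ℝ) :
    ((emb p hp h : Matrix.SpecialLinearGroup (Fin n) ℝ) : Matrix (Fin n) (Fin n) ℝ) = embM p h := rfl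

lemma embM_apply_pp (p : Fin 2 → Fin n) (hp : Function.Injective p) (h : Matrix (Fin 2) (Fin 2) ℝ)
    (a b : Fin 2) : embM p h (p a) (p b) = h a b := by
  simp [embM, Matrix.mul_apply, PM_apply, Matrix.one_apply, hp.eq_iff]

lemma embM_apply_of_notin (p : Fin 2 → Fin n) (h : Matrix (Fin 2) (Fin 2) ℝ)
    (a b : Fin n) (hab : (∀ k, p k ≠ a) ∨ (∀ k, p k ≠ b)) :
    embM p h a b = if a = b then 1 else 0 := by
  have : (PM p * (h - 1) * (PM p)ᵀ : Matrix (Fin n) (Fin n) ℝ) a b = 0 := by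
    rcases hab with hh | hh
    · have : ∀ k, a ≠ p k := fun k => (hh k).symm
      simp [Matrix.mul_apply, PM_apply, this]
    · have : ∀ k, b ≠ p k := fun k => (hh k).symm
      simp [Matrix.mul_apply, PM_apply, this]
  simp [embM, this, Matrix.one_apply]

lemma emb_comm (p q : Fin 2 → Fin n) (hp : Function.Injective p) (hq : Function.Injective q)
    (hpq : ∀ a b, p a ≠ q b) (h h' : Matrix.SpecialLinearGroup (Fin 2) ℝ) :
    emb p hp h * emb q hq h' = emb q hq h' * emb p hp h := by
  have e1 : (PM p)ᵀ * PM q = 0 := by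
    rw [PMT_mul]; ext a b; simp [Matrix.one_apply, hpq]
  have e2 : (PM q)ᵀ * PM p = 0 := by
    rw [PMT_mul]; ext a b; simp [Matrix.one_apply, (hpq _ _).symm]
  have key : ∀ (r s : Fin 2 → Fin n) (A B : Matrix (Fin 2) (Fin 2) ℝ), (PM r)ᵀ * PM s = 0 →
      PM r * A * (PM r)ᵀ * (PM s * B * (PM s)ᵀ) = 0 := by
    intro r s A B h0
    calc _ = PM r * A * ((PM r)ᵀ * PM s) * B * (PM s)ᵀ := by simp only [Matrix.mul_assoc]
      _ = 0 := by simp [h0]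
  apply Subtype.ext
  simp only [Matrix.SpecialLinearGroup.coe_mul, emb_coe, embM]
  rw [Matrix.add_mul, Matrix.add_mul, Matrix.mul_add, Matrix.mul_add, key p q _ _ e1, Matrix.mul_add,
    Matrix.mul_add, key q p _ _ e2]
  simp only [Matrix.mul_one, Matrix.one_mul]
  abel

lemma continuous_emb (p : Fin 2 → Fin n) (hp : Function.Injective p) : Continuous (emb p hp) := by
  refine continuous_induced_rng.2 ?_
  show Continuous (fun h : Matrix.SpecialLinearGroup (Fin 2) ℝ => embM p h)
  unfold embM
  have : Continuous (fun h : Matrix.SpecialLinearGroup (Fin 2) ℝ => (h : Matrix (Fin 2) (Fin 2) ℝ)) :=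
    continuous_subtype_val
  fun_prop

/-- permutation matrix in SL -/
noncomputable def permSL (σ : Equiv.Perm (Fin n)) (hσ : Equiv.Perm.sign σ = 1) :
    Matrix.SpecialLinearGroup (Fin n) ℝ :=
  ⟨(1 : Matrix (Fin n) (Fin n) ℝ).submatrix σ.symm id, by
    have := Matrix.det_permute σ.symm (1 : Matrix (Fin n) (Fin n) ℝ)
    rw [this]; simp [hσ]⟩

lemma permSL_conj (σ : Equiv.Perm (Fin n)) (hσ : Equiv.Perm.sign σ = 1) (p : Fin 2 → Fin n)
    (hp : Function.Injective p) (h : Matrix.SpecialLinearGroup (Fin 2) ℝ) :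
    emb (σ ∘ p) (σ.injective.comp hp) h = permSL σ hσ * emb p hp h * (permSL σ hσ)⁻¹ := by
  rw [eq_mul_inv_iff_mul_eq]
  apply Subtype.ext
  have e1 : (permSL σ hσ).1 * PM p = PM (σ ∘ p) := by
    ext a b
    simp [permSL, Matrix.mul_apply, PM_apply, Matrix.one_apply, Equiv.symm_apply_eq]
  have e2 : (PM (σ ∘ p))ᵀ * (permSL σ hσ).1 = (PM p)ᵀ := by
    ext a b
    simp only [permSL, Matrix.mul_apply, PM_apply, Matrix.one_apply, Matrix.transpose_apply,
      Function.comp_apply, Matrix.submatrix_apply, id, ite_mul, one_mul, zero_mul,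
      Finset.sum_ite_eq', Finset.sum_ite_eq, Finset.mem_univ, if_true, Equiv.symm_apply_apply]
    simp only [eq_comm]
  simp only [Matrix.SpecialLinearGroup.coe_mul, emb_coe, embM]
  rw [Matrix.add_mul, Matrix.mul_add, Matrix.mul_assoc _ _ (permSL σ hσ).1, e2,
    Matrix.mul_assoc (PM p), ← Matrix.mul_assoc (permSL σ hσ).1, e1]
  simp [Matrix.mul_assoc]

/-- Unimodularity input. -/
lemma hom_trivial {A : Type*} [CommMonoid A] (hn : 2 ≤ n)
    (χ : Matrix.SpecialLinearGroup (Fin n) ℝ →* A) (g : Matrix.SpecialLinearGroup (Fin n) ℝ) :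
    χ g = 1 := by
  have h2 : ∀ (ψ : Matrix.SpecialLinearGroup (Fin 2) ℝ →* A) h, ψ h = 1 := by
    intro ψ h
    have ht : commutator (Matrix.SpecialLinearGroup (Fin 2) ℝ) = ⊤ :=
      Matrix.SL2.commutator_eq_top (a := (2 : ℝ)) (by norm_num) (by norm_num)
    have hle : commutator (Matrix.SpecialLinearGroup (Fin 2) ℝ) ≤ ψ.toHomUnits.ker :=
      Abelianization.commutator_subset_ker _
    have : h ∈ ψ.toHomUnits.ker := hle (by rw [ht]; trivial)
    have := congrArg Units.val (MonoidHom.mem_ker.1 this)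
    simpa using this
  have : Nontrivial (Fin n) := Fin.nontrivial_iff_two_le.2 hn
  have hinj : ∀ i j : Fin n, i ≠ j → Function.Injective ![i, j] := by
    intro i j hij a b hab
    fin_cases a <;> fin_cases b <;> simp_all
  refine Matrix.SpecialLinearGroup.diagonal_transvection_induction' (fun g => χ g = 1) g ?_ ?_ ?_
  · intro i j hij c hc
    have : Matrix.SpecialLinearGroup.diag2n hij c hc =
        emb ![i, j] (hinj i j hij) (Matrix.SpecialLinearGroup.diag2 c hc) := by
      apply Subtype.ext
      rw [emb_coe, Matrix.SpecialLinearGroup.diag2_coe', Matrix.SpecialLinearGroup.diag2n_coe]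
      ext a b
      simp only [embM, Matrix.add_apply, Matrix.mul_apply, PM_apply, Matrix.one_apply,
        Matrix.diagonal_apply, Fin.sum_univ_two, Matrix.transpose_apply, Matrix.sub_apply]
      by_cases h1 : a = i <;> by_cases h2 : b = i <;> by_cases h3 : a = j <;> by_cases h4 : b = j <;>
        by_cases h5 : a = b <;> simp_all
    rw [this]
    exact h2 (χ.comp (emb ![i, j] (hinj i j hij))) _
  · intro i j hij c
    have : Matrix.SpecialLinearGroup.transvection hij c =
        emb ![i, j] (hinj i j hij) (Matrix.SpecialLinearGroup.transvection zero_ne_one c) := by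
      apply Subtype.ext
      rw [emb_coe, Matrix.SpecialLinearGroup.transvection_coe, Matrix.SpecialLinearGroup.transvection_coe]
      ext a b
      simp only [embM, Matrix.add_apply, Matrix.mul_apply, PM_apply, Matrix.one_apply,
        Matrix.single_apply, Fin.sum_univ_two, Matrix.transpose_apply, Matrix.sub_apply]
      have hsym : (i = a ∧ j = b) ↔ (a = i ∧ b = j) := by constructor <;> (rintro ⟨rfl, rfl⟩; simp)
      simp only [hsym]
      by_cases h1 : a = i <;> by_cases h2 : b = i <;> by_cases h3 : a = j <;> by_cases h4 : b = j <;>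
        by_cases h5 : a = b <;> simp_all
    rw [this]
    exact h2 (χ.comp (emb ![i, j] (hinj i j hij))) _
  · intro A B hA hB
    simp only [map_mul, hA, hB, mul_one]

end emb
end Shalom


namespace Shalom
open Matrix hiding zpow_neg
open MeasureTheory Filter Topology
open scoped Pointwise

theorem lift_compact {G : Type*} [Group G] [TopologicalSpace G] [IsTopologicalGroup G]
    [LocallyCompactSpace G] (N : Subgroup G) (C : Set (G ⧸ N)) (hC : IsCompact C) :
    ∃ D : Set G, IsCompact D ∧ ∀ x ∈ C, ∃ g ∈ D, (QuotientGroup.mk g : G ⧸ N) = x := by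
  have h : ∀ x : G ⧸ N, ∃ K : Set G, IsCompact K ∧ (QuotientGroup.mk '' K : Set (G ⧸ N)) ∈ 𝓝 x := by
    intro x
    obtain ⟨g, rfl⟩ := QuotientGroup.mk_surjective x
    obtain ⟨K, hK, hKn⟩ := exists_compact_mem_nhds g
    exact ⟨K, hK, QuotientGroup.isOpenMap_coe.image_mem_nhds hKn⟩
  choose K hK hKn using h
  obtain ⟨t, _, ht⟩ := hC.elim_nhds_subcover (fun x => (QuotientGroup.mk '' K x : Set (G ⧸ N)))
    (fun x _ => hKn x)
  refine ⟨⋃ x ∈ t, K x, t.isCompact_biUnion fun x _ => hK x, fun x hx => ?_⟩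
  obtain ⟨y, hy, g, hg, hgx⟩ := Set.mem_iUnion₂.1 (ht hx)
  exact ⟨g, Set.mem_biUnion hy hg, hgx⟩

section
variable {n : ℕ}

lemma continuous_nb : Continuous nb := by
  have : ∀ i j, Continuous (fun h : Matrix.SpecialLinearGroup (Fin 2) ℝ => h i j) := fun i j =>
    (continuous_subtype_val (p := fun A : Matrix (Fin 2) (Fin 2) ℝ => A.det = 1)).matrix_elem i j
  unfold nb
  exact (((this 0 0).pow 2).add ((this 0 1).pow 2)).add ((this 1 0).pow 2) |>.add ((this 1 1).pow 2)

lemma isCompact_nb (R : ℝ) : IsCompact {h : Matrix.SpecialLinearGroup (Fin 2) ℝ | nb h ≤ R} := by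
  have hce : IsClosedEmbedding (fun g : Matrix.SpecialLinearGroup (Fin 2) ℝ => g.1) :=
    Matrix.SpecialLinearGroup.isClosedEmbedding_val (n := Fin 2) (R := ℝ)
  rw [hce.isCompact_iff]
  have hB : IsCompact (Set.univ.pi fun _ : Fin 2 => Set.univ.pi fun _ : Fin 2 =>
      Set.Icc (-(|R| + 1)) (|R| + 1) : Set (Fin 2 → Fin 2 → ℝ)) :=
    isCompact_univ_pi fun _ => isCompact_univ_pi fun _ => isCompact_Icc
  refine IsCompact.of_isClosed_subset hB
    (hce.isClosedMap _ (isClosed_le continuous_nb continuous_const)) ?_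
  rintro _ ⟨h, hh, rfl⟩ i - j -
  have hh : nb h ≤ R := hh
  have hR := le_abs_self R
  have h0 := abs_nonneg R
  unfold nb at hh
  show h i j ∈ _
  have : h i j ^ 2 ≤ R := by
    fin_cases i <;> fin_cases j <;> simp <;>
    nlinarith [sq_nonneg (h 0 0), sq_nonneg (h 0 1), sq_nonneg (h 1 0), sq_nonneg (h 1 1)]
  constructor <;> nlinarith

lemma continuous_uni : Continuous uni := by
  refine continuous_induced_rng.2 ?_
  refine continuous_matrix fun i j => ?_
  fin_cases i <;> fin_cases j <;> simp [uni] <;> fun_prop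

lemma continuous_rot : Continuous rot := by
  refine continuous_induced_rng.2 ?_
  refine continuous_matrix fun i j => ?_
  fin_cases i <;> fin_cases j <;> simp [rot] <;> fun_prop

lemma uni_val (s : ℝ) : (uni s).1 = !![1, s; 0, 1] := rfl

lemma uni_pow (m : ℕ) : uni 1 ^ m = uni m := by
  induction m with
  | zero =>
    apply Subtype.ext
    rw [pow_zero, Matrix.SpecialLinearGroup.coe_one, uni_val, Matrix.one_fin_two]
    simp
  | succ k ih =>
    rw [pow_succ, ih]
    apply Subtype.ext
    rw [Matrix.SpecialLinearGroup.coe_mul, uni_val, uni_val, uni_val, Matrix.mul_fin_two]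
    ext i j
    fin_cases i <;> fin_cases j <;> simp
    ring

lemma uni_zero : uni 0 = 1 := by simpa using (uni_pow 0).symm

instance : PolishSpace (Matrix.SpecialLinearGroup (Fin n) ℝ) := by
  have : PolishSpace (Matrix (Fin n) (Fin n) ℝ) := inferInstanceAs (PolishSpace (Fin n → Fin n → ℝ))
  exact (Matrix.SpecialLinearGroup.isClosedEmbedding_val (n := Fin n) (R := ℝ)).polishSpace

instance : LocallyCompactSpace (Matrix.SpecialLinearGroup (Fin n) ℝ) := by
  have : LocallyCompactSpace (Matrix (Fin n) (Fin n) ℝ) :=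
    inferInstanceAs (LocallyCompactSpace (Fin n → Fin n → ℝ))
  exact (Matrix.SpecialLinearGroup.isClosedEmbedding_val (n := Fin n) (R := ℝ)).locallyCompactSpace

lemma inj_pair {i j : Fin n} (hij : i ≠ j) : Function.Injective ![i, j] := by
  intro a b hab
  fin_cases a <;> fin_cases b <;> simp_all

lemma comp_pair (σ : Fin n → Fin n) (i j : Fin n) : σ ∘ ![i, j] = ![σ i, σ j] := by
  funext k; fin_cases k <;> rfl

lemma emb_congr (p q : Fin 2 → Fin n) (hp hq) (h : p = q) : emb p hp = emb q hq := by
  subst h; rfl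

lemma emb_diag_comm (p : Fin 2 → Fin n) (hp) (d : Fin n → ℝ) (c : ℝ) (hd : ∀ k, d (p k) = c)
    (z : Matrix.SpecialLinearGroup (Fin n) ℝ) (hz : z.1 = Matrix.diagonal d)
    (h : Matrix.SpecialLinearGroup (Fin 2) ℝ) : z * emb p hp h = emb p hp h * z := by
  have e1 : Matrix.diagonal d * PM p = c • PM p := by
    ext a k
    simp only [Matrix.diagonal_mul, PM_apply, Matrix.smul_apply, smul_eq_mul]
    split_ifs with h
    · rw [h, hd]
    · simp
  have e2 : (PM p)ᵀ * Matrix.diagonal d = c • (PM p)ᵀ := by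
    ext k a
    simp only [Matrix.mul_diagonal, PM_apply, Matrix.smul_apply, smul_eq_mul, Matrix.transpose_apply]
    split_ifs with h
    · rw [h, hd]; ring
    · simp
  apply Subtype.ext
  rw [Matrix.SpecialLinearGroup.coe_mul, Matrix.SpecialLinearGroup.coe_mul, emb_coe, hz, embM,
    Matrix.mul_add, Matrix.add_mul, Matrix.mul_assoc (PM p * _), e2, Matrix.mul_assoc (PM p),
    ← Matrix.mul_assoc (Matrix.diagonal d), e1]
  simp [Matrix.mul_assoc]

lemma emb_uni_coe {i j : Fin n} (hij : i ≠ j) (s : ℝ) :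
    (emb ![i, j] (inj_pair hij) (uni s)).1 = 1 + Matrix.single i j s := by
  rw [emb_coe, embM]
  congr 1
  ext a b
  have h0 : (uni s).1 0 0 = 1 := rfl
  have h1 : (uni s).1 0 1 = s := rfl
  have h2 : (uni s).1 1 0 = 0 := rfl
  have h3 : (uni s).1 1 1 = 1 := rfl
  simp only [Matrix.mul_apply, PM_apply, Matrix.one_apply, Matrix.single_apply, Fin.sum_univ_two,
    Matrix.transpose_apply, Matrix.sub_apply, h0, h1, h2, h3]
  have hsym : (i = a ∧ j = b) ↔ (a = i ∧ b = j) := by constructor <;> (rintro ⟨rfl, rfl⟩; simp)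
  simp only [hsym]
  by_cases h1 : a = i <;> by_cases h4 : b = j <;> simp [h1, h4]

lemma emb_diag_uni {i j : Fin n} (hij : i ≠ j) (d : Fin n → ℝ) (c : ℝ) (hd : d i = c * d j)
    (z : Matrix.SpecialLinearGroup (Fin n) ℝ) (hz : z.1 = Matrix.diagonal d) (s : ℝ) :
    z * emb ![i, j] (inj_pair hij) (uni s) * z⁻¹ = emb ![i, j] (inj_pair hij) (uni (c * s)) := by
  rw [mul_inv_eq_iff_eq_mul]
  apply Subtype.ext
  rw [Matrix.SpecialLinearGroup.coe_mul, Matrix.SpecialLinearGroup.coe_mul, emb_uni_coe hij, emb_uni_coe hij,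
    hz, Matrix.mul_add, Matrix.add_mul]
  congr 1
  · simp
  · ext a b
    simp only [Matrix.diagonal_mul, Matrix.mul_diagonal, Matrix.single_apply]
    split_ifs with h
    · obtain ⟨rfl, rfl⟩ := h
      rw [hd]; ring
    · simp

lemma emb_diag_uni_pow {i j : Fin n} (hij : i ≠ j) (d : Fin n → ℝ) (c : ℝ) (hd : d i = c * d j)
    (z : Matrix.SpecialLinearGroup (Fin n) ℝ) (hz : z.1 = Matrix.diagonal d) (k : ℕ) :
    z ^ k * emb ![i, j] (inj_pair hij) (uni 1) * (z ^ k)⁻¹ =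
      emb ![i, j] (inj_pair hij) (uni (c ^ k)) := by
  induction k with
  | zero => simp
  | succ k ih =>
    rw [pow_succ', show ∀ a b w : Matrix.SpecialLinearGroup (Fin n) ℝ,
      a * b * w * (a * b)⁻¹ = a * (b * w * b⁻¹) * a⁻¹ by intros; group, ih,
      emb_diag_uni hij d c hd z hz, pow_succ']

end
end Shalom


namespace Shalom
open Matrix hiding zpow_neg
open MeasureTheory Filter Topology
open scoped Pointwise

lemma grp1 {A : Type*} [Group A] (w a : A) : w⁻¹ * (w * a * w⁻¹) = a * w⁻¹ := by group
lemma grp2 {A : Type*} [Group A] (k c g : A) : k⁻¹⁻¹ * ((c * k)⁻¹ * g⁻¹ * g) = c⁻¹ := by group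

theorem main' (n : ℕ) (hn : 4 ≤ n)
    (H : Subgroup (Matrix.SpecialLinearGroup (Fin n) ℝ))
    (hH : (H : Set (Matrix.SpecialLinearGroup (Fin n) ℝ)) =
      {g : Matrix.SpecialLinearGroup (Fin n) ℝ | ∀ i j : Fin n,
        (2 ≤ (i : ℕ) ∨ 2 ≤ (j : ℕ)) →
        (g : Matrix (Fin n) (Fin n) ℝ) i j = if i = j then 1 else 0})
    (Γ : Subgroup (Matrix.SpecialLinearGroup (Fin n) ℝ))
    (hdisc : DiscreteTopology Γ)
    (hpd : ∀ K L : Set (Matrix.SpecialLinearGroup (Fin n) ℝ ⧸ H),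
          IsCompact K → IsCompact L →
          {γ : Γ | ∃ x ∈ K, ((γ : Matrix.SpecialLinearGroup (Fin n) ℝ) • x) ∈ L}.Finite)
    (hcc : ∃ K : Set (Matrix.SpecialLinearGroup (Fin n) ℝ ⧸ H), IsCompact K ∧
          ∀ x : Matrix.SpecialLinearGroup (Fin n) ℝ ⧸ H, ∃ γ ∈ Γ, ∃ y ∈ K, γ • y = x) : False := by
  obtain ⟨i0, h0⟩ : ∃ i : Fin n, i.1 = 0 := ⟨⟨0, by omega⟩, rfl⟩
  obtain ⟨i1, h1⟩ : ∃ i : Fin n, i.1 = 1 := ⟨⟨1, by omega⟩, rfl⟩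
  obtain ⟨i2, h2⟩ : ∃ i : Fin n, i.1 = 2 := ⟨⟨2, by omega⟩, rfl⟩
  obtain ⟨i3, h3⟩ : ∃ i : Fin n, i.1 = 3 := ⟨⟨3, by omega⟩, rfl⟩
  have n01 : i0 ≠ i1 := by intro h; simp [← h, h0] at h1
  have n02 : i0 ≠ i2 := by intro h; simp [← h, h0] at h2
  have n03 : i0 ≠ i3 := by intro h; simp [← h, h0] at h3
  have n12 : i1 ≠ i2 := by intro h; simp [← h, h1] at h2
  have n13 : i1 ≠ i3 := by intro h; simp [← h, h1] at h3
  have n23 : i2 ≠ i3 := by intro h; simp [← h, h2] at h3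
  set G := Matrix.SpecialLinearGroup (Fin n) ℝ with hG
  set ι : Matrix.SpecialLinearGroup (Fin 2) ℝ →* G := emb ![i0, i1] (inj_pair n01) with hι
  set j : Matrix.SpecialLinearGroup (Fin 2) ℝ →* G := emb ![i2, i3] (inj_pair n23) with hj
  set v : Matrix.SpecialLinearGroup (Fin 2) ℝ →* G := emb ![i0, i2] (inj_pair n02) with hv
  -- H is the image of ι
  have hιH : ∀ h, ι h ∈ H := by
    intro h
    have : ι h ∈ (H : Set G) := by
      rw [hH]
      intro a b hab
      rw [hι, emb_coe]
      apply embM_apply_of_notin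
      rcases hab with hab | hab
      · left; intro k hk
        rw [← hk] at hab
        fin_cases k <;> simp [h0, h1] at hab
      · right; intro k hk
        rw [← hk] at hab
        fin_cases k <;> simp [h0, h1] at hab
    exact this
  have hHι : ∀ g ∈ H, ∃ h, ι h = g := by
    intro g hg
    have hg' : g ∈ (H : Set G) := hg
    rw [hH] at hg'
    have hp := inj_pair n01
    have e : embM ![i0, i1] (g.1.submatrix ![i0, i1] ![i0, i1]) = g.1 := by
      ext a b
      have hlt : ∀ a : Fin n, (∃ k, (![i0, i1] : Fin 2 → Fin n) k = a) ∨
          (2 ≤ (a : ℕ) ∧ ∀ k, (![i0, i1] : Fin 2 → Fin n) k ≠ a) := by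
        intro a
        by_cases ha : 2 ≤ (a : ℕ)
        · right
          refine ⟨ha, fun k hk => ?_⟩
          rw [← hk] at ha
          fin_cases k <;> simp [h0, h1] at ha
        · left
          have : a.1 = 0 ∨ a.1 = 1 := by omega
          rcases this with h | h
          · exact ⟨0, Fin.ext (by simp [h0, h])⟩
          · exact ⟨1, Fin.ext (by simp [h1, h])⟩
      rcases hlt a with ⟨k, rfl⟩ | ⟨ha, ha'⟩
      · rcases hlt b with ⟨l, rfl⟩ | ⟨hb, hb'⟩
        · rw [embM_apply_pp _ hp]; rfl
        · rw [embM_apply_of_notin _ _ _ _ (Or.inr hb')]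
          exact (hg' _ _ (Or.inr hb)).symm
      · rw [embM_apply_of_notin _ _ _ _ (Or.inl ha')]
        exact (hg' _ _ (Or.inl ha)).symm
    refine ⟨⟨g.1.submatrix ![i0, i1] ![i0, i1], ?_⟩, Subtype.ext e⟩
    rw [← embM_det _ hp, e]; exact g.2
  -- properness of ι
  have propι : ∀ C : Set (G ⧸ Γ), IsCompact C → ∃ R : ℝ, ∀ h, (∃ x ∈ C, ι h • x ∈ C) → nb h ≤ R := by
    intro C hC
    obtain ⟨D, hD, hDC⟩ := lift_compact Γ C hC
    have hK : IsCompact ((QuotientGroup.mk : G → G ⧸ H) '' D⁻¹) :=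
      hD.inv.image QuotientGroup.continuous_mk
    have hfin := (hpd _ _ hK hK).image (Subtype.val : Γ → G)
    have hcomp : IsCompact (D * (Subtype.val '' {γ : Γ | ∃ x ∈ (QuotientGroup.mk : G → G ⧸ H) '' D⁻¹,
        ((γ : G) • x) ∈ (QuotientGroup.mk : G → G ⧸ H) '' D⁻¹}) * D⁻¹) :=
      (hD.mul hfin.isCompact).mul hD.inv
    have hcont : Continuous (fun g : G => g.1 i0 i0 ^ 2 + g.1 i0 i1 ^ 2 + g.1 i1 i0 ^ 2 + g.1 i1 i1 ^ 2) := by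
      have : ∀ a b, Continuous (fun g : G => g.1 a b) := fun a b =>
        (continuous_subtype_val (p := fun A : Matrix (Fin n) (Fin n) ℝ => A.det = 1)).matrix_elem a b
      exact (((this _ _).pow 2).add ((this _ _).pow 2)).add ((this _ _).pow 2) |>.add ((this _ _).pow 2)
    obtain ⟨R, hR⟩ := (hcomp.image hcont).bddAbove
    refine ⟨R, ?_⟩
    rintro h ⟨x, hx, hhx⟩
    obtain ⟨c1, hc1, rfl⟩ := hDC x hx
    obtain ⟨c2, hc2, he⟩ := hDC _ hhx
    have he : (QuotientGroup.mk c2 : G ⧸ Γ) = QuotientGroup.mk (ι h * c1) := he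
    have hγ := QuotientGroup.eq.1 he
    have hmem : ι h ∈ D * (Subtype.val '' {γ : Γ | ∃ x ∈ (QuotientGroup.mk : G → G ⧸ H) '' D⁻¹,
        ((γ : G) • x) ∈ (QuotientGroup.mk : G → G ⧸ H) '' D⁻¹}) * D⁻¹ := by
      refine ⟨c2 * (c2⁻¹ * (ι h * c1)), ⟨c2, hc2, c2⁻¹ * (ι h * c1), ⟨⟨_, hγ⟩, ?_, rfl⟩, rfl⟩,
        c1⁻¹, Set.inv_mem_inv.2 hc1, by group⟩
      refine ⟨QuotientGroup.mk c1⁻¹, ⟨c1⁻¹, Set.inv_mem_inv.2 hc1, rfl⟩, c2⁻¹, Set.inv_mem_inv.2 hc2, ?_⟩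
      show (QuotientGroup.mk c2⁻¹ : G ⧸ H) = QuotientGroup.mk (c2⁻¹ * (ι h * c1) * c1⁻¹)
      rw [QuotientGroup.eq]
      have : c2⁻¹⁻¹ * (c2⁻¹ * (ι h * c1) * c1⁻¹) = ι h := by group
      rw [this]; exact hιH h
    have := hR ⟨_, hmem, rfl⟩
    have hent : ∀ a b : Fin 2, (ι h).1 ((![i0, i1] : Fin 2 → Fin n) a) ((![i0, i1] : Fin 2 → Fin n) b) = h a b := by
      intro a b
      rw [hι, emb_coe, embM_apply_pp _ (inj_pair n01)]
    have e00 : (ι h).1 i0 i0 = h 0 0 := hent 0 0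
    have e01 : (ι h).1 i0 i1 = h 0 1 := hent 0 1
    have e10 : (ι h).1 i1 i0 = h 1 0 := hent 1 0
    have e11 : (ι h).1 i1 i1 = h 1 1 := hent 1 1
    simp only [e00, e01, e10, e11] at this
    exact this
  -- conjugates
  have propconj : ∀ (w : G) (ψ : Matrix.SpecialLinearGroup (Fin 2) ℝ →* G),
      (∀ h, ψ h = w * ι h * w⁻¹) → ∀ C : Set (G ⧸ Γ), IsCompact C →
      ∃ R : ℝ, ∀ h, (∃ x ∈ C, ψ h • x ∈ C) → nb h ≤ R := by
    intro w ψ hψ C hC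
    have hC' : IsCompact ((fun x : G ⧸ Γ => w⁻¹ • x) '' C) := hC.image (continuous_const_smul _)
    obtain ⟨R, hR⟩ := propι _ hC'
    refine ⟨R, ?_⟩
    rintro h ⟨x, hx, hx'⟩
    refine hR h ⟨w⁻¹ • x, ⟨x, hx, rfl⟩, ψ h • x, hx', ?_⟩
    simp only [hψ, smul_smul]
    congr 1
    exact grp1 w (ι h)
  have propj : ∀ C : Set (G ⧸ Γ), IsCompact C → ∃ R : ℝ, ∀ h, (∃ x ∈ C, j h • x ∈ C) → nb h ≤ R := by
    have hs : Equiv.Perm.sign (Equiv.swap i0 i2 * Equiv.swap i1 i3) = 1 := by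
      rw [Equiv.Perm.sign_mul, Equiv.Perm.sign_swap n02, Equiv.Perm.sign_swap n13]; rfl
    apply propconj (permSL _ hs)
    intro h
    rw [hι, ← permSL_conj, hj]
    refine DFunLike.congr_fun (emb_congr _ _ _ _ ?_) h
    rw [comp_pair]
    simp only [Equiv.Perm.mul_apply]
    rw [Equiv.swap_apply_of_ne_of_ne n01 n03, Equiv.swap_apply_left, Equiv.swap_apply_left,
      Equiv.swap_apply_of_ne_of_ne n03.symm n23.symm]
  have propv : ∀ C : Set (G ⧸ Γ), IsCompact C → ∃ R : ℝ, ∀ h, (∃ x ∈ C, v h • x ∈ C) → nb h ≤ R := by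
    have hs : Equiv.Perm.sign (Equiv.swap i1 i3 * Equiv.swap i1 i2) = 1 := by
      rw [Equiv.Perm.sign_mul, Equiv.Perm.sign_swap n13, Equiv.Perm.sign_swap n12]; rfl
    apply propconj (permSL _ hs)
    intro h
    rw [hι, ← permSL_conj, hv]
    refine DFunLike.congr_fun (emb_congr _ _ _ _ ?_) h
    rw [comp_pair]
    simp only [Equiv.Perm.mul_apply]
    rw [Equiv.swap_apply_of_ne_of_ne n01 n02, Equiv.swap_apply_left,
      Equiv.swap_apply_of_ne_of_ne n01 n03, Equiv.swap_apply_of_ne_of_ne n12.symm n23]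
  -- cocompactness
  obtain ⟨K, hK, hKc⟩ := hcc
  obtain ⟨D, hD, hDK⟩ := lift_compact H K hK
  have hF₀ : IsCompact ((QuotientGroup.mk : G → G ⧸ Γ) '' D⁻¹) :=
    hD.inv.image QuotientGroup.continuous_mk
  have hcov : ∀ x : G ⧸ Γ, ∃ h, ι h • x ∈ (QuotientGroup.mk : G → G ⧸ Γ) '' D⁻¹ := by
    intro x
    obtain ⟨g, rfl⟩ := QuotientGroup.mk_surjective x
    obtain ⟨γ, hγ, y, hy, he⟩ := hKc (QuotientGroup.mk g⁻¹)
    obtain ⟨k, hk, rfl⟩ := hDK y hy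
    have he : (QuotientGroup.mk (γ * k) : G ⧸ H) = QuotientGroup.mk g⁻¹ := he
    have hm := QuotientGroup.eq.1 he
    obtain ⟨h, hh⟩ := hHι _ hm
    refine ⟨h, k⁻¹, Set.inv_mem_inv.2 hk, ?_⟩
    show (QuotientGroup.mk k⁻¹ : G ⧸ Γ) = QuotientGroup.mk (ι h * g)
    rw [QuotientGroup.eq, hh]
    have : k⁻¹⁻¹ * ((γ * k)⁻¹ * g⁻¹ * g) = γ⁻¹ := grp2 k γ g
    rw [this]; exact Γ.inv_mem hγ
  -- the measure
  letI : MeasurableSpace G := borel G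
  haveI : BorelSpace G := ⟨rfl⟩
  let ν : Measure G := Measure.haar
  haveI : ν.IsMulRightInvariant := by
    constructor
    intro g
    rw [Measure.map_right_mul_eq_modularCharacterFun_smul]
    have : Measure.modularCharacterFun g = 1 := hom_trivial (by omega) (Measure.modularCharacter (G := G)) g
    rw [this, one_smul]
  haveI : IsClosed (Γ : Set G) := Subgroup.isClosed_of_discrete
  haveI : T2Space (G ⧸ Γ) := inferInstance
  obtain ⟨hB, μ, hinv, hlf, hμ0⟩ := quotient_measure ν Γ
  haveI : LocallyCompactSpace (G ⧸ Γ) := inferInstance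
  haveI : SecondCountableTopology (G ⧸ Γ) := inferInstance
  haveI : SigmaCompactSpace (G ⧸ Γ) := inferInstance
  haveI : T3Space (G ⧸ Γ) := inferInstance
  haveI : TopologicalSpace.MetrizableSpace (G ⧸ Γ) := inferInstance
  haveI : μ.Regular := inferInstance
  haveI : SigmaFinite μ := inferInstance
  -- the central element
  obtain ⟨d, z, hz, hd0, hd1, hd2, hd3⟩ : ∃ (d : Fin n → ℝ) (z : G), z.1 = Matrix.diagonal d ∧
      d i0 = 1/2 ∧ d i1 = 1/2 ∧ d i2 = 2 ∧ d i3 = 2 := by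
    refine ⟨fun a => (if a = i0 then (1/2 : ℝ) else if a = i2 then (1/2 : ℝ)⁻¹ else 1) *
        (if a = i1 then (1/2 : ℝ) else if a = i3 then (1/2 : ℝ)⁻¹ else 1),
      Matrix.SpecialLinearGroup.diag2n n02 (1/2 : ℝ) (by norm_num) *
      Matrix.SpecialLinearGroup.diag2n n13 (1/2 : ℝ) (by norm_num), ?_, ?_⟩
    · rw [Matrix.SpecialLinearGroup.coe_mul, Matrix.SpecialLinearGroup.diag2n_coe,
        Matrix.SpecialLinearGroup.diag2n_coe, Matrix.diagonal_mul_diagonal]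
    · refine ⟨?_, ?_, ?_, ?_⟩
      · simp [n01, n03]
      · simp [n01.symm, n12]
      · simp [n02.symm, n12.symm, n23]
      · simp [n03.symm, n13.symm, n23.symm]
  refine abstract_main μ hμ0 ι j ?_ propι propj ?_ ?_ _ hF₀ hcov z (v (uni 1)) ?_ ?_ ?_ ?_
  · intro h h'
    refine emb_comm _ _ _ _ ?_ _ _
    intro a b
    fin_cases a <;> fin_cases b <;> simp [n02.symm, n12.symm, n03.symm, n13.symm]
  · intro R
    exact (isCompact_nb R).image (continuous_emb _ _)
  · exact (continuous_emb _ _).comp continuous_rot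
  · intro h
    refine emb_diag_comm _ _ d (1/2) ?_ z hz h
    intro k; fin_cases k
    · exact hd0
    · exact hd1
  · intro h
    refine emb_diag_comm _ _ d 2 ?_ z hz h
    intro k; fin_cases k
    · exact hd2
    · exact hd3
  · have : (fun k : ℕ => z ^ k * v (uni 1) * (z ^ k)⁻¹) = fun k : ℕ => v (uni ((1/4 : ℝ) ^ k)) := by
      funext k
      exact emb_diag_uni_pow n02 d (1/4) (by rw [hd0, hd2]; norm_num) z hz k
    rw [this]
    have hc : Continuous (fun s : ℝ => v (uni s)) := (continuous_emb _ _).comp continuous_uni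
    have h0 : v (uni 0) = 1 := by rw [uni_zero, map_one]
    rw [← h0]
    exact (hc.tendsto 0).comp (tendsto_pow_atTop_nhds_zero_of_lt_one (by norm_num) (by norm_num))
  · intro C hC
    obtain ⟨R, hR⟩ := propv C hC
    obtain ⟨m0, hm0⟩ := exists_nat_gt R
    refine ⟨m0 + 1, by omega, fun m hm x hx hux => ?_⟩
    have := hR (uni m) ⟨x, hx, by rwa [← map_pow, uni_pow] at hux⟩
    rw [nb_uni] at this
    have hm' : (m0 : ℝ) + 1 ≤ m := by exact_mod_cast hm
    have : (0 : ℝ) ≤ m0 := by positivity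
    nlinarith

end Shalom


/-- **Shalom.**  Let `n ≥ 4` and let `H` be the upper-left embedded copy of `SL(2, ℝ)` in
`SL(n, ℝ)` (block matrices `diag(A, I_{n−2})`).  No discrete subgroup `Γ` of `SL(n, ℝ)` acts
freely, properly discontinuously and cocompactly on `SL(n, ℝ)/H` by left multiplication:
`SL(2,ℝ)\SL(n,ℝ)` has no compact Clifford–Klein form for `n ≥ 4`. -/
theorem shalom_no_compact_form_real (n : ℕ) (hn : 4 ≤ n)
    (H : Subgroup (Matrix.SpecialLinearGroup (Fin n) ℝ))
    (hH : (H : Set (Matrix.SpecialLinearGroup (Fin n) ℝ)) =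
      {g : Matrix.SpecialLinearGroup (Fin n) ℝ | ∀ i j : Fin n,
        (2 ≤ (i : ℕ) ∨ 2 ≤ (j : ℕ)) →
        (g : Matrix (Fin n) (Fin n) ℝ) i j = if i = j then 1 else 0})
    (Γ : Subgroup (Matrix.SpecialLinearGroup (Fin n) ℝ))
    (hdisc : DiscreteTopology Γ) :
    ¬ ((∀ γ : Γ, (∃ x : Matrix.SpecialLinearGroup (Fin n) ℝ ⧸ H,
          (γ : Matrix.SpecialLinearGroup (Fin n) ℝ) • x = x) → γ = 1) ∧
        (∀ K L : Set (Matrix.SpecialLinearGroup (Fin n) ℝ ⧸ H),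
          IsCompact K → IsCompact L →
          {γ : Γ | ∃ x ∈ K, ((γ : Matrix.SpecialLinearGroup (Fin n) ℝ) • x) ∈ L}.Finite) ∧
        (∃ K : Set (Matrix.SpecialLinearGroup (Fin n) ℝ ⧸ H), IsCompact K ∧
          ∀ x : Matrix.SpecialLinearGroup (Fin n) ℝ ⧸ H, ∃ γ ∈ Γ, ∃ y ∈ K, γ • y = x)) := by
  rintro ⟨-, hpd, hcc⟩
  exact Shalom.main' n hn H hH Γ hdisc hpd hcc
end

section
/- (Constantine) Let n, m, k, l be positive integers with k ≥ 2, l ≥ 3, n − k ≥ 1 and m − l ≥ 1. Let H be the subgroup of SO(n,m) consisting of the elements that fix pointwise the standard basis vectors e_{n−k+1}, …, e_n and e_{n+m−l+1}, …, e_{n+m}; H is a block-embedded copy of SO(n−k, m−l). Then there is no discrete subgroup Γ of SO(n,m) whose action by left multiplication on the coset space SO(n,m)/H is free, properly discontinuous and cocompact; i.e., the homogeneous space SO(n−k,m−l)\SO(n,m) admits no compact Clifford–Klein form. -/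
open Matrix

set_option synthInstance.maxHeartbeats 1000000
set_option maxHeartbeats 1000000

/-- The symmetric form matrix `η` of signature `(a, b)` on `ℝ^{a+b}`:
`a` entries `+1` followed by `b` entries `−1`. -/
def pseudoForm (a b : ℕ) : Matrix (Fin (a + b)) (Fin (a + b)) ℝ :=
  Matrix.diagonal (fun i => if (i : ℕ) < a then (1 : ℝ) else -1)

namespace CKForm

open Set Topology

section Topological

variable {G : Type*} [Group G] [TopologicalSpace G] [IsTopologicalGroup G]

/-- Compact subsets of `G/H` are covered by images of compact subsets of `G`. -/
lemma exists_compact_lift [LocallyCompactSpace G] (H : Subgroup G) (K : Set (G ⧸ H))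
    (hK : IsCompact K) :
    ∃ M : Set G, IsCompact M ∧ K ⊆ (QuotientGroup.mk : G → G ⧸ H) '' M := by
  choose N hN hNx using fun x : G => exists_compact_mem_nhds x
  obtain ⟨t, -, ht⟩ := hK.elim_nhds_subcover
    (fun x => (QuotientGroup.mk : G → G ⧸ H) '' (N x.out)) (by
      intro x _
      have := (QuotientGroup.isOpenMap_coe (N := H)).image_mem_nhds (hNx x.out)
      simpa using this)
  refine ⟨⋃ x ∈ t, N x.out, t.isCompact_biUnion fun x _ => hN _, ?_⟩
  intro y hy
  obtain ⟨x, hx, z, hz, rfl⟩ := mem_iUnion₂.1 (ht hy)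
  exact ⟨z, mem_biUnion hx hz, rfl⟩

/-- If `H ≤ H'` and `H' ⊆ C H C` with `C` compact, a properly discontinuous cocompact action
on `G/H` forces `H'` to be compact modulo `H`. -/
lemma compact_mod [LocallyCompactSpace G] (H H' Γ : Subgroup G) (hle : H ≤ H')
    (C : Set G) (hC : IsCompact C)
    (hdec : ∀ g ∈ H', ∃ c ∈ C, ∃ d ∈ C, c⁻¹ * g * d ∈ H)
    (hpd : ∀ K L : Set (G ⧸ H), IsCompact K → IsCompact L →
      {γ : Γ | ∃ x ∈ K, ((γ : G) • x) ∈ L}.Finite)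
    (K : Set (G ⧸ H)) (hK : IsCompact K)
    (hcov : ∀ x : G ⧸ H, ∃ γ ∈ Γ, ∃ y ∈ K, γ • y = x) :
    ∃ M : Set G, IsCompact M ∧ ∀ g ∈ H', ∃ a ∈ M, ∃ h ∈ H, g = a * h := by
  obtain ⟨M, hM, hKM⟩ := exists_compact_lift H K hK
  have hmk : Continuous (QuotientGroup.mk : G → G ⧸ H) := QuotientGroup.continuous_mk
  have hfin := hpd (QuotientGroup.mk '' ((fun p : G × G => p.1 * p.2) '' (M ×ˢ C)))
    (QuotientGroup.mk '' C)
    (((hM.prod hC).image continuous_mul).image hmk) (hC.image hmk)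
  set F := {γ : Γ | ∃ x ∈ (QuotientGroup.mk : G → G ⧸ H) ''
    ((fun p : G × G => p.1 * p.2) '' (M ×ˢ C)), ((γ : G) • x) ∈
      (QuotientGroup.mk : G → G ⧸ H) '' C}
  refine ⟨⋃ γ ∈ F, (fun x => (γ : G) * x) '' M,
    hfin.isCompact_biUnion fun γ _ => hM.image (continuous_const_mul _), ?_⟩
  intro g hg
  obtain ⟨γ, hγ, y, hy, hyx⟩ := hcov (QuotientGroup.mk g)
  obtain ⟨a, ha, rfl⟩ := hKM hy
  have h1 : (γ * a)⁻¹ * g ∈ H := QuotientGroup.eq.1 hyx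
  have h2 : γ * a ∈ H' := by
    have := H'.mul_mem hg (H'.inv_mem (hle h1))
    simpa [mul_assoc] using this
  obtain ⟨c, hc, d, hd, hcd⟩ := hdec _ h2
  have hF : (⟨γ, hγ⟩ : Γ) ∈ F := by
    refine ⟨_, ⟨_, ⟨(a, d), ⟨ha, hd⟩, rfl⟩, rfl⟩, c, hc, ?_⟩
    refine QuotientGroup.eq.2 ?_
    simpa [mul_assoc] using hcd
  exact ⟨γ * a, mem_biUnion hF ⟨a, ha, rfl⟩, _, h1, by group⟩

end Topological

section Mat

variable {ι : Type*} [Fintype ι] [DecidableEq ι]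

/-- Reflections preserve the form. -/
lemma reflection_form (η v : ι → ℝ) (c : ℝ) (hc : c * (c * (v ⬝ᵥ (η * v)) - 2) = 0) :
    (1 - c • vecMulVec v (η * v))ᵀ * diagonal η * (1 - c • vecMulVec v (η * v)) = diagonal η := by
  have e1 : diagonal η * vecMulVec v (η * v) = vecMulVec (η * v) (η * v) := by
    ext i j; simp [diagonal_mul, vecMulVec_apply, mul_assoc]
  have e2 : vecMulVec (η * v) v * diagonal η = vecMulVec (η * v) (η * v) := by
    ext i j; simp [mul_diagonal, vecMulVec_apply]; ring
  have e3 : vecMulVec (η * v) (η * v) * vecMulVec v (η * v)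
      = (v ⬝ᵥ (η * v)) • vecMulVec (η * v) (η * v) := by
    rw [vecMulVec_mul_vecMulVec, vecMulVec_smul, dotProduct_comm]
  rw [transpose_sub, transpose_one, transpose_smul, transpose_vecMulVec, sub_mul, one_mul,
    smul_mul_assoc, e2, mul_sub, mul_one, mul_smul_comm, sub_mul, smul_mul_assoc, e1, e3]
  ext i j
  simp only [Matrix.sub_apply, Matrix.smul_apply, smul_eq_mul]
  linear_combination (vecMulVec (η * v) (η * v) i j) * hc

lemma reflection_apply (w v : ι → ℝ) (c : ℝ) (j : ι) :
    (1 - c • vecMulVec v w) *ᵥ Pi.single j 1 = Pi.single j 1 - (c * w j) • v := by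
  rw [sub_mulVec, one_mulVec, smul_mulVec, vecMulVec_mulVec]
  ext i
  simp; ring

/-- Correct the determinant of a form preserving matrix by a coordinate reflection. -/
lemma fix_det (η : ι → ℝ) (hη : ∀ i, η i = 1 ∨ η i = -1) (b : ι) (R : Matrix ι ι ℝ)
    (hR : Rᵀ * diagonal η * R = diagonal η) :
    ∃ r : GL ι ℝ, (r : Matrix ι ι ℝ).det = 1 ∧
      (r : Matrix ι ι ℝ)ᵀ * diagonal η * r = diagonal η ∧
      (∀ j, j ≠ b → (r : Matrix ι ι ℝ) *ᵥ Pi.single j 1 = R *ᵥ Pi.single j 1) ∧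
      (Rᵀ * R = 1 → (r : Matrix ι ι ℝ)ᵀ * r = 1) := by
  have hd : R.det = 1 ∨ R.det = -1 := by
    have h := congrArg det hR
    rw [det_mul, det_mul, det_transpose, det_diagonal] at h
    have h0 : (∏ i, η i) ≠ 0 := by
      refine Finset.prod_ne_zero_iff.2 fun i _ => ?_
      rcases hη i with h | h <;> rw [h] <;> norm_num
    have : R.det * R.det = 1 := mul_right_cancel₀ h0 (by linear_combination h)
    exact mul_self_eq_one_iff.1 this
  rcases hd with hd | hd
  · refine ⟨GeneralLinearGroup.mkOfDetNeZero R (by rw [hd]; norm_num), hd, hR, fun j _ => rfl,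
      fun h => h⟩
  · set S : Matrix ι ι ℝ := diagonal (fun i => if i = b then -1 else 1) with hS
    have hSd : S.det = -1 := by simp [hS, det_diagonal, Finset.prod_ite_eq']
    have hdet : (R * S).det = 1 := by rw [det_mul, hd, hSd]; norm_num
    have hST : Sᵀ = S := by simp [hS]
    have hSη : S * diagonal η * S = diagonal η := by
      rw [hS, diagonal_mul_diagonal, diagonal_mul_diagonal]
      congr 1; ext i; split_ifs <;> ring
    have hSS : S * S = 1 := by
      rw [hS, diagonal_mul_diagonal, ← diagonal_one]
      congr 1; ext i; split_ifs <;> norm_num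
    refine ⟨GeneralLinearGroup.mkOfDetNeZero (R * S) (by rw [hdet]; norm_num), hdet, ?_, ?_, ?_⟩
    · change (R * S)ᵀ * diagonal η * (R * S) = diagonal η
      rw [transpose_mul, hST]
      calc S * Rᵀ * diagonal η * (R * S) = S * (Rᵀ * diagonal η * R) * S := by
            simp only [mul_assoc]
        _ = _ := by rw [hR, hSη]
    · intro j hj
      change (R * S) *ᵥ Pi.single j 1 = _
      rw [← mulVec_mulVec]
      congr 1
      ext i
      simp only [hS, mulVec_diagonal, Pi.single_apply]
      by_cases hij : i = j
      · simp [hij, hj]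
      · simp [hij]
    · intro h
      change (R * S)ᵀ * (R * S) = 1
      rw [transpose_mul, hST]
      calc S * Rᵀ * (R * S) = S * (Rᵀ * R) * S := by simp only [mul_assoc]
        _ = 1 := by rw [h, mul_one, hSS]

/-- A rotation in the directions of sign `η d` carrying `e_d` to a given unit vector. -/
lemma exists_rotation (η : ι → ℝ) (hη : ∀ i, η i = 1 ∨ η i = -1) (d b : ι) (hb : b ≠ d)
    (u : ι → ℝ) (hu : ∀ i, η i ≠ η d → u i = 0) (hu1 : u ⬝ᵥ u = 1) :
    ∃ r : GL ι ℝ, (r : Matrix ι ι ℝ).det = 1 ∧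
      (r : Matrix ι ι ℝ)ᵀ * diagonal η * r = diagonal η ∧
      (r : Matrix ι ι ℝ)ᵀ * r = 1 ∧
      (r : Matrix ι ι ℝ) *ᵥ Pi.single d 1 = u ∧
      (∀ j, j ≠ b → j ≠ d → u j = 0 →
        (r : Matrix ι ι ℝ) *ᵥ Pi.single j 1 = Pi.single j 1) := by
  set v : ι → ℝ := Pi.single d 1 - u with hv
  have hvv : v ⬝ᵥ v = 2 - 2 * u d := by
    simp [hv, sub_dotProduct, dotProduct_sub, hu1]; ring
  have hvη : η * v = η d • v := by
    ext i
    by_cases h : η i = η d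
    · simp [h]
    · have : i ≠ d := fun h' => h (by rw [h'])
      simp [hv, hu i h, this]
  have hηd : η d * η d = 1 := by rcases hη d with h | h <;> rw [h] <;> norm_num
  obtain ⟨c, hc, hc2⟩ : ∃ c : ℝ, c * (c * (v ⬝ᵥ v) - 2) = 0 ∧ (c * (1 - u d)) • v = v := by
    by_cases h : v ⬝ᵥ v = 0
    · exact ⟨0, by simp, by rw [dotProduct_self_eq_zero.1 h]; simp⟩
    · refine ⟨2 / (v ⬝ᵥ v), by rw [div_mul_cancel₀ _ h]; simp, ?_⟩
      have : 2 / (v ⬝ᵥ v) * (1 - u d) = 1 := by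
        rw [div_mul_eq_mul_div, div_eq_one_iff_eq h, hvv]; ring
      rw [this, one_smul]
  have hR1 : (1 - c • vecMulVec v v)ᵀ * diagonal η * (1 - c • vecMulVec v v) = diagonal η := by
    have := reflection_form η v (c * η d) (by
      rw [hvη, dotProduct_smul, smul_eq_mul]
      linear_combination (c * c * (v ⬝ᵥ v) * η d) * hηd + η d * hc)
    rw [hvη, vecMulVec_smul, smul_smul, mul_assoc c, hηd, mul_one] at this
    exact this
  have hR2 : (1 - c • vecMulVec v v)ᵀ * (1 - c • vecMulVec v v) = 1 := by
    have := reflection_form 1 v c (by simpa using hc)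
    rw [one_mul] at this
    have h1 : diagonal (1 : ι → ℝ) = 1 := diagonal_one
    rwa [h1, mul_one] at this
  obtain ⟨r, h1, h2, h3, h4⟩ := fix_det η hη b _ hR1
  refine ⟨r, h1, h2, h4 hR2, ?_, ?_⟩
  · rw [h3 d hb.symm, reflection_apply]
    have : v d = 1 - u d := by simp [hv]
    rw [this, hc2, hv]; simp
  · intro j hj hjd huj
    rw [h3 j hj, reflection_apply]
    have : v j = 0 := by simp [hv, huj, hjd]
    simp [this]

/-- Boosts with arbitrarily large matrix coefficients. -/
lemma exists_boost (η : ι → ℝ) (hη : ∀ i, η i = 1 ∨ η i = -1) (d b a : ι) (hb : b ≠ d)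
    (ha : η a = - η d) (B : ℝ) :
    ∃ r : GL ι ℝ, (r : Matrix ι ι ℝ).det = 1 ∧
      (r : Matrix ι ι ℝ)ᵀ * diagonal η * r = diagonal η ∧
      B < |(r : Matrix ι ι ℝ) d d| ∧
      (∀ j, j ≠ b → j ≠ d → j ≠ a →
        (r : Matrix ι ι ℝ) *ᵥ Pi.single j 1 = Pi.single j 1) := by
  have hηd : η d * η d = 1 := by rcases hη d with h | h <;> rw [h] <;> norm_num
  have had : a ≠ d := by
    rintro rfl
    nlinarith
  set x : ℝ := |B| + 1
  set y : ℝ := Real.sqrt (1 + x ^ 2)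
  have hy : y * y = 1 + x ^ 2 := Real.mul_self_sqrt (by positivity)
  set v : ι → ℝ := Pi.single a x + Pi.single d y with hv
  have hva : v a = x := by simp [hv, had]
  have hvd : v d = y := by simp [hv, had.symm]
  have hq : v ⬝ᵥ (η * v) = η d := by
    rw [hv, add_dotProduct, single_dotProduct, single_dotProduct, ← hv]
    simp only [Pi.mul_apply, hva, hvd, ha]
    linear_combination η d * hy
  obtain ⟨r, h1, h2, h3, -⟩ := fix_det η hη b _
    (reflection_form η v (2 * η d) (by rw [hq]; linear_combination (4 * η d) * hηd))
  refine ⟨r, h1, h2, ?_, ?_⟩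
  · have := congrFun (h3 d hb.symm) d
    rw [reflection_apply] at this
    simp only [mulVec_single_one, col_apply, Pi.sub_apply, Pi.single_eq_same, Pi.smul_apply,
      Pi.mul_apply, hvd, smul_eq_mul] at this
    have h : (r : Matrix ι ι ℝ) d d = 1 - 2 * (1 + x ^ 2) := by
      rw [this]; linear_combination (-2 * y * y) * hηd - 2 * hy
    rw [h]
    have hx : B < x := (le_abs_self B).trans_lt (lt_add_one _)
    have hx1 : 1 ≤ x := by simp [x]
    refine lt_of_lt_of_le ?_ (neg_le_abs _)
    nlinarith
  · intro j hjb hjd hja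
    rw [h3 j hjb, reflection_apply]
    have : v j = 0 := by simp [hv, hjd, hja]
    simp [this]

/-- The key linear algebra fact: dimension count. -/
lemma exists_vector (η : ι → ℝ) (hη : ∀ i, η i = 1 ∨ η i = -1) (D : ι → Prop) (d : ι)
    (hd : D d)
    (hcard : Nat.card {i // ¬ D i ∧ η i ≠ η d} ≤ Nat.card {i // ¬ D i ∧ η i = η d})
    (A : Matrix ι ι ℝ) (hA : Aᵀ * diagonal η * A = diagonal η)
    (hfix : ∀ j, D j → j ≠ d → A *ᵥ Pi.single j 1 = Pi.single j 1) :
    ∃ w : ι → ℝ, w ⬝ᵥ w = 1 ∧ (A *ᵥ w) ⬝ᵥ (A *ᵥ w) = 1 ∧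
      (∀ i, η i ≠ η d → w i = 0) ∧ (∀ i, η i ≠ η d → (A *ᵥ w) i = 0) ∧
      (∀ i, D i → i ≠ d → w i = 0) ∧ (∀ i, D i → i ≠ d → (A *ᵥ w) i = 0) := by
  classical
  have hη0 : ∀ i, η i ≠ 0 := fun i => by rcases hη i with h | h <;> rw [h] <;> norm_num
  have hform : ∀ x y : ι → ℝ, (A *ᵥ x) ⬝ᵥ (η * (A *ᵥ y)) = x ⬝ᵥ (η * y) := by
    intro x y
    have h1 : ∀ z : ι → ℝ, η * z = diagonal η *ᵥ z := by
      intro z; ext i; simp [mulVec_diagonal]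
    rw [h1, h1]
    conv_rhs => rw [← hA, ← mulVec_mulVec, ← mulVec_mulVec, dotProduct_mulVec, vecMul_transpose]
  -- the zero-extended vectors
  let P : ι → Prop := fun i => ¬ D i ∧ η i ≠ η d
  let W : ι → Prop := fun i => (¬ D i ∧ η i = η d) ∨ i = d
  let f : (ι → ℝ) →ₗ[ℝ] ({i // ¬ W i} → ℝ) × ({i // P i} → ℝ) :=
    LinearMap.prod (LinearMap.funLeft ℝ ℝ Subtype.val)
      ((LinearMap.funLeft ℝ ℝ Subtype.val).comp (mulVecLin A))
  have hlt : Module.finrank ℝ (({i // ¬ W i} → ℝ) × ({i // P i} → ℝ))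
      < Module.finrank ℝ (ι → ℝ) := by
    rw [Module.finrank_prod, Module.finrank_fintype_fun_eq_card,
      Module.finrank_fintype_fun_eq_card, Module.finrank_fintype_fun_eq_card]
    rw [Nat.card_eq_fintype_card, Nat.card_eq_fintype_card] at hcard
    have h1 : Fintype.card {i // W i} = Fintype.card {i // ¬ D i ∧ η i = η d} + 1 := by
      rw [Fintype.card_subtype_or_disjoint]
      · simp
      · rw [Pi.disjoint_iff]
        intro i
        simp only [Prop.disjoint_iff]
        rintro ⟨h1, h2⟩
        exact h1.1 (h2 ▸ hd)
    have h2 := Fintype.card_subtype_compl W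
    have h3 := Fintype.card_subtype_le W
    have h4 : Fintype.card {i // P i} ≤ Fintype.card {i // ¬ D i ∧ η i = η d} := hcard
    omega
  obtain ⟨w0, hw0, hne⟩ := Submodule.exists_mem_ne_zero_of_ne_bot
    (LinearMap.ker_ne_bot_of_finrank_lt (f := f) hlt)
  have hpos : 0 < w0 ⬝ᵥ w0 := lt_of_le_of_ne (Finset.sum_nonneg fun i _ => mul_self_nonneg (w0 i))
    (fun h => hne (dotProduct_self_eq_zero.1 h.symm))
  set s : ℝ := (Real.sqrt (w0 ⬝ᵥ w0))⁻¹ with hs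
  have hss : s * s * (w0 ⬝ᵥ w0) = 1 := by
    rw [hs, ← mul_inv, Real.mul_self_sqrt hpos.le, inv_mul_cancel₀ hpos.ne']
  have hker := LinearMap.mem_ker.1 hw0
  have hk1 : ∀ i, ¬ W i → w0 i = 0 := fun i hi =>
    congrFun (congrArg Prod.fst hker) ⟨i, hi⟩
  have hk2 : ∀ i, P i → (A *ᵥ w0) i = 0 := fun i hi =>
    congrFun (congrArg Prod.snd hker) ⟨i, hi⟩
  have a1 : ∀ i, η i ≠ η d → w0 i = 0 := fun i hi => hk1 i (by
    rintro (h | h)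
    · exact hi h.2
    · exact hi (by rw [h]))
  have a2 : ∀ i, D i → i ≠ d → w0 i = 0 := fun i hi hid => hk1 i (by
    rintro (h | h)
    · exact h.1 hi
    · exact hid h)
  have a3 : ∀ i, D i → i ≠ d → (A *ᵥ w0) i = 0 := by
    intro i hi hid
    have h := hform (Pi.single i 1) w0
    rw [hfix i hi hid, single_dotProduct, single_dotProduct] at h
    simp only [Pi.mul_apply, a2 i hi hid, one_mul, mul_zero] at h
    exact (mul_eq_zero.1 h).resolve_left (hη0 i)
  have a4 : ∀ i, η i ≠ η d → (A *ᵥ w0) i = 0 := by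
    intro i hi
    by_cases hD : D i
    · exact a3 i hD (fun h => hi (by rw [h]))
    · exact hk2 i ⟨hD, hi⟩
  have hsm : ∀ z : ι → ℝ, (∀ i, η i ≠ η d → z i = 0) → η * z = η d • z := by
    intro z hz
    ext i
    by_cases h : η i = η d
    · simp [h]
    · simp [hz i h]
  have a5 : (A *ᵥ w0) ⬝ᵥ (A *ᵥ w0) = w0 ⬝ᵥ w0 := by
    have h := hform w0 w0
    rw [hsm _ a1, hsm _ a4, dotProduct_smul, dotProduct_smul] at h
    exact mul_left_cancel₀ (hη0 d) h
  refine ⟨s • w0, ?_, ?_, ?_, ?_, ?_, ?_⟩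
  · rw [smul_dotProduct, dotProduct_smul, smul_eq_mul, smul_eq_mul, ← mul_assoc, hss]
  · rw [mulVec_smul, smul_dotProduct, dotProduct_smul, smul_eq_mul, smul_eq_mul, ← mul_assoc, a5,
      hss]
  · intro i hi; simp [a1 i hi]
  · intro i hi; simp [mulVec_smul, a4 i hi]
  · intro i hi hid; simp [a2 i hi hid]
  · intro i hi hid; simp [mulVec_smul, a3 i hi hid]

/-- The general nonexistence statement. -/
theorem no_compact_form (η : ι → ℝ) (hη : ∀ i, η i = 1 ∨ η i = -1) (D : ι → Prop) (d a : ι)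
    (hd : D d) (haD : ¬ D a) (ha : η a = - η d)
    (hcard : Nat.card {i // ¬ D i ∧ η i ≠ η d} ≤ Nat.card {i // ¬ D i ∧ η i = η d})
    (G : Subgroup (GL ι ℝ))
    (hG : ∀ g, g ∈ G ↔ (g : Matrix ι ι ℝ).det = 1 ∧
      (g : Matrix ι ι ℝ)ᵀ * diagonal η * g = diagonal η)
    (H : Subgroup G)
    (hH : ∀ g : G, g ∈ H ↔ ∀ j, D j →
      ((g : GL ι ℝ) : Matrix ι ι ℝ) *ᵥ Pi.single j 1 = Pi.single j 1)
    (Γ : Subgroup G)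
    (hpd : ∀ K L : Set (G ⧸ H), IsCompact K → IsCompact L →
      {γ : Γ | ∃ x ∈ K, ((γ : G) • x) ∈ L}.Finite)
    (K : Set (G ⧸ H)) (hK : IsCompact K)
    (hcov : ∀ x : G ⧸ H, ∃ γ ∈ Γ, ∃ y ∈ K, γ • y = x) : False := by
  have had : a ≠ d := fun h => haD (h ▸ hd)
  have hval : Continuous (fun g : GL ι ℝ => (g : Matrix ι ι ℝ)) := Units.continuous_val
  have hGc : IsClosed (G : Set (GL ι ℝ)) := by
    have : (G : Set (GL ι ℝ)) = {g : GL ι ℝ | (g : Matrix ι ι ℝ).det = 1} ∩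
        {g : GL ι ℝ | (g : Matrix ι ι ℝ)ᵀ * diagonal η * g = diagonal η} := by
      ext g; exact hG g
    rw [this]
    refine (isClosed_eq hval.matrix_det continuous_const).inter (isClosed_eq ?_ continuous_const)
    exact (hval.matrix_transpose.matrix_mul continuous_const).matrix_mul hval
  have hemb : IsClosedEmbedding (fun g : G => Units.embedProduct (Matrix ι ι ℝ) (g : GL ι ℝ)) :=
    Units.isClosedEmbedding_embedProduct.comp hGc.isClosedEmbedding_subtypeVal
  have : LocallyCompactSpace (Matrix ι ι ℝ) := inferInstanceAs (LocallyCompactSpace (ι → ι → ℝ))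
  have : LocallyCompactSpace G := hemb.locallyCompactSpace
  -- the compact set
  let Q : Set (Matrix ι ι ℝ) := Set.pi univ fun _ => Set.pi univ fun _ => Icc (-1 : ℝ) 1
  have hQ : IsCompact Q := isCompact_univ_pi fun _ => isCompact_univ_pi fun _ => isCompact_Icc
  have hQT : ∀ A : Matrix ι ι ℝ, Aᵀ * A = 1 → A ∈ Q := by
    intro A hA i _ j _
    have h := congrFun (congrFun hA j) j
    rw [mul_apply, one_apply_eq] at h
    have h2 := Finset.single_le_sum (f := fun x => Aᵀ j x * A x j)
      (fun x _ => mul_self_nonneg (A x j)) (Finset.mem_univ i)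
    rw [h] at h2
    exact abs_le.1 (abs_le_one_iff_mul_self_le_one.2 h2)
  let C : Set G := (fun g : G => Units.embedProduct (Matrix ι ι ℝ) (g : GL ι ℝ)) ⁻¹'
    (Q ×ˢ (MulOpposite.op '' Q))
  have hC : IsCompact C :=
    hemb.isCompact_preimage (hQ.prod (hQ.image MulOpposite.continuous_op))
  have hCmem : ∀ g : G, ((g : GL ι ℝ) : Matrix ι ι ℝ)ᵀ * ((g : GL ι ℝ) : Matrix ι ι ℝ) = 1 →
      g ∈ C := by
    intro g hg
    refine ⟨hQT _ hg, _, hQT (((g : GL ι ℝ)⁻¹ : GL ι ℝ) : Matrix ι ι ℝ) ?_, rfl⟩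
    have h1 : (((g : GL ι ℝ)⁻¹ : GL ι ℝ) : Matrix ι ι ℝ) = ((g : GL ι ℝ) : Matrix ι ι ℝ)ᵀ :=
      (Units.eq_inv_of_mul_eq_one_left (mul_eq_one_comm.1 hg)).symm
    rw [h1, transpose_transpose]
    exact mul_eq_one_comm.1 hg
  have hinv : ∀ (g : GL ι ℝ) (x y : ι → ℝ), (g : Matrix ι ι ℝ) *ᵥ x = y →
      ((g⁻¹ : GL ι ℝ) : Matrix ι ι ℝ) *ᵥ y = x := by
    rintro g x y rfl
    rw [mulVec_mulVec, ← Units.val_mul, inv_mul_cancel, Units.val_one, one_mulVec]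
  -- the intermediate subgroup
  let H' : Subgroup G :=
    { carrier := {g | ∀ j, D j → j ≠ d →
        ((g : GL ι ℝ) : Matrix ι ι ℝ) *ᵥ Pi.single j 1 = Pi.single j 1}
      one_mem' := by
        intro j _ _
        exact one_mulVec _
      mul_mem' := by
        intro g h hg hh j hj hjd
        change (((g : GL ι ℝ) : Matrix ι ι ℝ) * ((h : GL ι ℝ) : Matrix ι ι ℝ)) *ᵥ _ = _
        rw [← mulVec_mulVec, hh j hj hjd, hg j hj hjd]
      inv_mem' := by
        intro g hg j hj hjd
        exact hinv _ _ _ (hg j hj hjd) }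
  have hle : H ≤ H' := fun g hg j hj _ => (hH g).1 hg j hj
  have hdec : ∀ g ∈ H', ∃ c ∈ C, ∃ e ∈ C, c⁻¹ * g * e ∈ H := by
    intro g hg
    obtain ⟨w, w1, w2, w3, w4, w5, w6⟩ := exists_vector η hη D d hd hcard
      ((g : GL ι ℝ) : Matrix ι ι ℝ) ((hG _).1 g.2).2 hg
    obtain ⟨r, r1, r2, r3, r4, r5⟩ := exists_rotation η hη d a had w w3 w1
    obtain ⟨c, c1, c2, c3, c4, c5⟩ := exists_rotation η hη d a had _ w4 w2
    refine ⟨⟨c, (hG c).2 ⟨c1, c2⟩⟩, hCmem _ c3, ⟨r, (hG r).2 ⟨r1, r2⟩⟩, hCmem _ r3, ?_⟩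
    refine (hH _).2 fun j hj => ?_
    change (((c⁻¹ : GL ι ℝ) : Matrix ι ι ℝ) * ((g : GL ι ℝ) : Matrix ι ι ℝ) *
      (r : Matrix ι ι ℝ)) *ᵥ _ = _
    rw [← mulVec_mulVec, ← mulVec_mulVec]
    by_cases hjd : j = d
    · subst hjd
      rw [r4]
      exact hinv _ _ _ c4
    · have hja : j ≠ a := fun h => haD (h ▸ hj)
      rw [r5 j hja hjd (w5 j hj hjd), hg j hj hjd]
      exact hinv _ _ _ (c5 j hja hjd (w6 j hj hjd))
  obtain ⟨M, hM, hMH⟩ := compact_mod H H' Γ hle C hC hdec hpd K hK hcov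
  have hcont : Continuous (fun g : G => ((g : GL ι ℝ) : Matrix ι ι ℝ) d d) :=
    (hval.comp continuous_subtype_val).matrix_elem d d
  obtain ⟨B, hB⟩ := hM.exists_bound_of_continuousOn hcont.continuousOn
  obtain ⟨r, r1, r2, r3, r4⟩ := exists_boost η hη d a a had ha B
  obtain ⟨m, hm, h, hh, hmh⟩ := hMH ⟨r, (hG r).2 ⟨r1, r2⟩⟩ (fun j hj hjd =>
    have hja : j ≠ a := fun h => haD (h ▸ hj)
    r4 j hja hjd hja)
  have e1 : (r : Matrix ι ι ℝ) = ((m : GL ι ℝ) : Matrix ι ι ℝ) * ((h : GL ι ℝ) : Matrix ι ι ℝ) :=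
    congrArg (fun g : G => ((g : GL ι ℝ) : Matrix ι ι ℝ)) hmh
  have e2 : (r : Matrix ι ι ℝ) *ᵥ Pi.single d 1 =
      ((m : GL ι ℝ) : Matrix ι ι ℝ) *ᵥ Pi.single d 1 := by
    rw [e1, ← mulVec_mulVec, (hH h).1 hh d hd]
  have e3 := congrFun e2 d
  simp only [mulVec_single_one, col_apply] at e3
  rw [e3] at r3
  exact absurd (hB m hm) (not_le.2 r3)

end Mat

end CKForm

/-- **Constantine.**  Let `k ≥ 2`, `l ≥ 3`, `n − k ≥ 1`, `m − l ≥ 1`.  Let `G = SO(n,m)`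
(realized as the subgroup of `GL(n+m, ℝ)` of determinant-one matrices preserving the form of
signature `(n,m)`), and let `H ≤ G` be the subgroup of elements fixing pointwise the standard
basis vectors `e_{n−k+1}, …, e_n` and `e_{n+m−l+1}, …, e_{n+m}` (a block-embedded copy of
`SO(n−k, m−l)`).  Then no discrete subgroup `Γ` of `G` acts freely, properly discontinuously
and cocompactly on `G/H` by left multiplication: `SO(n−k,m−l)\SO(n,m)` admits no compact
Clifford–Klein form. -/
theorem constantine_no_compact_form (n m k l : ℕ)
    (hk : 2 ≤ k) (hl : 3 ≤ l) (hnk : k + 1 ≤ n) (hml : l + 1 ≤ m)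
    (G : Subgroup (Matrix.GeneralLinearGroup (Fin (n + m)) ℝ))
    (hG : (G : Set (Matrix.GeneralLinearGroup (Fin (n + m)) ℝ)) =
      {g : Matrix.GeneralLinearGroup (Fin (n + m)) ℝ |
        (g : Matrix (Fin (n + m)) (Fin (n + m)) ℝ).det = 1 ∧
        (g : Matrix (Fin (n + m)) (Fin (n + m)) ℝ)ᵀ * pseudoForm n m * g = pseudoForm n m})
    (H : Subgroup G)
    (hH : (H : Set G) =
      {g : G | ∀ j : Fin (n + m),
        ((n - k ≤ (j : ℕ) ∧ (j : ℕ) < n) ∨ n + m - l ≤ (j : ℕ)) →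
        ((g : Matrix.GeneralLinearGroup (Fin (n + m)) ℝ) :
            Matrix (Fin (n + m)) (Fin (n + m)) ℝ).mulVec (Pi.single j 1) = Pi.single j 1})
    (Γ : Subgroup G)
    (hdisc : DiscreteTopology Γ) :
    ¬ ((∀ γ : Γ, (∃ x : G ⧸ H, (γ : G) • x = x) → γ = 1) ∧
        (∀ K L : Set (G ⧸ H), IsCompact K → IsCompact L →
          {γ : Γ | ∃ x ∈ K, ((γ : G) • x) ∈ L}.Finite) ∧
        (∃ K : Set (G ⧸ H), IsCompact K ∧
          ∀ x : G ⧸ H, ∃ γ ∈ Γ, ∃ y ∈ K, γ • y = x)) := by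
  rintro ⟨-, hpd, K, hK, hcov⟩
  have hG' : ∀ g, g ∈ G ↔ (g : Matrix (Fin (n + m)) (Fin (n + m)) ℝ).det = 1 ∧
      (g : Matrix (Fin (n + m)) (Fin (n + m)) ℝ)ᵀ *
        Matrix.diagonal (fun i : Fin (n + m) => if (i : ℕ) < n then (1 : ℝ) else -1) * g =
        Matrix.diagonal (fun i : Fin (n + m) => if (i : ℕ) < n then (1 : ℝ) else -1) := by
    intro g
    rw [← SetLike.mem_coe, hG]
    rfl
  have hH' : ∀ g : G, g ∈ H ↔ ∀ j : Fin (n + m),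
      ((n - k ≤ (j : ℕ) ∧ (j : ℕ) < n) ∨ n + m - l ≤ (j : ℕ)) →
        ((g : Matrix.GeneralLinearGroup (Fin (n + m)) ℝ) :
            Matrix (Fin (n + m)) (Fin (n + m)) ℝ).mulVec (Pi.single j 1) = Pi.single j 1 := by
    intro g
    rw [← SetLike.mem_coe, hH]
    rfl
  have hη : ∀ i : Fin (n + m), (if (i : ℕ) < n then (1 : ℝ) else -1) = 1 ∨
      (if (i : ℕ) < n then (1 : ℝ) else -1) = -1 := by
    intro i; split_ifs <;> simp
  have hone : (1 : ℝ) ≠ -1 := by norm_num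
  have hone' : (-1 : ℝ) ≠ 1 := by norm_num
  have ep : ∀ i : ℕ, (if i < n then (1 : ℝ) else -1) = 1 ↔ i < n := by
    intro i; split_ifs with h <;> simp [h, hone']
  have en : ∀ i : ℕ, (if i < n then (1 : ℝ) else -1) = -1 ↔ ¬ i < n := by
    intro i; split_ifs with h <;> simp [h, hone]
  rcases le_total (n - k) (m - l) with hle | hle
  · refine CKForm.no_compact_form _ hη _ ⟨n + m - 1, by omega⟩ ⟨0, by omega⟩
      (Or.inr (by simp only; omega)) (by simp only; omega) ?_ ?_ G hG' H hH' Γ hpd K hK hcov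
    · have h1 : ¬ (n + m - 1 < n) := by omega
      have h2 : 0 < n := by omega
      simp [h1, h2]
    · have h1 : ¬ (n + m - 1 < n) := by omega
      simp only [h1, if_false, ne_eq, en, not_not]
      refine Nat.card_le_card_of_injective
        (fun i => ⟨⟨n + (i.1 : ℕ), ?_⟩, ?_⟩) ?_
      · have := i.2; omega
      · have := i.2; simp only; omega
      · intro i j hij
        simp only [Subtype.mk.injEq, Fin.mk.injEq] at hij
        exact Subtype.ext (Fin.ext (by omega))
  · refine CKForm.no_compact_form _ hη _ ⟨n - 1, by omega⟩ ⟨n, by omega⟩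
      (Or.inl (by simp only; omega)) (by simp only; omega) ?_ ?_ G hG' H hH' Γ hpd K hK hcov
    · have h1 : n - 1 < n := by omega
      simp [h1]
    · have h1 : n - 1 < n := by omega
      simp only [h1, if_true, ne_eq, ep]
      refine Nat.card_le_card_of_injective
        (fun i => ⟨⟨(i.1 : ℕ) - n, ?_⟩, ?_⟩) ?_
      · have := i.1.2; omega
      · have := i.2; have := i.1.2; simp only; omega
      · intro i j hij
        have h2 := i.2
        have h3 := j.2
        simp only [Subtype.mk.injEq, Fin.mk.injEq] at hij
        exact Subtype.ext (Fin.ext (by omega))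
end
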